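/- Assume that for every degree m ≤ n, every GC_m set possesses a maximal line (the GM conjecture up to degree n). Let X be a GC_n set and let ℓ be a k-node line of X with 2 ≤ k ≤ n+1. Then either X_ℓ = ∅, or there exists an integer s with 2k − n − 1 ≤ s ≤ k such that |X_ℓ| = s(s−1)/2 (i.e., binomial(s,2)). -/

import Mathlib

open MvPolynomial

/-- Bivariate real polynomials. -/
abbrev Poly2 : Type := MvPolynomial (Fin 2) ℝ

/-- Evaluation of a bivariate polynomial at a point of `ℝ²`. -/
noncomputable def evalPt (p : Poly2) (A : ℝ × ℝ) : ℝ :=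
  MvPolynomial.eval (fun i => if i = 0 then A.1 else A.2) p

/-- `X` is an `n`-poised set: it has `(n+2 choose 2)` nodes and the only polynomial of
total degree at most `n` vanishing on all of `X` is the zero polynomial. -/
def IsPoised (n : ℕ) (X : Finset (ℝ × ℝ)) : Prop :=
  X.card = (n + 2).choose 2 ∧
    ∀ p : Poly2, p.totalDegree ≤ n → (∀ A ∈ X, evalPt p A = 0) → p = 0

/-- `p` is an `n`-fundamental polynomial of the node `A` with respect to `X`. -/
def IsFund (n : ℕ) (X : Finset (ℝ × ℝ)) (A : ℝ × ℝ) (p : Poly2) : Prop :=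
  p.totalDegree ≤ n ∧ evalPt p A = 1 ∧ ∀ B ∈ X, B ≠ A → evalPt p B = 0

/-- `X` is a `GC_n` set: `n`-poised and each node has a fundamental polynomial which is
a product of `n` polynomials of degree 1. -/
def IsGC (n : ℕ) (X : Finset (ℝ × ℝ)) : Prop :=
  IsPoised n X ∧
    ∀ A ∈ X, ∃ p : Poly2, IsFund n X A p ∧
      ∃ f : Fin n → Poly2, (∀ i, (f i).totalDegree = 1) ∧ p = ∏ i, f i

/-- The nodes of `X` lying on the zero set of `ℓ`. -/
noncomputable def nodesOn (X : Finset (ℝ × ℝ)) (ℓ : Poly2) : Finset (ℝ × ℝ) :=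
  @Finset.filter _ (fun A => evalPt ℓ A = 0) (Classical.decPred _) X

/-- `ℓ` is a `k`-node line of `X`: it has degree exactly 1 and passes through exactly
`k` nodes of `X`. -/
def IsKNodeLine (X : Finset (ℝ × ℝ)) (ℓ : Poly2) (k : ℕ) : Prop :=
  ℓ.totalDegree = 1 ∧ (nodesOn X ℓ).card = k

/-- A maximal line of an `n`-poised set: an `(n+1)`-node line. -/
def IsMaximalLine (n : ℕ) (X : Finset (ℝ × ℝ)) (ℓ : Poly2) : Prop :=
  IsKNodeLine X ℓ (n + 1)

/-- The zero set of a polynomial, i.e. the line it determines when it has degree 1. -/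
def zeroSet (ℓ : Poly2) : Set (ℝ × ℝ) := {A | evalPt ℓ A = 0}

/-- `μ(X)`: the number of maximal lines (as subsets of the plane) of `X`. -/
noncomputable def mu (n : ℕ) (X : Finset (ℝ × ℝ)) : ℕ :=
  {L : Set (ℝ × ℝ) | ∃ ℓ : Poly2, IsMaximalLine n X ℓ ∧ L = zeroSet ℓ}.ncard

/-- The node `A` of `X` uses the line `ℓ`: `ℓ` divides a fundamental polynomial of `A`. -/
def Uses (n : ℕ) (X : Finset (ℝ × ℝ)) (ℓ : Poly2) (A : ℝ × ℝ) : Prop :=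
  ∃ p : Poly2, IsFund n X A p ∧ ℓ ∣ p

/-- `X_ℓ`: the set of nodes of `X` using the line `ℓ`. -/
noncomputable def usesSet (n : ℕ) (X : Finset (ℝ × ℝ)) (ℓ : Poly2) : Finset (ℝ × ℝ) :=
  @Finset.filter _ (Uses n X ℓ) (Classical.decPred _) X

/-- The Gasca–Maeztu conjecture for degree `m`: every `GC_m` set has a maximal line. -/
def GM (m : ℕ) : Prop :=
  ∀ Y : Finset (ℝ × ℝ), IsGC m Y → ∃ lam : Poly2, IsMaximalLine m Y lam

theorem evalPt_mul (p q : Poly2) (A : ℝ × ℝ) : evalPt (p * q) A = evalPt p A * evalPt q A := by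
  simp [evalPt]

theorem evalPt_add (p q : Poly2) (A : ℝ × ℝ) : evalPt (p + q) A = evalPt p A + evalPt q A := by
  simp [evalPt]

theorem evalPt_sub (p q : Poly2) (A : ℝ × ℝ) : evalPt (p - q) A = evalPt p A - evalPt q A := by
  simp [evalPt]

theorem evalPt_C (c : ℝ) (A : ℝ × ℝ) : evalPt (C c) A = c := by
  simp [evalPt]

theorem evalPt_one (A : ℝ × ℝ) : evalPt 1 A = 1 := by
  simp [evalPt]

theorem evalPt_zero (A : ℝ × ℝ) : evalPt 0 A = 0 := by
  simp [evalPt]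

theorem evalPt_X0 (A : ℝ × ℝ) : evalPt (X 0) A = A.1 := by
  simp [evalPt]

theorem evalPt_X1 (A : ℝ × ℝ) : evalPt (X 1) A = A.2 := by
  simp [evalPt]

theorem evalPt_prod {n : ℕ} (f : Fin n → Poly2) (A : ℝ × ℝ) :
    evalPt (∏ i, f i) A = ∏ i, evalPt (f i) A := by
  simp [evalPt]

/-- the affine polynomial `a x + b y + c` -/
noncomputable def lin (a b c : ℝ) : Poly2 := C a * X 0 + C b * X 1 + C c

theorem evalPt_lin (a b c : ℝ) (A : ℝ × ℝ) : evalPt (lin a b c) A = a * A.1 + b * A.2 + c := by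
  simp [lin, evalPt_add, evalPt_mul, evalPt_C, evalPt_X0, evalPt_X1]

theorem finsupp_deg_le_one (m : Fin 2 →₀ ℕ) (h : (m.sum fun _ e => e) ≤ 1) :
    m = 0 ∨ m = Finsupp.single 0 1 ∨ m = Finsupp.single 1 1 := by
  rw [Finsupp.sum_fintype _ _ (by simp)] at h
  simp only [Fin.sum_univ_two] at h
  have h3 : (m 0 = 0 ∧ m 1 = 0) ∨ (m 0 = 1 ∧ m 1 = 0) ∨ (m 0 = 0 ∧ m 1 = 1) := by omega
  rcases h3 with ⟨h0, h1⟩ | ⟨h0, h1⟩ | ⟨h0, h1⟩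
  · left; ext i; fin_cases i <;> simp [h0, h1]
  · right; left; ext i; fin_cases i <;> simp [h0, h1]
  · right; right; ext i; fin_cases i <;> simp [h0, h1]

theorem eq_lin_of_le_one {p : Poly2} (h : p.totalDegree ≤ 1) :
    ∃ a b c, p = lin a b c := by
  refine ⟨coeff (Finsupp.single 0 1) p, coeff (Finsupp.single 1 1) p, coeff 0 p, ?_⟩
  ext m
  by_cases hm : (m.sum fun _ e => e) ≤ 1
  · have e10 : (Finsupp.single (1 : Fin 2) 1) ≠ (Finsupp.single (0 : Fin 2) 1) := by
      intro h; have := DFunLike.congr_fun h 0; simp at this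
    have e01 : (Finsupp.single (0 : Fin 2) 1) ≠ (Finsupp.single (1 : Fin 2) 1) := fun h => e10 h.symm
    rcases finsupp_deg_le_one m hm with rfl | rfl | rfl
    · simp [lin]
    · have : (0 : Fin 2 →₀ ℕ) ≠ Finsupp.single 0 1 := by
        intro h; have := DFunLike.congr_fun h 0; simp at this
      simp [lin, coeff_C, coeff_X, this, e10]
    · have : (0 : Fin 2 →₀ ℕ) ≠ Finsupp.single 1 1 := by
        intro h; have := DFunLike.congr_fun h 1; simp at this
      simp [lin, coeff_C, coeff_X, this, e01]
  · push Not at hm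
    rw [coeff_eq_zero_of_totalDegree_lt (lt_of_le_of_lt h hm)]
    symm
    have h2 : (lin (coeff (Finsupp.single 0 1) p) (coeff (Finsupp.single 1 1) p) (coeff 0 p)).totalDegree ≤ 1 := by
      unfold lin
      refine (totalDegree_add _ _).trans (max_le ((totalDegree_add _ _).trans (max_le ?_ ?_)) ?_)
      · exact (totalDegree_mul _ _).trans (by simp)
      · exact (totalDegree_mul _ _).trans (by simp)
      · simp
    exact coeff_eq_zero_of_totalDegree_lt (lt_of_le_of_lt h2 hm)

theorem lin_deg_le (a b c : ℝ) : (lin a b c).totalDegree ≤ 1 := by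
  unfold lin
  refine (totalDegree_add _ _).trans (max_le ((totalDegree_add _ _).trans (max_le ?_ ?_)) ?_)
  · exact (totalDegree_mul _ _).trans (by simp)
  · exact (totalDegree_mul _ _).trans (by simp)
  · simp

theorem lin_deg {a b c : ℝ} (h : a ≠ 0 ∨ b ≠ 0) : (lin a b c).totalDegree = 1 := by
  refine le_antisymm (lin_deg_le a b c) ?_
  by_contra hh
  have h0 : (lin a b c).totalDegree = 0 := by omega
  rw [totalDegree_eq_zero_iff_eq_C] at h0
  have h1 := congrArg (fun p => evalPt p (0, 0)) h0
  have h2 := congrArg (fun p => evalPt p (1, 0)) h0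
  have h3 := congrArg (fun p => evalPt p (0, 1)) h0
  simp only [evalPt_lin, evalPt_C] at h1 h2 h3
  rcases h with h | h <;> apply h <;> linarith

theorem lin_form {p : Poly2} (h : p.totalDegree = 1) :
    ∃ a b c, p = lin a b c ∧ (a ≠ 0 ∨ b ≠ 0) := by
  obtain ⟨a, b, c, rfl⟩ := eq_lin_of_le_one h.le
  refine ⟨a, b, c, rfl, ?_⟩
  by_contra hh
  push Not at hh
  rw [hh.1, hh.2] at h
  simp [lin] at h

/-- strict degree bound, with the zero polynomial allowed for every bound -/
def DegLT (p : Poly2) (d : ℕ) : Prop := p = 0 ∨ p.totalDegree < d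

theorem DegLT.mul_cancel {l q : Poly2} (hl : l.totalDegree = 1) {d : ℕ} (h : DegLT (l * q) (d + 1)) :
    DegLT q d := by
  have hl0 : l ≠ 0 := by rintro rfl; simp at hl
  rcases h with h | h
  · left; exact (mul_eq_zero.1 h).resolve_left hl0
  · by_cases hq : q = 0
    · left; exact hq
    · right
      rw [totalDegree_mul_of_isDomain hl0 hq] at h
      omega

theorem DegLT.zero {q : Poly2} (h : DegLT q 0) : q = 0 := by
  rcases h with h | h
  · exact h
  · omega

theorem degLT_of_le {p : Poly2} {d : ℕ} (h : p.totalDegree ≤ d) : DegLT p (d + 1) := Or.inr (by omega)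

theorem DegLT.mono {p : Poly2} {d e : ℕ} (h : DegLT p d) (hde : d ≤ e) : DegLT p e := by
  rcases h with h | h
  · exact Or.inl h
  · exact Or.inr (by omega)

theorem DegLT.sub {p q : Poly2} {d : ℕ} (h : DegLT p d) (h' : DegLT q d) : DegLT (p - q) d := by
  rcases h with rfl | h
  · rcases h' with rfl | h'
    · left; simp
    · right; rw [zero_sub, totalDegree_neg]; exact h'
  · rcases h' with rfl | h'
    · right; simpa using h
    · right; exact lt_of_le_of_lt (totalDegree_sub _ _) (max_lt h h')

theorem DegLT.smul {p : Poly2} {d : ℕ} (c : ℝ) (h : DegLT p d) : DegLT (C c * p) d := by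
  rcases h with rfl | h
  · left; simp
  · right; exact lt_of_le_of_lt (totalDegree_mul _ _) (by simpa using h)

theorem DegLT.le {p : Poly2} {d : ℕ} (h : DegLT p (d + 1)) : p.totalDegree ≤ d := by
  rcases h with rfl | h
  · simp
  · omega

/-- restriction of a polynomial to a line, as a univariate polynomial -/
noncomputable def rst (a b c : ℝ) : Poly2 →ₐ[ℝ] Polynomial ℝ :=
  aeval (fun i : Fin 2 => if i = 0 then
    Polynomial.C (-c * a / (a ^ 2 + b ^ 2)) + Polynomial.C (b / (a ^ 2 + b ^ 2)) * Polynomial.X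
  else
    Polynomial.C (-c * b / (a ^ 2 + b ^ 2)) + Polynomial.C (-a / (a ^ 2 + b ^ 2)) * Polynomial.X)

noncomputable def lft (a b : ℝ) : Polynomial ℝ →ₐ[ℝ] Poly2 := Polynomial.aeval (C b * X 0 - C a * X 1)

theorem lin_dvd_sub_lft (a b c : ℝ) (h : a ≠ 0 ∨ b ≠ 0) (p : Poly2) :
    lin a b c ∣ p - lft a b (rst a b c p) := by
  have hN : a ^ 2 + b ^ 2 ≠ 0 := by
    rcases h with h | h <;> positivity
  rw [← Ideal.mem_span_singleton, ← Ideal.Quotient.eq]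
  set π := Ideal.Quotient.mkₐ ℝ (Ideal.span {lin a b c}) with hπ
  have : π = (π.comp ((lft a b).comp (rst a b c))) := by
    apply MvPolynomial.algHom_ext
    intro i
    simp only [AlgHom.comp_apply, hπ, Ideal.Quotient.mkₐ_eq_mk]
    rw [Ideal.Quotient.eq, Ideal.mem_span_singleton]
    fin_cases i
    · refine ⟨C (a / (a ^ 2 + b ^ 2)), ?_⟩
      simp [rst, lft, lin, Polynomial.aeval_C, MvPolynomial.algebraMap_eq]
      apply MvPolynomial.funext
      intro x
      simp
      field_simp
      ring
    · refine ⟨C (b / (a ^ 2 + b ^ 2)), ?_⟩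
      simp [rst, lft, lin, Polynomial.aeval_C, MvPolynomial.algebraMap_eq]
      apply MvPolynomial.funext
      intro x
      simp
      field_simp
      ring
  exact DFunLike.congr_fun this p

theorem rst_lin (a b c : ℝ) (h : a ≠ 0 ∨ b ≠ 0) : rst a b c (lin a b c) = 0 := by
  have hN : a ^ 2 + b ^ 2 ≠ 0 := by
    rcases h with h | h <;> positivity
  apply Polynomial.funext
  intro x
  simp [rst, lin, MvPolynomial.algebraMap_eq]
  field_simp
  ring

theorem lin_dvd_iff (a b c : ℝ) (h : a ≠ 0 ∨ b ≠ 0) (p : Poly2) :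
    lin a b c ∣ p ↔ rst a b c p = 0 := by
  constructor
  · rintro ⟨q, rfl⟩
    rw [map_mul, rst_lin a b c h, zero_mul]
  · intro h0
    have := lin_dvd_sub_lft a b c h p
    rwa [h0, map_zero, sub_zero] at this

theorem rst_eval (a b c : ℝ) (h : a ≠ 0 ∨ b ≠ 0) (p : Poly2) (A : ℝ × ℝ)
    (hA : a * A.1 + b * A.2 + c = 0) :
    Polynomial.eval (b * A.1 - a * A.2) (rst a b c p) = evalPt p A := by
  obtain ⟨q, hq⟩ := lin_dvd_sub_lft a b c h p
  have h1 := congrArg (fun p => evalPt p A) hq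
  simp only [evalPt_sub, evalPt_mul, evalPt_lin, hA, zero_mul] at h1
  have h2 : ∀ r : Polynomial ℝ, evalPt (lft a b r) A = Polynomial.eval (b * A.1 - a * A.2) r := by
    intro r
    have : ((MvPolynomial.aeval (fun i : Fin 2 => if i = 0 then A.1 else A.2) : Poly2 →ₐ[ℝ] ℝ).comp (lft a b))
      = Polynomial.aeval (b * A.1 - a * A.2) := by
      apply Polynomial.algHom_ext
      simp [lft]
    have := DFunLike.congr_fun this r
    simpa [evalPt, MvPolynomial.aeval_eq_eval, Polynomial.aeval_def, Polynomial.eval₂_eq_eval_map] using this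
  rw [h2] at h1
  linarith

theorem dvd_of_zeros {l p : Poly2} (hl : l.totalDegree = 1) {d : ℕ} (hp : DegLT p d)
    (s : Finset (ℝ × ℝ)) (hs : d ≤ s.card) (h : ∀ A ∈ s, evalPt l A = 0 ∧ evalPt p A = 0) : l ∣ p := by
  obtain ⟨a, b, c, rfl, hab⟩ := lin_form hl
  rcases hp with rfl | hp
  · exact dvd_zero _
  rw [lin_dvd_iff a b c hab]
  have hN : a ^ 2 + b ^ 2 ≠ 0 := by
    rcases hab with h | h <;> positivity
  have hdeg : (rst a b c p).natDegree ≤ p.totalDegree * 1 := by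
    apply aeval_natDegree_le p le_rfl
    intro i
    split_ifs
    · exact Polynomial.natDegree_add_le_of_degree_le (by simp) ((Polynomial.natDegree_C_mul_le _ _).trans (by simp))
    · exact Polynomial.natDegree_add_le_of_degree_le (by simp) ((Polynomial.natDegree_C_mul_le _ _).trans (by simp))
  have hinj : Set.InjOn (fun A : ℝ × ℝ => b * A.1 - a * A.2) s := by
    intro A hA B hB hAB
    have h1 := (h A hA).1
    have h2 := (h B hB).1
    rw [evalPt_lin] at h1 h2
    simp only at hAB
    have e1 : (a ^ 2 + b ^ 2) * (A.1 - B.1) = 0 := by linear_combination a * (h1 - h2) + b * hAB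
    have e2 : (a ^ 2 + b ^ 2) * (A.2 - B.2) = 0 := by linear_combination b * (h1 - h2) - a * hAB
    have f1 := (mul_eq_zero.1 e1).resolve_left hN
    have f2 := (mul_eq_zero.1 e2).resolve_left hN
    exact Prod.ext (by linarith) (by linarith)
  apply Polynomial.eq_zero_of_natDegree_lt_card_of_eval_eq_zero' (rst a b c p) (s.image (fun A : ℝ × ℝ => b * A.1 - a * A.2))
  · intro x hx
    rw [Finset.mem_image] at hx
    obtain ⟨A, hA, rfl⟩ := hx
    have := h A hA
    rw [rst_eval a b c hab p A (by rw [← evalPt_lin]; exact this.1)]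
    exact this.2
  · rw [Finset.card_image_of_injOn hinj]
    omega

theorem prime_of_deg_one {l : Poly2} (hl : l.totalDegree = 1) : Prime l := by
  obtain ⟨a, b, c, rfl, hab⟩ := lin_form hl
  refine ⟨?_, ?_, ?_⟩
  · intro h; rw [h] at hl; simp at hl
  · intro h
    rw [MvPolynomial.isUnit_iff_totalDegree_of_isReduced] at h
    omega
  · intro p q
    rw [lin_dvd_iff a b c hab, lin_dvd_iff a b c hab, lin_dvd_iff a b c hab, map_mul, mul_eq_zero]
    exact id

/-- lines as point sets -/
def IsLine (L : Set (ℝ × ℝ)) : Prop := ∃ l : Poly2, l.totalDegree = 1 ∧ L = zeroSet l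

/-- nodes on a line -/
noncomputable def nd (X : Finset (ℝ × ℝ)) (L : Set (ℝ × ℝ)) : Finset (ℝ × ℝ) :=
  @Finset.filter _ (fun A => A ∈ L) (Classical.decPred _) X

/-- number of nodes on a line -/
noncomputable def cnt (X : Finset (ℝ × ℝ)) (L : Set (ℝ × ℝ)) : ℕ := (nd X L).card

/-- remove a line from a node set -/
noncomputable def rm (X : Finset (ℝ × ℝ)) (L : Set (ℝ × ℝ)) : Finset (ℝ × ℝ) :=
  @Finset.filter _ (fun A => A ∉ L) (Classical.decPred _) X

/-- maximal lines -/
def Mx (n : ℕ) (X : Finset (ℝ × ℝ)) (L : Set (ℝ × ℝ)) : Prop := IsLine L ∧ cnt X L = n + 1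

/-- GC sets under the standing assumption -/
def G (n : ℕ) (X : Finset (ℝ × ℝ)) : Prop := IsGC n X ∧ ∀ m ≤ n, GM m

/-- `K` is the next line of `L` -/
def Nx (n : ℕ) (X : Finset (ℝ × ℝ)) (L K : Set (ℝ × ℝ)) : Prop :=
  IsLine K ∧ cnt X K = n ∧ ∀ P ∈ X, P ∈ L → P ∉ K

/-- `A` is a node using the line `L` -/
def Us (n : ℕ) (X : Finset (ℝ × ℝ)) (L : Set (ℝ × ℝ)) (A : ℝ × ℝ) : Prop :=
  A ∈ X ∧ ∃ l p : Poly2, l.totalDegree = 1 ∧ L = zeroSet l ∧ IsFund n X A p ∧ l ∣ p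

theorem mem_nd {X : Finset (ℝ × ℝ)} {L : Set (ℝ × ℝ)} {A : ℝ × ℝ} : A ∈ nd X L ↔ A ∈ X ∧ A ∈ L := by
  simp [nd]

theorem mem_rm {X : Finset (ℝ × ℝ)} {L : Set (ℝ × ℝ)} {A : ℝ × ℝ} : A ∈ rm X L ↔ A ∈ X ∧ A ∉ L := by
  simp [rm]

theorem rm_comm (X : Finset (ℝ × ℝ)) (L K : Set (ℝ × ℝ)) : rm (rm X L) K = rm (rm X K) L := by
  ext A; simp only [mem_rm]; tauto

theorem card_rm (X : Finset (ℝ × ℝ)) (L : Set (ℝ × ℝ)) : (rm X L).card + cnt X L = X.card := by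
  classical
  have := Finset.card_filter_add_card_filter_not (s := X) (p := fun A => A ∈ L)
  unfold cnt nd rm
  rw [← this, add_comm]
  congr!

theorem mem_zeroSet {l : Poly2} {A : ℝ × ℝ} : A ∈ zeroSet l ↔ evalPt l A = 0 := Iff.rfl

theorem exists_two {l : Poly2} (hl : l.totalDegree = 1) :
    ∃ A B, A ≠ B ∧ evalPt l A = 0 ∧ evalPt l B = 0 := by
  obtain ⟨a, b, c, rfl, hab⟩ := lin_form hl
  have hN : a ^ 2 + b ^ 2 ≠ 0 := by
    rcases hab with h | h <;> positivity
  refine ⟨(-c * a / (a ^ 2 + b ^ 2), -c * b / (a ^ 2 + b ^ 2)),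
    (-c * a / (a ^ 2 + b ^ 2) + b, -c * b / (a ^ 2 + b ^ 2) - a), ?_, ?_, ?_⟩
  · intro h
    have h1 := congrArg Prod.fst h
    have h2 := congrArg Prod.snd h
    simp only at h1 h2
    have e1 : b = 0 := by linarith
    have e2 : a = 0 := by linarith
    rcases hab with hh | hh
    · exact hh e2
    · exact hh e1
  · rw [evalPt_lin]; field_simp; ring
  · rw [evalPt_lin]; field_simp; ring

theorem dvd_of_two {l l' : Poly2} (hl : l.totalDegree = 1) (hl' : l'.totalDegree = 1) {A B : ℝ × ℝ}
    (hAB : A ≠ B) (h1 : evalPt l A = 0) (h2 : evalPt l B = 0) (h3 : evalPt l' A = 0)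
    (h4 : evalPt l' B = 0) : l ∣ l' := by
  classical
  apply dvd_of_zeros hl (d := 2) (Or.inr (by omega)) {A, B}
  · rw [Finset.card_pair hAB]
  · intro P hP
    simp only [Finset.mem_insert, Finset.mem_singleton] at hP
    rcases hP with rfl | rfl <;> simp [*]

theorem dvd_of_zeroSet {l l' : Poly2} (hl : l.totalDegree = 1) (hl' : l'.totalDegree = 1)
    (h : zeroSet l = zeroSet l') : l ∣ l' := by
  obtain ⟨A, B, hAB, h1, h2⟩ := exists_two hl
  refine dvd_of_two hl hl' hAB h1 h2 ?_ ?_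
  · rw [← mem_zeroSet, ← h]; exact h1
  · rw [← mem_zeroSet, ← h]; exact h2

theorem const_of_dvd {l l' : Poly2} (hl : l.totalDegree = 1) (hl' : l'.totalDegree = 1)
    (h : l ∣ l') : ∃ c : ℝ, c ≠ 0 ∧ l' = l * C c := by
  obtain ⟨q, rfl⟩ := h
  have hl0 : l ≠ 0 := by rintro rfl; simp at hl
  have hq0 : q ≠ 0 := by rintro rfl; simp at hl'
  rw [totalDegree_mul_of_isDomain hl0 hq0] at hl'
  have hq : q.totalDegree = 0 := by omega
  rw [totalDegree_eq_zero_iff_eq_C] at hq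
  refine ⟨_, ?_, by rw [← hq]⟩
  intro h; rw [h] at hq; simp at hq; exact hq0 hq

theorem zeroSet_of_dvd {l l' : Poly2} (hl : l.totalDegree = 1) (hl' : l'.totalDegree = 1)
    (h : l ∣ l') : zeroSet l = zeroSet l' := by
  obtain ⟨c, hc, rfl⟩ := const_of_dvd hl hl' h
  ext A
  simp [mem_zeroSet, evalPt_mul, evalPt_C, hc]

theorem line_eq {L K : Set (ℝ × ℝ)} (hL : IsLine L) (hK : IsLine K) {A B : ℝ × ℝ} (hAB : A ≠ B)
    (h1 : A ∈ L) (h2 : B ∈ L) (h3 : A ∈ K) (h4 : B ∈ K) : L = K := by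
  obtain ⟨l, hl, rfl⟩ := hL
  obtain ⟨k, hk, rfl⟩ := hK
  exact zeroSet_of_dvd hl hk (dvd_of_two hl hk hAB h1 h2 h3 h4)

theorem pt_eq {L K : Set (ℝ × ℝ)} (hL : IsLine L) (hK : IsLine K) (hLK : L ≠ K) {A B : ℝ × ℝ}
    (h1 : A ∈ L) (h2 : B ∈ L) (h3 : A ∈ K) (h4 : B ∈ K) : A = B := by
  by_contra h
  exact hLK (line_eq hL hK h h1 h2 h3 h4)

theorem exists_line {A B : ℝ × ℝ} (hAB : A ≠ B) : ∃ L, IsLine L ∧ A ∈ L ∧ B ∈ L := by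
  refine ⟨_, ⟨lin (A.2 - B.2) (B.1 - A.1) (A.1 * B.2 - A.2 * B.1), lin_deg ?_, rfl⟩, ?_, ?_⟩
  · by_contra h
    push Not at h
    exact hAB (Prod.ext (by linarith) (by linarith))
  · rw [mem_zeroSet, evalPt_lin]; ring
  · rw [mem_zeroSet, evalPt_lin]; ring

theorem fund_unique {n : ℕ} {X : Finset (ℝ × ℝ)} (hX : IsGC n X) {A : ℝ × ℝ} {p q : Poly2}
    (hp : IsFund n X A p) (hq : IsFund n X A q) : p = q := by
  rw [← sub_eq_zero]
  apply hX.1.2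
  · exact (totalDegree_sub _ _).trans (max_le hp.1 hq.1)
  · intro B hB
    rw [evalPt_sub]
    by_cases hBA : B = A
    · rw [hBA, hp.2.1, hq.2.1, sub_self]
    · rw [hp.2.2 B hB hBA, hq.2.2 B hB hBA, sub_self]

theorem dvd_of_nodes {L : Set (ℝ × ℝ)} {l p : Poly2} (hl : l.totalDegree = 1) (hL : L = zeroSet l)
    {d : ℕ} (hp : DegLT p d) (s : Finset (ℝ × ℝ)) (hs : d ≤ s.card)
    (h : ∀ A ∈ s, A ∈ L ∧ evalPt p A = 0) : l ∣ p := by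
  apply dvd_of_zeros hl hp s hs
  intro A hA
  obtain ⟨h1, h2⟩ := h A hA
  rw [hL] at h1
  exact ⟨h1, h2⟩

theorem cnt_le {n : ℕ} {X : Finset (ℝ × ℝ)} (hX : IsGC n X) {L : Set (ℝ × ℝ)} (hL : IsLine L) :
    cnt X L ≤ n + 1 := by
  by_contra h
  push Not at h
  obtain ⟨l, hl, rfl⟩ := hL
  have : 0 < (nd X (zeroSet l)).card := by unfold cnt at h; omega
  obtain ⟨A, hA⟩ := Finset.card_pos.1 this
  rw [mem_nd] at hA
  obtain ⟨p, hp, -⟩ := hX.2 A hA.1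
  have : l ∣ p := by
    apply dvd_of_nodes hl rfl (degLT_of_le hp.1) ((nd X (zeroSet l)).erase A)
    · rw [Finset.card_erase_of_mem (mem_nd.2 hA)]
      unfold cnt at h; omega
    · intro B hB
      rw [Finset.mem_erase, mem_nd] at hB
      exact ⟨hB.2.2, hp.2.2 B hB.2.1 hB.1⟩
  obtain ⟨q, rfl⟩ := this
  have h1 := hp.2.1
  rw [evalPt_mul, mem_zeroSet.1 hA.2, zero_mul] at h1
  exact zero_ne_one h1

theorem absorb {n : ℕ} {X : Finset (ℝ × ℝ)} {A : ℝ × ℝ} {q : Poly2} (hq : IsFund n X A q)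
    (c : ℝ) (g : Fin n → Poly2) (hg : ∀ i, (g i).totalDegree = 1) (h : q = C c * ∏ i, g i) :
    ∃ f : Fin n → Poly2, (∀ i, (f i).totalDegree = 1) ∧ q = ∏ i, f i := by
  have hc : c ≠ 0 := by
    rintro rfl
    have h1 := hq.2.1
    rw [h, C_0, zero_mul, evalPt_zero] at h1
    exact zero_ne_one h1
  cases n with
  | zero =>
    refine ⟨g, hg, ?_⟩
    have h1 := hq.2.1
    rw [h] at h1
    simp [evalPt_C] at h1
    rw [h, h1]; simp
  | succ n =>
    refine ⟨Fin.cons (C c * g 0) (fun i => g i.succ), ?_, ?_⟩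
    · intro i
      refine Fin.cases ?_ ?_ i
      · rw [Fin.cons_zero, totalDegree_mul_of_isDomain (by simpa using hc), hg, totalDegree_C]
        intro h; have := hg 0; rw [h] at this; simp at this
      · intro j; rw [Fin.cons_succ]; exact hg _
    · rw [h, Fin.prod_univ_succ, Fin.prod_univ_succ, Fin.cons_zero]
      simp only [Fin.cons_succ]
      ring

theorem fund_dvd {n : ℕ} {X : Finset (ℝ × ℝ)} {L : Set (ℝ × ℝ)} {l : Poly2} (hl : l.totalDegree = 1)
    (hL : L = zeroSet l) (hM : Mx n X L) {A : ℝ × ℝ} (hAL : A ∉ L) {p : Poly2} (hp : IsFund n X A p) :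
    l ∣ p := by
  apply dvd_of_nodes hl hL (degLT_of_le hp.1) (nd X L)
  · exact hM.2.ge
  · intro B hB
    rw [mem_nd] at hB
    refine ⟨hB.2, hp.2.2 B hB.1 ?_⟩
    rintro rfl; exact hAL hB.2

theorem fund_rm {n : ℕ} {X : Finset (ℝ × ℝ)} {L : Set (ℝ × ℝ)} {l : Poly2} (hl : l.totalDegree = 1)
    (hL : L = zeroSet l) {A : ℝ × ℝ} (hAL : A ∉ L) {q : Poly2}
    (hp : IsFund (n + 1) X A (l * q)) : IsFund n (rm X L) A (C (evalPt l A) * q) := by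
  subst hL
  rw [mem_zeroSet] at hAL
  refine ⟨?_, ?_, ?_⟩
  · refine ((DegLT.smul _ (DegLT.mul_cancel hl (degLT_of_le hp.1)))).le
  · rw [evalPt_mul, evalPt_C, ← evalPt_mul]; exact hp.2.1
  · intro B hB hBA
    rw [mem_rm] at hB
    have h1 := hp.2.2 B hB.1 hBA
    rw [evalPt_mul] at h1 ⊢
    have h2 := (mul_eq_zero.1 h1).resolve_left hB.2
    rw [h2, mul_zero]

theorem fund_up {n : ℕ} {X : Finset (ℝ × ℝ)} {L : Set (ℝ × ℝ)} {l : Poly2} (hl : l.totalDegree = 1)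
    (hL : L = zeroSet l) {A : ℝ × ℝ} (hAL : A ∉ L) {q : Poly2}
    (hp : IsFund n (rm X L) A q) : IsFund (n + 1) X A (C (evalPt l A)⁻¹ * (l * q)) := by
  subst hL
  have hAL' : evalPt l A ≠ 0 := hAL
  refine ⟨?_, ?_, ?_⟩
  · refine (DegLT.smul _ (degLT_of_le ?_)).le
    refine (totalDegree_mul _ _).trans ?_
    rw [hl]; have := hp.1; omega
  · rw [evalPt_mul, evalPt_C, evalPt_mul, hp.2.1]; field_simp
  · intro B hB hBA
    by_cases hBL : B ∈ zeroSet l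
    · rw [evalPt_mul, evalPt_mul, mem_zeroSet.1 hBL]; ring
    · rw [evalPt_mul, evalPt_mul, hp.2.2 B (mem_rm.2 ⟨hB, hBL⟩) hBA]; ring

theorem gc_rm {n : ℕ} {X : Finset (ℝ × ℝ)} (hX : IsGC (n + 1) X) {L : Set (ℝ × ℝ)}
    (hL : Mx (n + 1) X L) : IsGC n (rm X L) := by
  obtain ⟨l, hl, hLl⟩ := hL.1
  have hl0 : l ≠ 0 := by rintro rfl; simp at hl
  refine ⟨⟨?_, ?_⟩, ?_⟩
  · have h1 := card_rm X L
    rw [hL.2, hX.1.1, Nat.choose_succ_succ' (n + 2) 1] at h1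
    simp only [Nat.choose_one_right] at h1
    simp at h1
    omega
  · intro p hp hp0
    have : l * p = 0 := by
      apply hX.1.2
      · refine (totalDegree_mul _ _).trans ?_
        omega
      · intro A hA
        rw [evalPt_mul]
        by_cases hAL : A ∈ L
        · rw [hLl] at hAL; rw [mem_zeroSet.1 hAL, zero_mul]
        · rw [hp0 A (mem_rm.2 ⟨hA, hAL⟩), mul_zero]
    exact (mul_eq_zero.1 this).resolve_left hl0
  · intro A hA
    rw [mem_rm] at hA
    obtain ⟨p, hp, f, hf, hpf⟩ := hX.2 A hA.1
    have hd := fund_dvd hl hLl hL hA.2 hp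
    rw [hpf] at hd
    obtain ⟨i, -, hi⟩ := ((prime_of_deg_one hl).dvd_finsetProd_iff _).1 hd
    obtain ⟨c, hc, hfc⟩ := const_of_dvd hl (hf i) hi
    rw [Fin.prod_univ_succAbove f i, hfc, mul_assoc] at hpf
    rw [hpf] at hp
    have h2 := fund_rm hl hLl hA.2 hp
    refine ⟨_, h2, ?_⟩
    apply absorb h2 (evalPt l A * c) (fun j => f (i.succAbove j)) (fun j => hf _)
    rw [C_mul]; ring

theorem G.rm {n : ℕ} {X : Finset (ℝ × ℝ)} (hX : G (n + 1) X) {L : Set (ℝ × ℝ)}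
    (hL : Mx (n + 1) X L) : G n (rm X L) :=
  ⟨gc_rm hX.1 hL, fun m hm => hX.2 m (by omega)⟩

theorem nodesOn_eq (X : Finset (ℝ × ℝ)) (l : Poly2) : nodesOn X l = nd X (zeroSet l) := by
  ext A; simp [nodesOn, mem_nd, mem_zeroSet]

theorem G.ex {n : ℕ} {X : Finset (ℝ × ℝ)} (hX : G n X) : ∃ L, Mx n X L := by
  obtain ⟨l, hl⟩ := hX.2 n le_rfl X hX.1
  refine ⟨zeroSet l, ⟨l, hl.1, rfl⟩, ?_⟩
  rw [cnt, ← nodesOn_eq]; exact hl.2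

theorem us_zero {X : Finset (ℝ × ℝ)} {L : Set (ℝ × ℝ)} {A : ℝ × ℝ} : ¬ Us 0 X L A := by
  rintro ⟨-, l, p, hl, -, hp, q, rfl⟩
  have h := DegLT.mul_cancel (d := 0) hl (degLT_of_le hp.1)
  have h1 := hp.2.1
  rw [h.zero, mul_zero, evalPt_zero] at h1
  exact zero_ne_one h1

theorem Us.line {n : ℕ} {X : Finset (ℝ × ℝ)} {L : Set (ℝ × ℝ)} {A : ℝ × ℝ} (h : Us n X L A) : IsLine L := by
  obtain ⟨-, l, p, hl, h, -⟩ := h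
  exact ⟨l, hl, h⟩

theorem Us.not_mem {n : ℕ} {X : Finset (ℝ × ℝ)} {L : Set (ℝ × ℝ)} {A : ℝ × ℝ} (h : Us n X L A) : A ∉ L := by
  obtain ⟨-, l, p, hl, rfl, hp, q, rfl⟩ := h
  intro hA
  have h1 := hp.2.1
  rw [evalPt_mul, mem_zeroSet.1 hA, zero_mul] at h1
  exact zero_ne_one h1

theorem us_mx {n : ℕ} {X : Finset (ℝ × ℝ)} (hX : IsGC n X) {L : Set (ℝ × ℝ)} (hL : Mx n X L) {A : ℝ × ℝ}
    (hA : A ∈ X) (hAL : A ∉ L) : Us n X L A := by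
  obtain ⟨p, hp, -⟩ := hX.2 A hA
  obtain ⟨l, hl, hLl⟩ := hL.1
  exact ⟨hA, l, p, hl, hLl, hp, fund_dvd hl hLl hL hAL hp⟩

theorem us_down {n : ℕ} {X : Finset (ℝ × ℝ)} {L K : Set (ℝ × ℝ)}
    (hL : Mx (n + 1) X L) {A : ℝ × ℝ} (hAL : A ∉ L) (h : Us (n + 1) X K A) : K = L ∨ Us n (rm X L) K A := by
  obtain ⟨hA, k, p, hk, hKk, hp, hkp⟩ := h
  obtain ⟨l, hl, hLl⟩ := hL.1
  obtain ⟨q, rfl⟩ := fund_dvd hl hLl hL hAL hp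
  rcases (prime_of_deg_one hk).2.2 _ _ hkp with h | h
  · left; rw [hKk, hLl]; exact zeroSet_of_dvd hk hl h
  · right
    exact ⟨mem_rm.2 ⟨hA, hAL⟩, k, _, hk, hKk, fund_rm hl hLl hAL hp, h.mul_left _⟩

theorem us_up {n : ℕ} {X : Finset (ℝ × ℝ)} {L K : Set (ℝ × ℝ)}
    (hL : IsLine L) {A : ℝ × ℝ} (h : Us n (rm X L) K A) : Us (n + 1) X K A := by
  obtain ⟨hA, k, p, hk, hKk, hp, hkp⟩ := h
  obtain ⟨l, hl, hLl⟩ := hL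
  rw [mem_rm] at hA
  exact ⟨hA.1, k, _, hk, hKk, fund_up hl hLl hA.2 hp, (hkp.mul_left _).mul_left _⟩

theorem us_disj {n : ℕ} {X : Finset (ℝ × ℝ)} {L K : Set (ℝ × ℝ)}
    (hL : Mx n X L) (hd : ∀ P ∈ X, P ∈ L → P ∉ K) {A : ℝ × ℝ} (hAL : A ∈ L) : ¬ Us n X K A := by
  cases n with
  | zero => exact us_zero
  | succ n =>
    rintro ⟨hA, k, p, hk, hKk, hp, q, rfl⟩
    obtain ⟨l, hl, hLl⟩ := hL.1
    have hq := DegLT.mul_cancel hk (degLT_of_le hp.1)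
    have : l ∣ q := by
      apply dvd_of_nodes hl hLl hq ((nd X L).erase A)
      · rw [Finset.card_erase_of_mem (mem_nd.2 ⟨hA, hAL⟩)]
        have := hL.2; unfold cnt at this; omega
      · intro B hB
        rw [Finset.mem_erase, mem_nd] at hB
        have h1 := hp.2.2 B hB.2.1 hB.1
        have h2 := hd B hB.2.1 hB.2.2
        rw [evalPt_mul] at h1
        rw [hKk] at h2
        exact ⟨hB.2.2, (mul_eq_zero.1 h1).resolve_left h2⟩
    obtain ⟨r, rfl⟩ := this
    have h1 := hp.2.1
    rw [hLl] at hAL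
    rw [evalPt_mul, evalPt_mul, mem_zeroSet.1 hAL] at h1
    simp at h1

theorem cnt_rm_disj {X : Finset (ℝ × ℝ)} {L K : Set (ℝ × ℝ)} (h : ∀ P ∈ X, P ∈ L → P ∉ K) :
    cnt (rm X L) K = cnt X K := by
  unfold cnt
  congr 1
  ext P
  simp only [mem_nd, mem_rm]
  have := h P
  tauto

theorem cnt_rm_inter {X : Finset (ℝ × ℝ)} {L K : Set (ℝ × ℝ)} (hL : IsLine L) (hK : IsLine K) (hLK : L ≠ K)
    {P : ℝ × ℝ} (hP : P ∈ X) (hPL : P ∈ L) (hPK : P ∈ K) : cnt (rm X L) K + 1 = cnt X K := by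
  classical
  have : nd (rm X L) K = (nd X K).erase P := by
    ext Q
    simp only [mem_nd, mem_rm, Finset.mem_erase]
    constructor
    · rintro ⟨⟨h1, h2⟩, h3⟩
      exact ⟨fun h => h2 (h ▸ hPL), h1, h3⟩
    · rintro ⟨h1, h2, h3⟩
      exact ⟨⟨h2, fun h => h1 (pt_eq hL hK hLK h hPL h3 hPK)⟩, h3⟩
  unfold cnt
  rw [this, Finset.card_erase_of_mem (mem_nd.2 ⟨hP, hPK⟩)]
  have : 0 < (nd X K).card := Finset.card_pos.2 ⟨P, mem_nd.2 ⟨hP, hPK⟩⟩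
  omega

theorem meet {n : ℕ} {X : Finset (ℝ × ℝ)} (hX : IsGC n X) {L K : Set (ℝ × ℝ)} (hL : Mx n X L) (hK : Mx n X K) :
    ∃ P ∈ X, P ∈ L ∧ P ∈ K := by
  cases n with
  | zero =>
    have h1 : X.card = 1 := by simpa using hX.1.1
    obtain ⟨A, rfl⟩ := Finset.card_eq_one.1 h1
    have h2 : ∀ L, Mx 0 {A} L → A ∈ L := by
      intro L hL
      have : 0 < (nd {A} L).card := by have := hL.2; unfold cnt at this; omega
      obtain ⟨B, hB⟩ := Finset.card_pos.1 this
      rw [mem_nd, Finset.mem_singleton] at hB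
      rw [← hB.1]; exact hB.2
    exact ⟨A, by simp, h2 _ hL, h2 _ hK⟩
  | succ n =>
    by_contra h
    push Not at h
    have h1 := cnt_rm_disj h
    have h2 := cnt_le (gc_rm hX hL) hK.1
    rw [h1, hK.2] at h2
    omega

theorem mx_rm {n : ℕ} {X : Finset (ℝ × ℝ)} (hX : IsGC (n + 1) X) {L K : Set (ℝ × ℝ)} (hL : Mx (n + 1) X L)
    (hK : Mx (n + 1) X K) (hLK : L ≠ K) : Mx n (rm X L) K := by
  obtain ⟨P, hP, h1, h2⟩ := meet hX hL hK
  have := cnt_rm_inter hL.1 hK.1 hLK hP h1 h2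
  rw [hK.2] at this
  exact ⟨hK.1, by omega⟩

theorem us_adj {n : ℕ} {X : Finset (ℝ × ℝ)} (hX : IsGC n X) {L L' K : Set (ℝ × ℝ)} (hL : Mx n X L)
    (hL' : Mx n X L') (hLL : L ≠ L') {P : ℝ × ℝ} (hPL : P ∈ L) (hPL' : P ∈ L') (hPK : P ∈ K)
    (hK : K ≠ L) (hK' : K ≠ L') {A : ℝ × ℝ} (hA : A ∈ L) : ¬ Us n X K A := by
  intro h
  cases n with
  | zero => exact us_zero h
  | succ n =>
    have hAL' : A ∉ L' := by
      intro hA'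
      have : A = P := pt_eq hL.1 hL'.1 hLL hA hPL hA' hPL'
      exact h.not_mem (this ▸ hPK)
    rcases us_down hL' hAL' h with h1 | h1
    · exact hK' h1
    · refine us_disj (mx_rm hX hL' hL hLL.symm) ?_ hA h1
      intro Q hQ hQL hQK
      rw [mem_rm] at hQ
      have : Q = P := pt_eq hL.1 h.line hK.symm hQL hPL hQK hPK
      exact hQ.2 (this ▸ hPL')

theorem rm_mx_cases {n : ℕ} {X : Finset (ℝ × ℝ)} {L K : Set (ℝ × ℝ)} (hL : IsLine L)
    (hK : Mx n (rm X L) K) : (Mx (n + 1) X K ∧ L ≠ K) ∨ Nx (n + 1) X L K := by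
  have hLK : L ≠ K := by
    rintro rfl
    have : 0 < (nd (rm X L) L).card := by have := hK.2; unfold cnt at this; omega
    obtain ⟨B, hB⟩ := Finset.card_pos.1 this
    rw [mem_nd, mem_rm] at hB
    exact hB.1.2 hB.2
  by_cases h : ∃ P ∈ X, P ∈ L ∧ P ∈ K
  · left
    obtain ⟨P, hP, h1, h2⟩ := h
    have := cnt_rm_inter hL hK.1 hLK hP h1 h2
    have h3 := hK.2
    exact ⟨⟨hK.1, by omega⟩, hLK⟩
  · right
    push Not at h
    refine ⟨hK.1, ?_, h⟩
    rw [← cnt_rm_disj h, hK.2]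

theorem Nx.mx {n : ℕ} {X : Finset (ℝ × ℝ)} {L K : Set (ℝ × ℝ)} (h : Nx (n + 1) X L K) : Mx n (rm X L) K :=
  ⟨h.1, by rw [cnt_rm_disj h.2.2, h.2.1]⟩

theorem Nx.ne {n : ℕ} {X : Finset (ℝ × ℝ)} {L K : Set (ℝ × ℝ)} (h : Nx (n + 1) X L K) : L ≠ K := by
  rintro rfl
  have : 0 < (nd X L).card := by have := h.2.1; unfold cnt at this; omega
  obtain ⟨B, hB⟩ := Finset.card_pos.1 this
  rw [mem_nd] at hB
  exact h.2.2 B hB.1 hB.2 hB.2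

/-- maximal lines are never next lines -/
theorem Nx.not_mx {n : ℕ} {X : Finset (ℝ × ℝ)} {L K : Set (ℝ × ℝ)} (h : Nx n X L K) : ¬ Mx n X K := by
  intro hK
  have h1 := hK.2
  rw [h.2.1] at h1
  omega

/-- persistence of next lines -/
theorem Nx.persist {n : ℕ} {X : Finset (ℝ × ℝ)} (hX : IsGC (n + 1 + 1) X) {L K M : Set (ℝ × ℝ)} (hL : Mx (n + 1 + 1) X L)
    (h : Nx (n + 1 + 1) X L K) (hM : Mx (n + 1 + 1) X M) (hML : L ≠ M) : Nx (n + 1) (rm X M) L K := by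
  have hMK : M ≠ K := by rintro rfl; exact h.not_mx hM
  refine ⟨h.1, ?_, fun P hP => h.2.2 P (mem_rm.1 hP).1⟩
  obtain ⟨P, hP, h1, h2⟩ := meet (gc_rm hX hL) (mx_rm hX hL hM hML) h.mx
  have := cnt_rm_inter hM.1 h.1 hMK (mem_rm.1 hP).1 h1 h2
  have := h.2.1
  omega

theorem no_three {n : ℕ} {X : Finset (ℝ × ℝ)} (hX : IsGC (n + 1) X) {L K M : Set (ℝ × ℝ)} (hL : Mx (n + 1) X L)
    (hK : Mx (n + 1) X K) (hM : Mx (n + 1) X M) (h1 : L ≠ K) (h2 : L ≠ M) (h3 : K ≠ M) {P : ℝ × ℝ}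
    (hPL : P ∈ L) (hPK : P ∈ K) (hPM : P ∈ M) : False := by
  obtain ⟨Q, hQ, hQK, hQM⟩ := meet (gc_rm hX hL) (mx_rm hX hL hK h1) (mx_rm hX hL hM h2)
  have : Q = P := pt_eq hK.1 hM.1 h3 hQK hPK hQM hPM
  exact (mem_rm.1 hQ).2 (this ▸ hPL)

theorem fund_factor {n : ℕ} {X : Finset (ℝ × ℝ)} (hX : IsGC n X) {A P : ℝ × ℝ} (hA : A ∈ X) (hP : P ∈ X)
    (hPA : P ≠ A) : ∃ l g : Poly2, l.totalDegree = 1 ∧ evalPt l P = 0 ∧ IsFund n X A (l * g) := by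
  obtain ⟨p, hp, f, hf, hpf⟩ := hX.2 A hA
  have h0 := hp.2.2 P hP hPA
  rw [hpf, evalPt_prod, Finset.prod_eq_zero_iff] at h0
  obtain ⟨i, -, hi⟩ := h0
  obtain ⟨g, hg⟩ := Finset.dvd_prod_of_mem f (Finset.mem_univ i)
  refine ⟨f i, g, hf i, hi, ?_⟩
  rw [← hg, ← hpf]; exact hp

theorem not_dvd_nx {n : ℕ} {X : Finset (ℝ × ℝ)} {L K : Set (ℝ × ℝ)} (hL : Mx n X L) (hK : Nx n X L K)
    {A : ℝ × ℝ} (hA : A ∈ X) (hAL : A ∈ L) {p k : Poly2} (hp : IsFund n X A p) (hk : k.totalDegree = 1)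
    (hKk : K = zeroSet k) : ¬ k ∣ p := by
  intro h
  exact us_disj hL hK.2.2 hAL ⟨hA, k, p, hk, hKk, hp, h⟩

theorem t_lemma {m : ℕ} {X : Finset (ℝ × ℝ)} (hX : IsGC (m + 1 + 1) X) {L K1 K2 K3 : Set (ℝ × ℝ)}
    (hL : Mx (m + 1 + 1) X L) (h1 : Nx (m + 1 + 1) X L K1) (h2 : Nx (m + 1 + 1) X L K2) (h3 : Nx (m + 1 + 1) X L K3)
    (h12 : K1 ≠ K2) (h13 : K1 ≠ K3) (h23 : K2 ≠ K3) : False := by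
  classical
  have hY := gc_rm hX hL
  obtain ⟨P, hPY, hP1, hP2⟩ := meet hY h1.mx h2.mx
  have hP3 : P ∉ K3 := fun h => no_three hY h1.mx h2.mx h3.mx h12 h13 h23 hP1 hP2 h
  obtain ⟨hPX, hPL⟩ := mem_rm.1 hPY
  obtain ⟨l, hl, hLl⟩ := hL.1
  obtain ⟨k1, hk1, hK1⟩ := h1.1
  obtain ⟨k2, hk2, hK2⟩ := h2.1
  obtain ⟨k3, hk3, hK3⟩ := h3.1
  have step : ∀ A ∈ nd X L, ∃ f g D, f.totalDegree = 1 ∧ evalPt f P = 0 ∧ IsFund (m + 1 + 1) X A (f * g) ∧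
      D ∈ nd X K3 ∧ evalPt f D = 0 := by
    intro A hA
    rw [mem_nd] at hA
    obtain ⟨f, g, hf, hfP, hfg⟩ := fund_factor hX hA.1 hPX (fun h => hPL (h ▸ hA.2))
    by_contra hcon
    push Not at hcon
    have hn := hcon f g
    refine not_dvd_nx hL h3 hA.1 hA.2 hfg hk3 hK3 (Dvd.dvd.mul_left ?_ _)
    apply dvd_of_nodes hk3 hK3 (DegLT.mul_cancel hf (degLT_of_le hfg.1)) (nd X K3)
    · exact h3.2.1.ge
    · intro D hD
      refine ⟨(mem_nd.1 hD).2, ?_⟩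
      have h4 := hn D hf hfP hfg hD
      have h5 := hfg.2.2 D (mem_nd.1 hD).1 (fun h => h3.2.2 D (mem_nd.1 hD).1 (h ▸ hA.2) (mem_nd.1 hD).2)
      rw [evalPt_mul] at h5
      exact (mul_eq_zero.1 h5).resolve_left h4
  choose! f g D hf hfP hfg hD hfD using step
  obtain ⟨A, hA, A', hA', hAA, hDD⟩ := Finset.exists_ne_map_eq_of_card_lt_of_maps_to
    (s := nd X L) (t := nd X K3) (f := D) (by
      have e1 := hL.2
      have e2 := h3.2.1
      unfold cnt at e1 e2
      omega) hD
  -- the two factors coincide up to a constant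
  have hPD : P ≠ D A := fun h => hP3 (by rw [h]; exact (mem_nd.1 (hD A hA)).2)
  obtain ⟨c0, hc0, hfc⟩ := const_of_dvd (hf A hA) (hf A' hA') (dvd_of_two (hf A hA) (hf A' hA') hPD (hfP A hA)
    (hfD A hA) (hfP A' hA') (by rw [hDD]; exact hfD A' hA'))
  have q1 := hfg A hA
  have q2 := hfg A' hA'
  rw [hfc, mul_assoc] at q2
  set F := f A with hF
  set g1 := g A
  set g2 := C c0 * g A' with hg2
  have hF1 : F.totalDegree = 1 := hf A hA
  have hFP : evalPt F P = 0 := hfP A hA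
  rw [mem_nd] at hA hA'
  have dg1 := DegLT.mul_cancel hF1 (degLT_of_le q1.1)
  have dg2 := DegLT.mul_cancel hF1 (degLT_of_le q2.1)
  -- F does not vanish at the other nodes of K1, K2
  have nz : ∀ K k : _, Nx (m + 1 + 1) X L K → k.totalDegree = 1 → K = zeroSet k → P ∈ K →
      ∀ B ∈ nd X K, B ≠ P → evalPt F B ≠ 0 := by
    intro K k hK hk hKk hPK B hB hBP h0
    rw [mem_nd] at hB
    rw [hKk] at hPK hB
    exact not_dvd_nx hL hK hA.1 hA.2 q1 hk hKk
      ((dvd_of_two hk hF1 hBP hB.2 hPK h0 hFP).mul_right _)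
  have van : ∀ K k : _, Nx (m + 1 + 1) X L K → k.totalDegree = 1 → K = zeroSet k → P ∈ K →
      ∀ B ∈ nd X K, B ≠ P → evalPt g1 B = 0 ∧ evalPt g2 B = 0 := by
    intro K k hK hk hKk hPK B hB hBP
    have hz := nz K k hK hk hKk hPK B hB hBP
    rw [mem_nd] at hB
    have hBL : B ∉ L := fun h => hK.2.2 B hB.1 h hB.2
    have e1 := q1.2.2 B hB.1 (fun h => hBL (h ▸ hA.2))
    have e2 := q2.2.2 B hB.1 (fun h => hBL (h ▸ hA'.2))
    rw [evalPt_mul] at e1 e2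
    exact ⟨(mul_eq_zero.1 e1).resolve_left hz, (mul_eq_zero.1 e2).resolve_left hz⟩
  have hg2P : evalPt g2 P ≠ 0 := by
    intro h0
    refine not_dvd_nx hL h1 hA'.1 hA'.2 q2 hk1 hK1 (Dvd.dvd.mul_left ?_ _)
    apply dvd_of_nodes hk1 hK1 dg2 (nd X K1)
    · exact h1.2.1.ge
    · intro B hB
      refine ⟨(mem_nd.1 hB).2, ?_⟩
      by_cases hBP : B = P
      · rw [hBP]; exact h0
      · exact (van K1 k1 h1 hk1 hK1 hP1 B hB hBP).2
  set c := evalPt g1 P / evalPt g2 P with hc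
  set h := g1 - C c * g2 with hh
  have dh : DegLT h (m + 1 + 1) := dg1.sub (dg2.smul c)
  have hhP : evalPt h P = 0 := by
    rw [hh, evalPt_sub, evalPt_mul, evalPt_C, hc]; field_simp; ring
  have hh0 : ∀ B, evalPt g1 B = 0 ∧ evalPt g2 B = 0 → evalPt h B = 0 := by
    rintro B ⟨e1, e2⟩
    rw [hh, evalPt_sub, evalPt_mul, e1, e2]; ring
  have hd1 : k1 ∣ h := by
    apply dvd_of_nodes hk1 hK1 dh (nd X K1)
    · exact h1.2.1.ge
    · intro B hB
      refine ⟨(mem_nd.1 hB).2, ?_⟩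
      by_cases hBP : B = P
      · rw [hBP]; exact hhP
      · exact hh0 B (van K1 k1 h1 hk1 hK1 hP1 B hB hBP)
  obtain ⟨r1, hr1⟩ := hd1
  rw [hr1] at dh
  have dr1 := dh.mul_cancel hk1
  have hd2 : k2 ∣ r1 := by
    apply dvd_of_nodes hk2 hK2 dr1 ((nd X K2).erase P)
    · rw [Finset.card_erase_of_mem (mem_nd.2 ⟨hPX, hP2⟩)]
      have := h2.2.1; unfold cnt at this; omega
    · intro B hB
      rw [Finset.mem_erase] at hB
      refine ⟨(mem_nd.1 hB.2).2, ?_⟩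
      have e := hh0 B (van K2 k2 h2 hk2 hK2 hP2 B hB.2 hB.1)
      rw [hr1, evalPt_mul] at e
      refine (mul_eq_zero.1 e).resolve_left ?_
      intro e0
      apply hB.1
      refine pt_eq h1.1 h2.1 h12 ?_ hP1 (mem_nd.1 hB.2).2 hP2
      rw [hK1]; exact e0
  obtain ⟨r, hr⟩ := hd2
  rw [hr] at dr1
  have dr := dr1.mul_cancel hk2
  have hFA : evalPt F A ≠ 0 := by
    intro h0
    have := q1.2.1
    rw [evalPt_mul, h0, zero_mul] at this
    exact zero_ne_one this
  have hd3 : l ∣ r := by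
    apply dvd_of_nodes hl hLl dr ((((nd X L).erase A).erase A').filter (fun B => evalPt F B ≠ 0))
    · have e1 := Finset.card_filter_add_card_filter_not (s := ((nd X L).erase A).erase A') (p := fun B => evalPt F B ≠ 0)
      have e2 : ((((nd X L).erase A).erase A').filter (fun B => ¬ (evalPt F B ≠ 0))).card ≤ 1 := by
        rw [Finset.card_le_one]
        intro B hB B' hB'
        simp only [Finset.mem_filter, Finset.mem_erase, mem_nd, not_not] at hB hB'
        refine pt_eq hL.1 ⟨F, hF1, rfl⟩ ?_ hB.1.2.2.2 hB'.1.2.2.2 hB.2 hB'.2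
        rintro rfl
        exact hFA hA.2
      rw [Finset.card_erase_of_mem, Finset.card_erase_of_mem (mem_nd.2 hA)] at e1
      · have := hL.2; unfold cnt at this; omega
      · rw [Finset.mem_erase, mem_nd]; exact ⟨hAA.symm, hA'⟩
    · intro B hB
      simp only [Finset.mem_filter, Finset.mem_erase, mem_nd] at hB
      obtain ⟨⟨hBA', hBA, hBX, hBL⟩, hBF⟩ := hB
      refine ⟨hBL, ?_⟩
      have e1 := q1.2.2 B hBX hBA
      have e2 := q2.2.2 B hBX hBA'
      rw [evalPt_mul] at e1 e2
      have e := hh0 B ⟨(mul_eq_zero.1 e1).resolve_left hBF, (mul_eq_zero.1 e2).resolve_left hBF⟩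
      rw [hr1, hr, evalPt_mul, evalPt_mul] at e
      have n1 := h1.2.2 B hBX hBL
      have n2 := h2.2.2 B hBX hBL
      rw [hK1] at n1
      rw [hK2] at n2
      exact (mul_eq_zero.1 ((mul_eq_zero.1 e).resolve_left n1)).resolve_left n2
  obtain ⟨t, ht⟩ := hd3
  have hA2 := hA.2
  rw [hLl] at hA2
  have eA : evalPt h A = 0 := by
    rw [hr1, hr, ht, evalPt_mul, evalPt_mul, evalPt_mul, mem_zeroSet.1 hA2]; ring
  have e2 := q2.2.2 A hA.1 hAA
  rw [evalPt_mul] at e2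
  have e3 := (mul_eq_zero.1 e2).resolve_left hFA
  rw [hh, evalPt_sub, evalPt_mul, e3] at eA
  have e4 := q1.2.1
  rw [evalPt_mul, show evalPt g1 A = 0 by linarith, mul_zero] at e4
  exact zero_ne_one e4

def ThreeMx (n : ℕ) (X : Finset (ℝ × ℝ)) : Prop :=
  ∃ L1 L2 L3, Mx n X L1 ∧ Mx n X L2 ∧ Mx n X L3 ∧ L1 ≠ L2 ∧ L1 ≠ L3 ∧ L2 ≠ L3

theorem ThreeMx.other {n : ℕ} {X : Finset (ℝ × ℝ)} (h : ThreeMx n X) (K K' : Set (ℝ × ℝ)) :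
    ∃ L, Mx n X L ∧ L ≠ K ∧ L ≠ K' := by
  obtain ⟨L1, L2, L3, h1, h2, h3, h12, h13, h23⟩ := h
  by_contra hc
  push Not at hc
  have c1 := hc L1 h1
  have c2 := hc L2 h2
  have c3 := hc L3 h3
  by_cases e1 : L1 = K
  · have f2 := c2 (fun e => h12 (e1.trans e.symm))
    have f3 := c3 (fun e => h13 (e1.trans e.symm))
    exact h23 (f2.trans f3.symm)
  · have f1 := c1 e1
    by_cases e2 : L2 = K
    · exact h13 (f1.trans (c3 (fun e => h23 (e2.trans e.symm))).symm)
    · exact h12 (f1.trans (c2 e2).symm)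

theorem threeMx_one {X : Finset (ℝ × ℝ)} (hX : IsGC 1 X) : ThreeMx 1 X := by
  classical
  have h1 : X.card = 3 := by rw [hX.1.1]; rfl
  obtain ⟨A, B, D, hAB, hAD, hBD, rfl⟩ := Finset.card_eq_three.1 h1
  obtain ⟨L1, l1, a1, b1⟩ := exists_line hAB
  obtain ⟨L2, l2, a2, d2⟩ := exists_line hAD
  obtain ⟨L3, l3, b3, d3⟩ := exists_line hBD
  have no : ∀ L, IsLine L → A ∈ L → B ∈ L → D ∈ L → False := by
    intro L hL hA hB hD
    have e := cnt_le hX hL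
    have : nd {A, B, D} L = {A, B, D} := by
      ext P; rw [mem_nd]
      simp only [Finset.mem_insert, Finset.mem_singleton]
      constructor
      · exact fun h => h.1
      · rintro (rfl | rfl | rfl) <;> simp [*]
    rw [cnt, this, h1] at e
    omega
  have yes : ∀ L, IsLine L → ∀ P Q, P ≠ Q → P ∈ ({A, B, D} : Finset _) → Q ∈ ({A, B, D} : Finset _) → P ∈ L → Q ∈ L → Mx 1 {A, B, D} L := by
    intro L hL P Q hPQ hP hQ hPL hQL
    refine ⟨hL, le_antisymm (cnt_le hX hL) ?_⟩
    have : ({P, Q} : Finset _) ⊆ nd {A, B, D} L := by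
      intro R hR
      rw [Finset.mem_insert, Finset.mem_singleton] at hR
      rw [mem_nd]
      rcases hR with rfl | rfl
      · exact ⟨hP, hPL⟩
      · exact ⟨hQ, hQL⟩
    have := Finset.card_le_card this
    rw [Finset.card_pair hPQ] at this
    exact this
  refine ⟨L1, L2, L3, yes L1 l1 A B hAB (by simp) (by simp) a1 b1, yes L2 l2 A D hAD (by simp) (by simp) a2 d2,
    yes L3 l3 B D hBD (by simp) (by simp) b3 d3, ?_, ?_, ?_⟩
  · rintro rfl; exact no _ l1 a1 b1 d2
  · rintro rfl; exact no _ l1 a1 b1 d3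
  · rintro rfl; exact no _ l2 a2 b3 d3

def NxUnique (n : ℕ) : Prop := ∀ X L K K', G n X → Mx n X L → Nx n X L K → Nx n X L K' → K = K'

theorem nxUnique_two : NxUnique 2 := by
  classical
  intro X L K1 K2 hX hL h1 h2
  by_contra h12
  have hY := gc_rm (n := 1) hX.1 hL
  obtain ⟨K3, h3, h13, h23⟩ := (threeMx_one hY).other K1 K2
  rcases rm_mx_cases hL.1 h3 with ⟨h3', hLK3⟩ | h3'
  · obtain ⟨B, hB, hBL, hB3⟩ := meet hX.1 hL h3'
    obtain ⟨P, hP, hP1, hP2⟩ := meet hY (Nx.mx (n := 1) h1) (Nx.mx (n := 1) h2)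
    obtain ⟨D, hD, hD1, hD3⟩ := meet hY (Nx.mx (n := 1) h1) h3
    obtain ⟨E, hE, hE2, hE3⟩ := meet hY (Nx.mx (n := 1) h2) h3
    have hP3 : P ∉ K3 := fun h => no_three (n := 0) hY (Nx.mx (n := 1) h1) (Nx.mx (n := 1) h2) h3 h12 h13.symm h23.symm hP1 hP2 h
    have hPD : P ≠ D := by rintro rfl; exact hP3 hD3
    have hPE : P ≠ E := by rintro rfl; exact hP3 hE3
    have hDE : D ≠ E := by
      rintro rfl
      exact hPD (pt_eq h1.1 h2.1 h12 hP1 hD1 hP2 hE2)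
    have out : ∀ Q ∈ rm X L, Q ≠ B := by
      rintro Q hQ rfl; exact (mem_rm.1 hQ).2 hBL
    obtain ⟨f, g, hf, hfP, hfg⟩ := fund_factor hX.1 hB (mem_rm.1 hP).1 (out P hP)
    have key : ∀ K Q, Nx 2 X L K → P ∈ K → Q ∈ K → P ≠ Q → Q ∈ rm X L → evalPt g Q = 0 := by
      intro K Q hK hPK hQK hPQ hQ
      have e := hfg.2.2 Q (mem_rm.1 hQ).1 (out Q hQ)
      rw [evalPt_mul] at e
      refine (mul_eq_zero.1 e).resolve_left ?_
      intro e0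
      obtain ⟨k, hk, hKk⟩ := hK.1
      rw [hKk] at hPK hQK
      exact not_dvd_nx hL hK hB hBL hfg hk hKk ((dvd_of_two hk hf hPQ hPK hQK hfP e0).mul_right _)
    obtain ⟨k3, hk3, hK3⟩ := h3.1
    have hd : k3 ∣ g := by
      apply dvd_of_nodes hk3 hK3 (DegLT.mul_cancel hf (degLT_of_le hfg.1)) {D, E}
      · rw [Finset.card_pair hDE]
      · intro Q hQ
        rw [Finset.mem_insert, Finset.mem_singleton] at hQ
        rcases hQ with rfl | rfl
        · exact ⟨hD3, key K1 _ h1 hP1 hD1 hPD hD⟩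
        · exact ⟨hE3, key K2 _ h2 hP2 hE2 hPE hE⟩
    obtain ⟨r, rfl⟩ := hd
    have e := hfg.2.1
    rw [hK3] at hB3
    rw [evalPt_mul, evalPt_mul, mem_zeroSet.1 hB3] at e
    simp at e
  · exact t_lemma hX.1 hL h1 h2 h3' h12 h13.symm h23.symm

theorem pq_lemma (m : ℕ) : (∀ X, G (m + 1) X → ThreeMx (m + 1) X) ∧ NxUnique (m + 2) := by
  induction m with
  | zero => exact ⟨fun X hX => threeMx_one hX.1, nxUnique_two⟩
  | succ m ih =>
    obtain ⟨hP, hQ⟩ := ih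
    have hP' : ∀ X, G (m + 1 + 1) X → ThreeMx (m + 1 + 1) X := by
      intro X hX
      obtain ⟨L, hL⟩ := hX.ex
      obtain ⟨K1, K2, K3, h1, h2, h3, h12, h13, h23⟩ := hP _ (hX.rm hL)
      rcases rm_mx_cases hL.1 h1 with ⟨e1, f1⟩ | e1 <;> rcases rm_mx_cases hL.1 h2 with ⟨e2, f2⟩ | e2
      · exact ⟨L, K1, K2, hL, e1, e2, f1, f2, h12⟩
      · rcases rm_mx_cases hL.1 h3 with ⟨e3, f3⟩ | e3
        · exact ⟨L, K1, K3, hL, e1, e3, f1, f3, h13⟩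
        · exact absurd (hQ _ _ _ _ hX hL e2 e3) h23
      · rcases rm_mx_cases hL.1 h3 with ⟨e3, f3⟩ | e3
        · exact ⟨L, K2, K3, hL, e2, e3, f2, f3, h23⟩
        · exact absurd (hQ _ _ _ _ hX hL e1 e3) h13
      · exact absurd (hQ _ _ _ _ hX hL e1 e2) h12
    refine ⟨hP', ?_⟩
    intro X L K K' hX hL hK hK'
    by_cases hu : ∃ M, Mx (m + 1 + 2) X M ∧ L ≠ M
    · obtain ⟨M, hM, hLM⟩ := hu
      exact hQ _ _ _ _ (hX.rm (n := m + 2) hM) (mx_rm (n := m + 2) hX.1 hM hL hLM.symm)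
        (Nx.persist (n := m + 1) hX.1 hL hK hM hLM) (Nx.persist (n := m + 1) hX.1 hL hK' hM hLM)
    · push Not at hu
      exfalso
      obtain ⟨K1, K2, K3, h1, h2, h3, h12, h13, h23⟩ := hP' _ (hX.rm (n := m + 2) hL)
      have nx : ∀ K, Mx (m + 1 + 1) (rm X L) K → Nx (m + 1 + 2) X L K := by
        intro K hK
        rcases rm_mx_cases hL.1 hK with ⟨e1, f1⟩ | e1
        · exact absurd (hu _ e1) f1
        · exact e1
      exact t_lemma hX.1 hL (nx _ h1) (nx _ h2) (nx _ h3) h12 h13 h23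

theorem G.three {n : ℕ} {X : Finset (ℝ × ℝ)} (hX : G (n + 1) X) : ThreeMx (n + 1) X := (pq_lemma n).1 X hX

theorem nx_unique {n : ℕ} {X : Finset (ℝ × ℝ)} {L K K' : Set (ℝ × ℝ)} (hn : 2 ≤ n) (hX : G n X) (hL : Mx n X L)
    (hK : Nx n X L K) (hK' : Nx n X L K') : K = K' := by
  obtain ⟨m, rfl⟩ := Nat.exists_eq_add_of_le' hn
  exact (pq_lemma m).2 X L K K' hX hL hK hK'

/-- number of maximal lines -/
noncomputable def mm (n : ℕ) (X : Finset (ℝ × ℝ)) : ℕ := {L | Mx n X L}.ncard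

theorem exists_pair_on {X : Finset (ℝ × ℝ)} {L : Set (ℝ × ℝ)} (h : 2 ≤ cnt X L) :
    ∃ A ∈ X, ∃ B ∈ X, A ≠ B ∧ A ∈ L ∧ B ∈ L := by
  obtain ⟨A, hA, B, hB, hAB⟩ := Finset.one_lt_card.1 (show 1 < (nd X L).card from h)
  rw [mem_nd] at hA hB
  exact ⟨A, hA.1, B, hB.1, hAB, hA.2, hB.2⟩

theorem finite_mx (n : ℕ) (X : Finset (ℝ × ℝ)) : {L | Mx (n + 1) X L}.Finite := by
  classical
  apply Set.Finite.of_finite_image (f := fun L => nd X L)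
  · apply Set.Finite.subset (Finset.finite_toSet X.powerset)
    rintro s ⟨L, -, rfl⟩
    rw [Finset.mem_coe, Finset.mem_powerset]
    intro P hP
    exact (mem_nd.1 hP).1
  · intro L hL K hK hLK
    obtain ⟨A, hA, B, hB, hAB, h1, h2⟩ := exists_pair_on (X := X) (L := L) (by rw [hL.2]; omega)
    simp only at hLK
    have e1 : A ∈ nd X K := by rw [← hLK, mem_nd]; exact ⟨hA, h1⟩
    have e2 : B ∈ nd X K := by rw [← hLK, mem_nd]; exact ⟨hB, h2⟩
    exact line_eq hL.1 hK.1 hAB h1 h2 (mem_nd.1 e1).2 (mem_nd.1 e2).2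

theorem mm_le {n : ℕ} {X : Finset (ℝ × ℝ)} (hX : G (n + 1) X) : mm (n + 1) X ≤ n + 3 := by
  classical
  obtain ⟨L, hL⟩ := hX.ex
  have hfin := finite_mx n X
  have h1 : ({K | Mx (n + 1) X K} \ {L}).ncard ≤ (nd X L : Set (ℝ × ℝ)).ncard := by
    have : ∀ K ∈ {K | Mx (n + 1) X K} \ {L}, ∃ P, P ∈ nd X L ∧ P ∈ K := by
      rintro K ⟨hK, -⟩
      obtain ⟨P, h1, h2, h3⟩ := meet hX.1 hL hK
      exact ⟨P, mem_nd.2 ⟨h1, h2⟩, h3⟩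
    choose! f hf1 hf2 using this
    apply Set.ncard_le_ncard_of_injOn f hf1 ?_ (Finset.finite_toSet _)
    intro K hK K' hK' hKK
    by_contra hne
    refine no_three hX.1 hL hK.1 hK'.1 (Ne.symm hK.2) (Ne.symm hK'.2) hne (mem_nd.1 (hf1 K hK)).2 (hf2 K hK) ?_
    rw [hKK]; exact hf2 K' hK'
  rw [Set.ncard_coe_finset] at h1
  have h2 := hL.2
  unfold cnt at h2
  have h3 := Set.ncard_sdiff_singleton_add_one (show L ∈ {K | Mx (n + 1) X K} from hL) hfin
  unfold mm
  omega

theorem three_le_mm {n : ℕ} {X : Finset (ℝ × ℝ)} (hX : G (n + 1) X) : 3 ≤ mm (n + 1) X := by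
  classical
  obtain ⟨L1, L2, L3, h1, h2, h3, h12, h13, h23⟩ := hX.three
  have : ({L1, L2, L3} : Set _) ⊆ {L | Mx (n + 1) X L} := by
    rintro K (rfl | rfl | rfl)
    · exact h1
    · exact h2
    · exact h3
  have e := Set.ncard_le_ncard this (finite_mx n X)
  rw [Set.ncard_eq_three.2 ⟨L1, L2, L3, h12, h13, h23, rfl⟩] at e
  exact e

theorem mx_rm_iff {n : ℕ} {X : Finset (ℝ × ℝ)} (hX : G (n + 1) X) {L K : Set (ℝ × ℝ)} (hL : Mx (n + 1) X L) :
    Mx n (rm X L) K ↔ (Mx (n + 1) X K ∧ L ≠ K) ∨ Nx (n + 1) X L K := by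
  constructor
  · exact rm_mx_cases hL.1
  · rintro (⟨h1, h2⟩ | h)
    · exact mx_rm hX.1 hL h1 h2
    · exact h.mx

theorem mm_rm_nx {n : ℕ} {X : Finset (ℝ × ℝ)} (hX : G (n + 1 + 1) X) {L K : Set (ℝ × ℝ)} (hL : Mx (n + 1 + 1) X L)
    (hK : Nx (n + 1 + 1) X L K) : mm (n + 1) (rm X L) = mm (n + 1 + 1) X := by
  classical
  have : {M | Mx (n + 1) (rm X L) M} = insert K ({M | Mx (n + 1 + 1) X M} \ {L}) := by
    ext M
    simp only [Set.mem_ofPred_eq, mx_rm_iff hX hL, Set.mem_insert_iff, Set.mem_sdiff, Set.mem_singleton_iff]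
    constructor
    · rintro (⟨h1, h2⟩ | h)
      · exact Or.inr ⟨h1, h2.symm⟩
      · exact Or.inl (nx_unique (by omega) hX hL h hK)
    · rintro (rfl | ⟨h1, h2⟩)
      · exact Or.inr hK
      · exact Or.inl ⟨h1, Ne.symm h2⟩
  unfold mm
  rw [this, Set.ncard_insert_of_notMem ?_ ((finite_mx (n + 1) X).sdiff), Set.ncard_sdiff_singleton_add_one (by exact hL) (finite_mx _ X)]
  · rintro ⟨h1, -⟩
    exact hK.not_mx h1

theorem mm_rm_no {n : ℕ} {X : Finset (ℝ × ℝ)} (hX : G (n + 1 + 1) X) {L : Set (ℝ × ℝ)} (hL : Mx (n + 1 + 1) X L)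
    (hK : ∀ K, ¬ Nx (n + 1 + 1) X L K) : mm (n + 1) (rm X L) + 1 = mm (n + 1 + 1) X := by
  classical
  have : {M | Mx (n + 1) (rm X L) M} = ({M | Mx (n + 1 + 1) X M} \ {L}) := by
    ext M
    simp only [Set.mem_ofPred_eq, mx_rm_iff hX hL, Set.mem_sdiff, Set.mem_singleton_iff]
    constructor
    · rintro (⟨h1, h2⟩ | h)
      · exact ⟨h1, h2.symm⟩
      · exact absurd h (hK _)
    · rintro ⟨h1, h2⟩
      exact Or.inl ⟨h1, Ne.symm h2⟩
  unfold mm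
  rw [this, Set.ncard_sdiff_singleton_add_one (by exact hL) (finite_mx _ X)]

theorem r_lemma (S : Finset (Set (ℝ × ℝ))) : ∀ (n : ℕ) (X : Finset (ℝ × ℝ)), G n X → S.card < n →
    (∀ L ∈ S, Mx n X L ∧ ∃ K, Nx n X L K) → S.card + mm n X ≤ n + 2 := by
  classical
  induction S using Finset.induction_on with
  | empty =>
    intro n X hX hn _
    obtain ⟨m, rfl⟩ : ∃ m, n = m + 1 := ⟨n - 1, by simp at hn; omega⟩
    simpa using mm_le hX
  | insert L S hLS ih =>
    intro n X hX hn h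
    rw [Finset.card_insert_of_notMem hLS] at hn ⊢
    obtain ⟨m, rfl⟩ : ∃ m, n = m + 1 + 1 := ⟨n - 2, by omega⟩
    obtain ⟨hL, K, hK⟩ := h L (by simp)
    have e := ih (m + 1) (rm X L) (hX.rm hL) (by omega) (by
      intro M hM
      have hML : M ≠ L := by rintro rfl; exact hLS hM
      obtain ⟨h1, K', hK'⟩ := h M (by simp [hM])
      exact ⟨mx_rm hX.1 hL h1 hML.symm, K', hK'.persist hX.1 h1 hL hML⟩)
    rw [mm_rm_nx hX hL hK] at e
    omega

/-- a sequence of lines -/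
abbrev LSeq : Type := ℕ → Set (ℝ × ℝ)

/-- remove initial segments of three sequences of lines -/
noncomputable def cut (X : Finset (ℝ × ℝ)) (a b c : LSeq) (x y z : ℕ) : Finset (ℝ × ℝ) :=
  @Finset.filter _ (fun P => (∀ i < x, P ∉ a i) ∧ (∀ i < y, P ∉ b i) ∧ (∀ i < z, P ∉ c i)) (Classical.decPred _) X

section
variable {X : Finset (ℝ × ℝ)} {a b c : LSeq} {x y z : ℕ} {P : ℝ × ℝ}

theorem mem_cut : P ∈ cut X a b c x y z ↔
    P ∈ X ∧ (∀ i < x, P ∉ a i) ∧ (∀ i < y, P ∉ b i) ∧ (∀ i < z, P ∉ c i) := by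
  simp [cut]

theorem cut_zero : cut X a b c 0 0 0 = X := by
  ext P; simp [mem_cut]

theorem cut_swap : cut X a b c x y z = cut X b a c y x z := by
  ext P; simp only [mem_cut]; tauto

theorem cut_rot : cut X a b c x y z = cut X b c a y z x := by
  ext P; simp only [mem_cut]; tauto

theorem cut_succ_a : cut X a b c (x + 1) y z = rm (cut X a b c x y z) (a x) := by
  ext P
  simp only [mem_cut, mem_rm]
  constructor
  · rintro ⟨h1, h2, h3, h4⟩
    exact ⟨⟨h1, fun i hi => h2 i (by omega), h3, h4⟩, h2 x (by omega)⟩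
  · rintro ⟨⟨h1, h2, h3, h4⟩, h5⟩
    refine ⟨h1, fun i hi => ?_, h3, h4⟩
    rcases Nat.lt_succ_iff_lt_or_eq.1 hi with h | rfl
    · exact h2 i h
    · exact h5

theorem cut_succ_b : cut X a b c x (y + 1) z = rm (cut X a b c x y z) (b y) := by
  rw [cut_swap, cut_succ_a, cut_swap]

theorem cut_succ_c : cut X a b c x y (z + 1) = rm (cut X a b c x y z) (c z) := by
  rw [cut_rot, cut_succ_b, ← cut_rot]

theorem cut_mono {x' y' z' : ℕ} (hx : x' ≤ x) (hy : y' ≤ y) (hz : z' ≤ z) (h : P ∈ cut X a b c x y z) :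
    P ∈ cut X a b c x' y' z' := by
  rw [mem_cut] at h ⊢
  exact ⟨h.1, fun i hi => h.2.1 i (by omega), fun i hi => h.2.2.1 i (by omega), fun i hi => h.2.2.2 i (by omega)⟩

end

/-- the local structure at a lattice point of the triangle -/
def TT (X : Finset (ℝ × ℝ)) (a b c : LSeq) (x y z d : ℕ) : Prop :=
  G (d + 1) (cut X a b c x y z) ∧ Mx (d + 1) (cut X a b c x y z) (a x) ∧ Mx (d + 1) (cut X a b c x y z) (b y) ∧
    Mx (d + 1) (cut X a b c x y z) (c z) ∧ a x ≠ b y ∧ a x ≠ c z ∧ b y ≠ c z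

theorem TT.swap {X : Finset (ℝ × ℝ)} {a b c : LSeq} {x y z d : ℕ} (h : TT X a b c x y z d) : TT X b a c y x z d := by
  obtain ⟨h1, h2, h3, h4, h5, h6, h7⟩ := h
  rw [cut_swap] at h1 h2 h3 h4
  exact ⟨h1, h3, h2, h4, h5.symm, h7, h6⟩

theorem TT.rot {X : Finset (ℝ × ℝ)} {a b c : LSeq} {x y z d : ℕ} (h : TT X a b c x y z d) : TT X b c a y z x d := by
  obtain ⟨h1, h2, h3, h4, h5, h6, h7⟩ := h
  rw [cut_rot] at h1 h2 h3 h4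
  exact ⟨h1, h3, h4, h2, h7, h5.symm, h6.symm⟩

/-- triangular structure -/
structure Tri (n : ℕ) (X : Finset (ℝ × ℝ)) (a b c : LSeq) : Prop where
  pos : 0 < n
  tt : ∀ x y z d, x + y + z + d + 1 = n → TT X a b c x y z d
  na : ∀ x d, x + d + 2 = n → Nx (d + 2) (cut X a b c x 0 0) (a x) (a (x + 1))
  nb : ∀ x d, x + d + 2 = n → Nx (d + 2) (cut X a b c 0 x 0) (b x) (b (x + 1))
  nc : ∀ x d, x + d + 2 = n → Nx (d + 2) (cut X a b c 0 0 x) (c x) (c (x + 1))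

theorem Tri.swap {n : ℕ} {X : Finset (ℝ × ℝ)} {a b c : LSeq} (h : Tri n X a b c) : Tri n X b a c where
  pos := h.pos
  tt x y z d e := (h.tt y x z d (by omega)).swap
  na x d e := by rw [cut_swap]; exact h.nb x d e
  nb x d e := by rw [cut_swap]; exact h.na x d e
  nc x d e := by rw [cut_swap]; exact h.nc x d e

theorem Tri.rot {n : ℕ} {X : Finset (ℝ × ℝ)} {a b c : LSeq} (h : Tri n X a b c) : Tri n X b c a where
  pos := h.pos
  tt x y z d e := (h.tt z x y d (by omega)).rot
  na x d e := by rw [← cut_rot]; exact h.nb x d e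
  nb x d e := by rw [← cut_rot]; exact h.nc x d e
  nc x d e := by rw [← cut_rot]; exact h.na x d e

/-- exactly three maximal lines -/
def Ex3 (n : ℕ) (X : Finset (ℝ × ℝ)) (A B D : Set (ℝ × ℝ)) : Prop :=
  G n X ∧ Mx n X A ∧ Mx n X B ∧ Mx n X D ∧ A ≠ B ∧ A ≠ D ∧ B ≠ D ∧ ∀ L, Mx n X L → L = A ∨ L = B ∨ L = D

theorem ex3_of_mm {n : ℕ} {X : Finset (ℝ × ℝ)} (hX : G (n + 1) X) (h : mm (n + 1) X = 3) :
    ∃ A B D, Ex3 (n + 1) X A B D := by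
  obtain ⟨A, B, D, h1, h2, h3, h4⟩ := Set.ncard_eq_three.1 h
  have key : ∀ L, Mx (n + 1) X L ↔ L = A ∨ L = B ∨ L = D := by
    intro L
    have : L ∈ {L | Mx (n + 1) X L} ↔ L ∈ ({A, B, D} : Set _) := by rw [h4]
    simpa using this
  exact ⟨A, B, D, hX, (key _).2 (by simp), (key _).2 (by simp), (key _).2 (by simp), h1, h2, h3, fun L hL => (key L).1 hL⟩

/-- removing the first line of a triangle -/
theorem Ex3.step {n : ℕ} {X : Finset (ℝ × ℝ)} {A B D : Set (ℝ × ℝ)} (h : Ex3 (n + 1 + 1) X A B D) :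
    ∃ A', Nx (n + 1 + 1) X A A' ∧ Ex3 (n + 1) (rm X A) A' B D := by
  obtain ⟨hX, hA, hB, hD, hAB, hAD, hBD, hall⟩ := h
  obtain ⟨A', h1, h2, h3⟩ := (hX.rm hA).three.other B D
  have hN : Nx (n + 1 + 1) X A A' := by
    rcases rm_mx_cases hA.1 h1 with ⟨e, f⟩ | e
    · rcases hall _ e with e | e | e
      · exact absurd e.symm f
      · exact absurd e h2
      · exact absurd e h3
    · exact e
  refine ⟨A', hN, hX.rm hA, h1, mx_rm hX.1 hA hB hAB, mx_rm hX.1 hA hD hAD, h2, h3, hBD, ?_⟩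
  intro L hL
  rcases rm_mx_cases hA.1 hL with ⟨e, f⟩ | e
  · rcases hall _ e with e | e | e
    · exact absurd e.symm f
    · exact Or.inr (Or.inl e)
    · exact Or.inr (Or.inr e)
  · exact Or.inl (nx_unique (by omega) hX hA e hN)

theorem axis (n : ℕ) : ∀ (X : Finset (ℝ × ℝ)) (A B D : Set (ℝ × ℝ)), Ex3 (n + 1) X A B D →
    ∃ a : LSeq, a 0 = A ∧ ∀ b c, (∀ x d, x + d = n → Ex3 (d + 1) (cut X a b c x 0 0) (a x) B D) ∧
      (∀ x d, x + d + 1 = n → Nx (d + 2) (cut X a b c x 0 0) (a x) (a (x + 1))) := by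
  induction n with
  | zero =>
    intro X A B D h
    refine ⟨fun _ => A, rfl, ?_⟩
    intro b c
    refine ⟨?_, ?_⟩
    · intro x d e
      obtain rfl : x = 0 := by omega
      obtain rfl : d = 0 := by omega
      rw [cut_zero]; exact h
    · intro x d e; omega
  | succ n ih =>
    intro X A B D h
    obtain ⟨A', hN, hE⟩ := h.step
    obtain ⟨a, ha, hab⟩ := ih _ _ _ _ hE
    refine ⟨fun i => Nat.casesOn i A a, rfl, ?_⟩
    intro b c
    obtain ⟨h1, h2⟩ := hab b c
    have hc : ∀ x, cut X (fun i => Nat.casesOn i A a) b c (x + 1) 0 0 = cut (rm X A) a b c x 0 0 := by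
      intro x
      ext P
      simp only [mem_cut, mem_rm]
      constructor
      · rintro ⟨e1, e2, -⟩
        exact ⟨⟨e1, e2 0 (by omega)⟩, fun i hi => e2 (i + 1) (by omega), by simp, by simp⟩
      · rintro ⟨⟨e1, e3⟩, e2, -⟩
        refine ⟨e1, fun i hi => ?_, by simp, by simp⟩
        cases i with
        | zero => exact e3
        | succ i => exact e2 i (by omega)
    refine ⟨?_, ?_⟩
    · intro x d e
      cases x with
      | zero =>
        obtain rfl : d = n + 1 := by omega
        rw [cut_zero]; exact h
      | succ x => rw [hc]; exact h1 x d (by omega)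
    · intro x d e
      cases x with
      | zero =>
        obtain rfl : d = n := by omega
        rw [cut_zero]
        change Nx (d + 2) X A (a 0)
        rw [ha]; exact hN
      | succ x => rw [hc]; exact h2 x d (by omega)

theorem tt_step {X : Finset (ℝ × ℝ)} {a b c : LSeq} {x y z d : ℕ}
    (hna : ∀ P ∈ cut X a b c x 0 0, P ∈ a x → P ∉ a (x + 1))
    (h1 : TT X a b c (x + 1) y z (d + 1)) (h2 : TT X a b c x (y + 1) z (d + 1)) : TT X a b c (x + 1) (y + 1) z d := by
  obtain ⟨p1, p2, p3, p4, p5, p6, p7⟩ := h1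
  obtain ⟨q1, q2, q3, q4, q5, q6, q7⟩ := h2
  refine ⟨?_, ?_, ?_, ?_, ?_, p6, q7⟩
  · rw [cut_succ_b]; exact p1.rm p3
  · rw [cut_succ_b]; exact mx_rm p1.1 p3 p2 p5.symm
  · rw [cut_succ_a]; exact mx_rm q1.1 q2 q3 q5
  · rw [cut_succ_b]; exact mx_rm p1.1 p3 p4 p7
  · intro he
    obtain ⟨P, hP, f1, f2⟩ := meet q1.1 q2 q3
    exact hna P (cut_mono le_rfl (Nat.zero_le _) (Nat.zero_le _) hP) f1 (he ▸ f2)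

theorem tri_of_ex3 {n : ℕ} {X : Finset (ℝ × ℝ)} {A B D : Set (ℝ × ℝ)} (h : Ex3 (n + 1) X A B D) :
    ∃ a b c : LSeq, a 0 = A ∧ b 0 = B ∧ c 0 = D ∧ Tri (n + 1) X a b c := by
  have hB : Ex3 (n + 1) X B A D := by
    obtain ⟨h1, h2, h3, h4, h5, h6, h7, h8⟩ := h
    exact ⟨h1, h3, h2, h4, h5.symm, h7, h6, fun L hL => by have := h8 L hL; tauto⟩
  have hD : Ex3 (n + 1) X D A B := by
    obtain ⟨h1, h2, h3, h4, h5, h6, h7, h8⟩ := h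
    exact ⟨h1, h4, h2, h3, h6.symm, h7.symm, h5, fun L hL => by have := h8 L hL; tauto⟩
  obtain ⟨a, ha, a1⟩ := axis n X A B D h
  obtain ⟨b, hb, b1⟩ := axis n X B A D hB
  obtain ⟨c, hc, c1⟩ := axis n X D A B hD
  obtain ⟨a1, a2⟩ := a1 b c
  obtain ⟨b1, b2⟩ := b1 a c
  obtain ⟨c1, c2⟩ := c1 a b
  refine ⟨a, b, c, ha, hb, hc, by omega, ?_, ?_, ?_, ?_⟩
  · have main : ∀ s x y z d, x + y + z = s → x + y + z + d + 1 = n + 1 → TT X a b c x y z d := by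
      intro s
      induction s using Nat.strong_induction_on with
      | _ s ih =>
        intro x y z d hs hn
        by_cases hxy : 0 < x ∧ 0 < y
        · obtain ⟨x, rfl⟩ : ∃ k, x = k + 1 := ⟨x - 1, by omega⟩
          obtain ⟨y, rfl⟩ : ∃ k, y = k + 1 := ⟨y - 1, by omega⟩
          apply tt_step
          · exact (a2 x (n - x - 1) (by omega)).2.2
          · exact ih (x + 1 + y + z) (by omega) _ _ _ _ rfl (by omega)
          · exact ih (x + (y + 1) + z) (by omega) _ _ _ _ rfl (by omega)
        by_cases hxz : 0 < x ∧ 0 < z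
        · obtain ⟨x, rfl⟩ : ∃ k, x = k + 1 := ⟨x - 1, by omega⟩
          obtain ⟨z, rfl⟩ : ∃ k, z = k + 1 := ⟨z - 1, by omega⟩
          refine TT.swap (TT.rot (TT.rot ?_))
          apply tt_step
          · have := (a2 x (n - x - 1) (by omega)).2.2
            rwa [cut_rot, cut_swap, ← cut_rot] at this
          · exact TT.swap (TT.rot (TT.rot (ih (x + 1 + y + z) (by omega) _ _ _ _ rfl (by omega))))
          · exact TT.swap (TT.rot (TT.rot (ih (x + y + (z + 1)) (by omega) _ _ _ _ rfl (by omega))))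
        by_cases hyz : 0 < y ∧ 0 < z
        · obtain ⟨y, rfl⟩ : ∃ k, y = k + 1 := ⟨y - 1, by omega⟩
          obtain ⟨z, rfl⟩ : ∃ k, z = k + 1 := ⟨z - 1, by omega⟩
          refine TT.rot (TT.rot ?_)
          apply tt_step
          · have := (b2 y (n - y - 1) (by omega)).2.2
            rwa [cut_swap, cut_rot] at this
          · exact TT.rot (ih (x + (y + 1) + z) (by omega) _ _ _ _ rfl (by omega))
          · exact TT.rot (ih (x + y + (z + 1)) (by omega) _ _ _ _ rfl (by omega))
        by_cases hx : y = 0 ∧ z = 0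
        · obtain ⟨rfl, rfl⟩ := hx
          obtain ⟨e1, e2, e3, e4, e5, e6, e7, -⟩ := a1 x d (by omega)
          subst hb hc
          exact ⟨e1, e2, e3, e4, e5, e6, e7⟩
        by_cases hy : x = 0 ∧ z = 0
        · obtain ⟨rfl, rfl⟩ := hy
          obtain ⟨e1, e2, e3, e4, e5, e6, e7, -⟩ := b1 y d (by omega)
          subst ha hc
          exact TT.swap ⟨e1, e2, e3, e4, e5, e6, e7⟩
        · obtain ⟨rfl, rfl⟩ : x = 0 ∧ y = 0 := by omega
          obtain ⟨e1, e2, e3, e4, e5, e6, e7, -⟩ := c1 z d (by omega)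
          subst ha hb
          exact TT.rot ⟨e1, e2, e3, e4, e5, e6, e7⟩
    intro x y z d e
    exact main _ x y z d rfl e
  · intro x d e; exact a2 x d (by omega)
  · intro x d e; rw [cut_swap]; exact b2 x d (by omega)
  · intro x d e; rw [cut_rot, cut_rot]; exact c2 x d (by omega)

theorem exists_tri {n : ℕ} {X : Finset (ℝ × ℝ)} (hX : G (n + 1) X) (h : mm (n + 1) X = 3) :
    ∃ a b c : LSeq, Tri (n + 1) X a b c := by
  obtain ⟨A, B, D, h⟩ := ex3_of_mm hX h
  obtain ⟨a, b, c, -, -, -, h⟩ := tri_of_ex3 h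
  exact ⟨a, b, c, h⟩

section
variable {n : ℕ} {X : Finset (ℝ × ℝ)} {a b c : LSeq}

theorem Tri.la (h : Tri n X a b c) {x : ℕ} (hx : x < n) : IsLine (a x) :=
  (h.tt x 0 0 (n - x - 1) (by omega)).2.1.1

theorem Tri.lb (h : Tri n X a b c) {x : ℕ} (hx : x < n) : IsLine (b x) := h.rot.la hx

theorem Tri.lc (h : Tri n X a b c) {x : ℕ} (hx : x < n) : IsLine (c x) := h.rot.rot.la hx

theorem Tri.g (h : Tri n X a b c) : G n X := by
  have hp := h.pos
  have := (h.tt 0 0 0 (n - 1) (by omega)).1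
  rwa [cut_zero, show n - 1 + 1 = n by omega] at this

/-- the sets at the last level are single nodes -/
theorem Tri.card_one (h : Tri n X a b c) {x y z : ℕ} (e : x + y + z = n) : (cut X a b c x y z).card = 1 := by
  have hp := h.pos
  have g0 : G 0 (cut X a b c x y z) := by
    rcases Nat.eq_zero_or_pos x with hx | hx
    · rcases Nat.eq_zero_or_pos y with hy | hy
      · obtain ⟨z, rfl⟩ : ∃ k, z = k + 1 := ⟨z - 1, by omega⟩
        rw [cut_succ_c]
        have t := h.tt x y z 0 (by omega)
        exact t.1.rm t.2.2.2.1
      · obtain ⟨y, rfl⟩ : ∃ k, y = k + 1 := ⟨y - 1, by omega⟩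
        rw [cut_succ_b]
        have t := h.tt x y z 0 (by omega)
        exact t.1.rm t.2.2.1
    · obtain ⟨x, rfl⟩ : ∃ k, x = k + 1 := ⟨x - 1, by omega⟩
      rw [cut_succ_a]
      have t := h.tt x y z 0 (by omega)
      exact t.1.rm t.2.1
  simpa using g0.1.1.1

theorem Tri.exists_node (h : Tri n X a b c) {x y z : ℕ} (e : x + y + z = n) : ∃ P, P ∈ cut X a b c x y z :=
  Finset.card_pos.1 (by rw [h.card_one e]; omega)

theorem Tri.node_unique (h : Tri n X a b c) {x y z : ℕ} (e : x + y + z = n) {P Q : ℝ × ℝ}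
    (hP : P ∈ cut X a b c x y z) (hQ : Q ∈ cut X a b c x y z) : P = Q :=
  Finset.card_le_one.1 (h.card_one e).le P hP Q hQ

theorem mem_of_mx_zero {Y : Finset (ℝ × ℝ)} {L : Set (ℝ × ℝ)} (hY : Y.card = 1) (hL : Mx 0 Y L) {P : ℝ × ℝ}
    (hP : P ∈ Y) : P ∈ L := by
  have : 0 < (nd Y L).card := by have := hL.2; unfold cnt at this; omega
  obtain ⟨B, hB⟩ := Finset.card_pos.1 this
  rw [mem_nd] at hB
  rw [Finset.card_le_one.1 hY.le P hP B hB.1]; exact hB.2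

theorem Tri.mem_a (h : Tri n X a b c) {x y z : ℕ} (e : x + y + z = n) (hx : x < n) {P : ℝ × ℝ}
    (hP : P ∈ cut X a b c x y z) : P ∈ a x := by
  refine mem_of_mx_zero (h.card_one e) ?_ hP
  rcases Nat.eq_zero_or_pos y with hy | hy
  · obtain ⟨z, rfl⟩ : ∃ k, z = k + 1 := ⟨z - 1, by omega⟩
    obtain ⟨t1, t2, t3, t4, t5, t6, t7⟩ := h.tt x y z 0 (by omega)
    rw [cut_succ_c]
    exact mx_rm t1.1 t4 t2 t6.symm
  · obtain ⟨y, rfl⟩ : ∃ k, y = k + 1 := ⟨y - 1, by omega⟩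
    obtain ⟨t1, t2, t3, t4, t5, t6, t7⟩ := h.tt x y z 0 (by omega)
    rw [cut_succ_b]
    exact mx_rm t1.1 t3 t2 t5.symm

theorem Tri.mem_b (h : Tri n X a b c) {x y z : ℕ} (e : x + y + z = n) (hx : y < n) {P : ℝ × ℝ}
    (hP : P ∈ cut X a b c x y z) : P ∈ b y :=
  h.rot.mem_a (x := y) (y := z) (z := x) (by omega) hx (by rwa [← cut_rot])

theorem Tri.mem_c (h : Tri n X a b c) {x y z : ℕ} (e : x + y + z = n) (hx : z < n) {P : ℝ × ℝ}
    (hP : P ∈ cut X a b c x y z) : P ∈ c z :=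
  h.rot.rot.mem_a (x := z) (y := x) (z := y) (by omega) hx (by rwa [← cut_rot, ← cut_rot])

theorem Tri.exists_index (h : Tri n X a b c) {P : ℝ × ℝ} (hP : P ∈ X) :
    ∃ x y z, x + y + z = n ∧ P ∈ cut X a b c x y z := by
  have main : ∀ s ≤ n, ∃ x y z, x + y + z = s ∧ P ∈ cut X a b c x y z := by
    intro s
    induction s with
    | zero => intro _; exact ⟨0, 0, 0, rfl, by rwa [cut_zero]⟩
    | succ s ih =>
      intro hs
      obtain ⟨x, y, z, e, hx⟩ := ih (by omega)
      obtain ⟨t1, t2, t3, t4, t5, t6, t7⟩ := h.tt x y z (n - s - 1) (by omega)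
      by_cases h1 : P ∈ a x
      · by_cases h2 : P ∈ b y
        · refine ⟨x, y, z + 1, by omega, ?_⟩
          rw [cut_succ_c, mem_rm]
          exact ⟨hx, fun h3 => no_three t1.1 t2 t3 t4 t5 t6 t7 h1 h2 h3⟩
        · refine ⟨x, y + 1, z, by omega, ?_⟩
          rw [cut_succ_b, mem_rm]
          exact ⟨hx, h2⟩
      · refine ⟨x + 1, y, z, by omega, ?_⟩
        rw [cut_succ_a, mem_rm]
        exact ⟨hx, h1⟩
  exact main n le_rfl

theorem Tri.ne_ab (h : Tri n X a b c) {x y : ℕ} (e : x + y ≤ n) (hx : x < n) (hy : y < n) : a x ≠ b y := by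
  rcases Nat.lt_or_ge (x + y) n with hl | hl
  · exact (h.tt x y 0 (n - x - y - 1) (by omega)).2.2.2.2.1
  · obtain ⟨x, rfl⟩ : ∃ k, x = k + 1 := ⟨x - 1, by omega⟩
    intro he
    obtain ⟨P, hP⟩ := h.exists_node (x := x) (y := y) (z := 1) (by omega)
    have h1 := h.mem_a (by omega) (by omega) hP
    have h2 := h.mem_b (by omega) (by omega) hP
    exact (h.na x (n - x - 2) (by omega)).2.2 P (cut_mono le_rfl (Nat.zero_le _) (Nat.zero_le _) hP) h1 (he ▸ h2)

/-- the lines of two families meet in a single node -/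
theorem Tri.inter_ab (h : Tri n X a b c) {x y z : ℕ} (e : x + y + z = n) (hx : x < n) (hy : y < n)
    {P Q : ℝ × ℝ} (hP : P ∈ cut X a b c x y z) (h1 : Q ∈ a x) (h2 : Q ∈ b y) : Q = P :=
  pt_eq (h.la hx) (h.lb hy) (h.ne_ab (by omega) hx hy) h1 (h.mem_a e hx hP) h2 (h.mem_b e hy hP)

theorem Tri.us_peel (h : Tri n X a b c) {K : Set (ℝ × ℝ)} {A : ℝ × ℝ} (hU : Us n X K A) :
    ∀ s u v w e, u + v + w = s → u + v + w + e = n → A ∈ cut X a b c u v w →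
    (∃ i < u, K = a i) ∨ (∃ i < v, K = b i) ∨ (∃ i < w, K = c i) ∨ Us e (cut X a b c u v w) K A := by
  intro s
  induction s with
  | zero =>
    intro u v w e hs hn hA
    obtain ⟨rfl, rfl, rfl⟩ : u = 0 ∧ v = 0 ∧ w = 0 := by omega
    obtain rfl : e = n := by omega
    right; right; right
    rwa [cut_zero]
  | succ s ih =>
    intro u v w e hs hn hA
    rcases Nat.eq_zero_or_pos u with hu | hu
    · rcases Nat.eq_zero_or_pos v with hv | hv
      · obtain ⟨w, rfl⟩ : ∃ k, w = k + 1 := ⟨w - 1, by omega⟩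
        rw [cut_succ_c, mem_rm] at hA
        rcases ih u v w (e + 1) (by omega) (by omega) hA.1 with ⟨i, hi, h1⟩ | ⟨i, hi, h1⟩ | ⟨i, hi, h1⟩ | h1
        · exact Or.inl ⟨i, by omega, h1⟩
        · exact Or.inr (Or.inl ⟨i, by omega, h1⟩)
        · exact Or.inr (Or.inr (Or.inl ⟨i, by omega, h1⟩))
        · rcases us_down (h.tt u v w e (by omega)).2.2.2.1 hA.2 h1 with h2 | h2
          · exact Or.inr (Or.inr (Or.inl ⟨w, by omega, h2⟩))
          · rw [cut_succ_c]; exact Or.inr (Or.inr (Or.inr h2))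
      · obtain ⟨v, rfl⟩ : ∃ k, v = k + 1 := ⟨v - 1, by omega⟩
        rw [cut_succ_b, mem_rm] at hA
        rcases ih u v w (e + 1) (by omega) (by omega) hA.1 with ⟨i, hi, h1⟩ | ⟨i, hi, h1⟩ | ⟨i, hi, h1⟩ | h1
        · exact Or.inl ⟨i, by omega, h1⟩
        · exact Or.inr (Or.inl ⟨i, by omega, h1⟩)
        · exact Or.inr (Or.inr (Or.inl ⟨i, by omega, h1⟩))
        · rcases us_down (h.tt u v w e (by omega)).2.2.1 hA.2 h1 with h2 | h2
          · exact Or.inr (Or.inl ⟨v, by omega, h2⟩)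
          · rw [cut_succ_b]; exact Or.inr (Or.inr (Or.inr h2))
    · obtain ⟨u, rfl⟩ : ∃ k, u = k + 1 := ⟨u - 1, by omega⟩
      rw [cut_succ_a, mem_rm] at hA
      rcases ih u v w (e + 1) (by omega) (by omega) hA.1 with ⟨i, hi, h1⟩ | ⟨i, hi, h1⟩ | ⟨i, hi, h1⟩ | h1
      · exact Or.inl ⟨i, by omega, h1⟩
      · exact Or.inr (Or.inl ⟨i, by omega, h1⟩)
      · exact Or.inr (Or.inr (Or.inl ⟨i, by omega, h1⟩))
      · rcases us_down (h.tt u v w e (by omega)).2.1 hA.2 h1 with h2 | h2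
        · exact Or.inl ⟨u, by omega, h2⟩
        · rw [cut_succ_a]; exact Or.inr (Or.inr (Or.inr h2))

/-- lines used by a node of a triangular set -/
theorem Tri.us_cases (h : Tri n X a b c) {K : Set (ℝ × ℝ)} {A : ℝ × ℝ} (hU : Us n X K A) :
    ∃ x y z, x + y + z = n ∧ A ∈ cut X a b c x y z ∧
    ((∃ i < x, K = a i) ∨ (∃ i < y, K = b i) ∨ (∃ i < z, K = c i)) := by
  obtain ⟨x, y, z, e, hA⟩ := h.exists_index hU.1
  refine ⟨x, y, z, e, hA, ?_⟩
  rcases h.us_peel hU _ x y z 0 rfl (by omega) hA with h1 | h1 | h1 | h1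
  · exact Or.inl h1
  · exact Or.inr (Or.inl h1)
  · exact Or.inr (Or.inr h1)
  · exact absurd h1 us_zero

theorem Tri.us_a (h : Tri n X a b c) {A : ℝ × ℝ} {k : ℕ} (hk : k < n) (hA : A ∈ cut X a b c k 0 0) (hA' : A ∉ a k) :
    Us n X (a k) A := by
  have main : ∀ x d, x + d = n → ∀ K, Us d (cut X a b c x 0 0) K A → Us n X K A := by
    intro x
    induction x with
    | zero => intro d e K hU; rw [cut_zero] at hU; obtain rfl : d = n := by omega
              exact hU
    | succ x ih =>
      intro d e K hU
      rw [cut_succ_a] at hU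
      exact ih (d + 1) (by omega) K (us_up (h.la (by omega)) hU)
  obtain ⟨t1, t2, -⟩ := h.tt k 0 0 (n - k - 1) (by omega)
  exact main k (n - k - 1 + 1) (by omega) _ (us_mx t1.1 t2 hA hA')

end

theorem exists_many {l : Poly2} (hl : l.totalDegree = 1) (d : ℕ) :
    ∃ s : Finset (ℝ × ℝ), s.card = d ∧ ∀ A ∈ s, evalPt l A = 0 := by
  classical
  obtain ⟨a, b, c, rfl, hab⟩ := lin_form hl
  have hN : a ^ 2 + b ^ 2 ≠ 0 := by
    rcases hab with h | h <;> positivity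
  refine ⟨(Finset.range d).image (fun t : ℕ => (-c * a / (a ^ 2 + b ^ 2) + b * t, -c * b / (a ^ 2 + b ^ 2) - a * t)), ?_, ?_⟩
  · rw [Finset.card_image_of_injective, Finset.card_range]
    intro s t h
    have h1 := congrArg Prod.fst h
    have h2 := congrArg Prod.snd h
    simp only at h1 h2
    have e1 : b * ((s : ℝ) - t) = 0 := by linarith
    have e2 : a * ((s : ℝ) - t) = 0 := by linarith
    have : (s : ℝ) - t = 0 := by
      rcases hab with h | h
      · exact (mul_eq_zero.1 e2).resolve_left h
      · exact (mul_eq_zero.1 e1).resolve_left h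
    exact_mod_cast sub_eq_zero.1 this
  · intro A hA
    rw [Finset.mem_image] at hA
    obtain ⟨t, -, rfl⟩ := hA
    rw [evalPt_lin]; field_simp; ring

theorem cb_lemma {r1 r2 r3 k1 k2 k3 F : Poly2} (hr1 : r1.totalDegree = 1) (hr2 : r2.totalDegree = 1)
    (hr3 : r3.totalDegree = 1) (hk1 : k1.totalDegree = 1) (hk2 : k2.totalDegree = 1) (hk3 : k3.totalDegree = 1)
    (hF : DegLT F 4) {e11 e12 e13 e21 e22 e23 e31 e32 e33 : ℝ × ℝ}
    (hr11 : evalPt r1 e11 = 0) (hr12 : evalPt r1 e12 = 0) (hr13 : evalPt r1 e13 = 0)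
    (hr21 : evalPt r2 e21 = 0) (hr22 : evalPt r2 e22 = 0) (hr23 : evalPt r2 e23 = 0)
    (hr31 : evalPt r3 e31 = 0) (hr32 : evalPt r3 e32 = 0) (hr33 : evalPt r3 e33 = 0)
    (hk11 : evalPt k1 e11 = 0) (hk12 : evalPt k1 e21 = 0) (hk13 : evalPt k1 e31 = 0)
    (hk21 : evalPt k2 e12 = 0) (hk22 : evalPt k2 e22 = 0) (hk23 : evalPt k2 e32 = 0)
    (hk31 : evalPt k3 e13 = 0) (hk32 : evalPt k3 e23 = 0) (hk33 : evalPt k3 e33 = 0)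
    (f11 : evalPt F e11 = 0) (f12 : evalPt F e12 = 0) (f13 : evalPt F e13 = 0)
    (f21 : evalPt F e21 = 0) (f22 : evalPt F e22 = 0) (f23 : evalPt F e23 = 0)
    (f31 : evalPt F e31 = 0) (f32 : evalPt F e32 = 0)
    (d1 : e11 ≠ e21) (d2 : e11 ≠ e31) (d3 : e21 ≠ e31)
    (d4 : e12 ≠ e22) (d5 : e12 ≠ e32) (d6 : e22 ≠ e32) (d7 : e13 ≠ e23)
    (n1 : evalPt k1 e12 ≠ 0) (n2 : evalPt k1 e22 ≠ 0) (n3 : evalPt k1 e32 ≠ 0)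
    (n4 : evalPt k1 e13 ≠ 0) (n5 : evalPt k1 e23 ≠ 0) (n6 : evalPt k2 e13 ≠ 0) (n7 : evalPt k2 e23 ≠ 0) :
    evalPt F e33 = 0 := by
  classical
  have hdeg : DegLT (r1 * r2 * r3) 4 := by
    refine degLT_of_le ((totalDegree_mul _ _).trans ?_)
    have := totalDegree_mul r1 r2
    omega
  have ndv : ∀ r : Poly2, r.totalDegree = 1 → ∀ e, evalPt r e = 0 → evalPt k1 e ≠ 0 → ¬ k1 ∣ r := by
    intro r hr e h1 h2 h3
    have := zeroSet_of_dvd hk1 hr h3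
    apply h2
    rw [← mem_zeroSet, this]; exact h1
  have hR : ∃ R, evalPt k1 R = 0 ∧ evalPt (r1 * r2 * r3) R ≠ 0 := by
    by_contra hc
    push Not at hc
    obtain ⟨s, hs, hs'⟩ := exists_many hk1 4
    have hd : k1 ∣ r1 * r2 * r3 := dvd_of_zeros hk1 hdeg s hs.ge (fun A hA => ⟨hs' A hA, hc A (hs' A hA)⟩)
    have hp := prime_of_deg_one hk1
    rcases hp.2.2 _ _ hd with h | h
    · rcases hp.2.2 _ _ h with h | h
      · exact ndv r1 hr1 e12 hr12 n1 h
      · exact ndv r2 hr2 e22 hr22 n2 h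
    · exact ndv r3 hr3 e32 hr32 n3 h
  obtain ⟨R, hRk, hRr⟩ := hR
  set lam := evalPt F R / evalPt (r1 * r2 * r3) R with hlam
  set H := F - C lam * (r1 * r2 * r3) with hH
  have dH : DegLT H 4 := hF.sub (hdeg.smul _)
  have HR : evalPt H R = 0 := by
    rw [hH, evalPt_sub, evalPt_mul, evalPt_C, hlam]; field_simp; ring
  have H0 : ∀ e, evalPt F e = 0 → evalPt (r1 * r2 * r3) e = 0 → evalPt H e = 0 := by
    intro e h1 h2
    rw [hH, evalPt_sub, evalPt_mul, h1, h2]; ring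
  have rr1 : ∀ e, evalPt r1 e = 0 → evalPt (r1 * r2 * r3) e = 0 := by
    intro e h; rw [evalPt_mul, evalPt_mul, h]; ring
  have rr2 : ∀ e, evalPt r2 e = 0 → evalPt (r1 * r2 * r3) e = 0 := by
    intro e h; rw [evalPt_mul, evalPt_mul, h]; ring
  have rr3 : ∀ e, evalPt r3 e = 0 → evalPt (r1 * r2 * r3) e = 0 := by
    intro e h; rw [evalPt_mul, evalPt_mul, h]; ring
  have g11 := H0 _ f11 (rr1 _ hr11)
  have g12 := H0 _ f12 (rr1 _ hr12)
  have g13 := H0 _ f13 (rr1 _ hr13)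
  have g21 := H0 _ f21 (rr2 _ hr21)
  have g22 := H0 _ f22 (rr2 _ hr22)
  have g23 := H0 _ f23 (rr2 _ hr23)
  have g31 := H0 _ f31 (rr3 _ hr31)
  have g32 := H0 _ f32 (rr3 _ hr32)
  have R1 : R ≠ e11 := by rintro rfl; exact hRr (rr1 _ hr11)
  have R2 : R ≠ e21 := by rintro rfl; exact hRr (rr2 _ hr21)
  have R3 : R ≠ e31 := by rintro rfl; exact hRr (rr3 _ hr31)
  have t1 : k1 ∣ H := by
    apply dvd_of_zeros hk1 dH {R, e11, e21, e31}
    · rw [Finset.card_insert_of_notMem (by simp [*]), Finset.card_insert_of_notMem (by simp [*]),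
        Finset.card_pair d3]
    · intro P hP
      simp only [Finset.mem_insert, Finset.mem_singleton] at hP
      rcases hP with rfl | rfl | rfl | rfl
      · exact ⟨hRk, HR⟩
      · exact ⟨hk11, g11⟩
      · exact ⟨hk12, g21⟩
      · exact ⟨hk13, g31⟩
  obtain ⟨H1, h1⟩ := t1
  rw [h1] at dH g12 g13 g22 g23 g32
  have dH1 := dH.mul_cancel hk1
  rw [evalPt_mul] at g12 g13 g22 g23 g32
  replace g12 := (mul_eq_zero.1 g12).resolve_left n1
  replace g22 := (mul_eq_zero.1 g22).resolve_left n2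
  replace g32 := (mul_eq_zero.1 g32).resolve_left n3
  replace g13 := (mul_eq_zero.1 g13).resolve_left n4
  replace g23 := (mul_eq_zero.1 g23).resolve_left n5
  have t2 : k2 ∣ H1 := by
    apply dvd_of_zeros hk2 dH1 {e12, e22, e32}
    · rw [Finset.card_insert_of_notMem (by simp [*]), Finset.card_pair d6]
    · intro P hP
      simp only [Finset.mem_insert, Finset.mem_singleton] at hP
      rcases hP with rfl | rfl | rfl
      · exact ⟨hk21, g12⟩
      · exact ⟨hk22, g22⟩
      · exact ⟨hk23, g32⟩
  obtain ⟨H2, h2⟩ := t2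
  rw [h2] at dH1 g13 g23
  have dH2 := dH1.mul_cancel hk2
  rw [evalPt_mul] at g13 g23
  replace g13 := (mul_eq_zero.1 g13).resolve_left n6
  replace g23 := (mul_eq_zero.1 g23).resolve_left n7
  have t3 : k3 ∣ H2 := by
    apply dvd_of_zeros hk3 dH2 {e13, e23}
    · rw [Finset.card_pair d7]
    · intro P hP
      simp only [Finset.mem_insert, Finset.mem_singleton] at hP
      rcases hP with rfl | rfl
      · exact ⟨hk31, g13⟩
      · exact ⟨hk32, g23⟩
  obtain ⟨H3, h3⟩ := t3
  have e : evalPt H e33 = 0 := by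
    rw [h1, h2, h3, evalPt_mul, evalPt_mul, evalPt_mul, hk33]; ring
  rw [hH, evalPt_sub, evalPt_mul, rr3 _ hr33] at e
  linarith

/-- a cubic through nine points -/
theorem exists_cubic (e : Fin 9 → ℝ × ℝ) : ∃ F : Poly2, F ≠ 0 ∧ DegLT F 4 ∧ ∀ i, evalPt F (e i) = 0 := by
  let mf : Fin 10 → Fin 2 → ℕ := ![![0, 0], ![0, 1], ![0, 2], ![0, 3], ![1, 0], ![1, 1], ![1, 2], ![2, 0], ![2, 1], ![3, 0]]
  have mfinj : Function.Injective mf := by decide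
  have mfdeg : ∀ i, mf i 0 + mf i 1 ≤ 3 := by decide
  let m : Fin 10 → (Fin 2 →₀ ℕ) := fun i => Finsupp.equivFunOnFinite.symm (mf i)
  have minj : Function.Injective m := Finsupp.equivFunOnFinite.symm.injective.comp mfinj
  let T : (Fin 10 → ℝ) →ₗ[ℝ] Poly2 := ∑ i, (MvPolynomial.monomial (m i)).comp (LinearMap.proj i)
  let E : Poly2 →ₗ[ℝ] (Fin 9 → ℝ) := LinearMap.pi fun j =>
    (MvPolynomial.aeval (fun i : Fin 2 => if i = 0 then (e j).1 else (e j).2) : Poly2 →ₐ[ℝ] ℝ).toLinearMap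
  have hT : ∀ v, T v = ∑ i, MvPolynomial.monomial (m i) (v i) := by
    intro v; simp [T]
  have hk := LinearMap.ker_ne_bot_of_finrank_lt (f := E.comp T) (by simp)
  obtain ⟨v, hv, hv0⟩ := (Submodule.ne_bot_iff _).1 hk
  refine ⟨T v, ?_, ?_, ?_⟩
  · intro h0
    apply hv0
    funext i
    have := congrArg (MvPolynomial.coeff (m i)) h0
    rw [hT, MvPolynomial.coeff_sum] at this
    simp only [MvPolynomial.coeff_monomial, minj.eq_iff] at this
    simpa using this
  · rw [hT]
    apply degLT_of_le
    refine (totalDegree_finsetSum _ _).trans ?_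
    apply Finset.sup_le
    intro i _
    refine (totalDegree_monomial_le _ _).trans ?_
    rw [Finsupp.sum_fintype _ _ (by simp)]
    simpa [m, Fin.sum_univ_two] using mfdeg i
  · intro j
    have := congrFun (LinearMap.mem_ker.1 hv) j
    simpa [E, evalPt, MvPolynomial.aeval_eq_eval] using this

/-- a duality correlating lines and points -/
theorem exists_dual (S : Finset (Set (ℝ × ℝ))) (hS : ∀ L ∈ S, IsLine L) :
    ∃ (δ : Set (ℝ × ℝ) → ℝ × ℝ) (D : ℝ × ℝ → Poly2), (∀ L ∈ S, ∀ P, P ∈ L ↔ evalPt (D P) (δ L) = 0) ∧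
      (∀ L ∈ S, ∀ P ∈ L, (D P).totalDegree = 1) := by
  classical
  have hQ : ∃ Q : ℝ × ℝ, ∀ L ∈ S, Q ∉ L := by
    choose! l hl hL using hS
    have hp : (∏ L ∈ S, l L) ≠ 0 := by
      rw [Finset.prod_ne_zero_iff]
      intro L hLS h0
      have := hl L hLS
      rw [h0] at this
      simp at this
    by_contra hc
    push Not at hc
    apply hp
    apply MvPolynomial.funext
    intro x
    obtain ⟨L, hLS, hQ⟩ := hc (x 0, x 1)
    rw [hL L hLS, mem_zeroSet] at hQ
    rw [map_prod, map_zero, Finset.prod_eq_zero_iff]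
    refine ⟨L, hLS, ?_⟩
    have hx : (fun i : Fin 2 => if i = 0 then x 0 else x 1) = x := by
      funext i; fin_cases i <;> simp
    unfold evalPt at hQ
    simp only [hx] at hQ
    exact hQ
  obtain ⟨Q, hQ⟩ := hQ
  have key : ∀ L ∈ S, ∃ d : ℝ × ℝ, ∀ P : ℝ × ℝ, P ∈ L ↔ (P.1 - Q.1) * d.1 + (P.2 - Q.2) * d.2 + (-1) = 0 := by
    intro L hL
    obtain ⟨l, hl, hLl⟩ := hS L hL
    obtain ⟨a, b, c, rfl, hab⟩ := lin_form hl
    have hq := hQ L hL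
    rw [hLl, mem_zeroSet, evalPt_lin] at hq
    refine ⟨(-a / (a * Q.1 + b * Q.2 + c), -b / (a * Q.1 + b * Q.2 + c)), ?_⟩
    intro P
    rw [hLl, mem_zeroSet, evalPt_lin]
    have : (P.1 - Q.1) * (-a / (a * Q.1 + b * Q.2 + c)) + (P.2 - Q.2) * (-b / (a * Q.1 + b * Q.2 + c)) + (-1)
        = - (a * P.1 + b * P.2 + c) / (a * Q.1 + b * Q.2 + c) := by
      have hq' : a * Q.1 + b * Q.2 + c ≠ 0 := hq
      generalize hw : a * Q.1 + b * Q.2 + c = w at hq' ⊢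
      obtain rfl : c = w - a * Q.1 - b * Q.2 := by linarith
      field_simp
      ring
    simp only [this]
    rw [div_eq_zero_iff, neg_eq_zero]
    simp [hq]
  choose! δ hδ using key
  refine ⟨δ, fun P => lin (P.1 - Q.1) (P.2 - Q.2) (-1), ?_, ?_⟩
  · intro L hL P
    rw [evalPt_lin]; exact hδ L hL P
  · intro L hL P hP
    apply lin_deg
    by_contra h
    push Not at h
    apply hQ L hL
    have : P = Q := Prod.ext (by linarith) (by linarith)
    rwa [← this]

section
variable {n : ℕ} {X : Finset (ℝ × ℝ)} {a b c : LSeq}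

theorem Tri.off_a' (h : Tri n X a b c) {x y z x' : ℕ} (e : x + y + z = n) {P : ℝ × ℝ}
    (hP : P ∈ cut X a b c x y z) (hx' : x' < n) (hne : x' ≠ x) (hle : x' ≤ x + z) (hy : y < n) : P ∉ a x' := by
  intro hm
  rcases Nat.lt_or_ge x' x with hl | hl
  · exact (mem_cut.1 hP).2.1 x' hl hm
  · obtain ⟨Q, hQ⟩ := h.exists_node (x := x') (y := y) (z := n - x' - y) (by omega)
    have := h.inter_ab (by omega) hx' hy hQ hm (h.mem_b e hy hP)
    rw [← this] at hQ
    exact (mem_cut.1 hQ).2.1 x (by omega) (h.mem_a e (by omega) hP)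

theorem Tri.off_a (h : Tri n X a b c) {x y z x' : ℕ} (e : x + y + z = n) {P : ℝ × ℝ}
    (hP : P ∈ cut X a b c x y z) (hx' : x' < n) (hne : x' ≠ x) (hle : x' ≤ x + z ∨ x' ≤ x + y) : P ∉ a x' := by
  rcases Nat.lt_or_ge x' x with hl | hl
  · exact (mem_cut.1 hP).2.1 x' hl
  rcases hle with hle | hle
  · exact h.off_a' e hP hx' hne hle (by omega)
  · refine h.rot.rot.swap.off_a' (x := x) (y := z) (z := y) (by omega) ?_ hx' hne hle (by omega)
    rw [cut_swap, ← cut_rot, ← cut_rot]; exact hP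

theorem Tri.off_b (h : Tri n X a b c) {x y z x' : ℕ} (e : x + y + z = n) {P : ℝ × ℝ}
    (hP : P ∈ cut X a b c x y z) (hx' : x' < n) (hne : x' ≠ y) (hle : x' ≤ y + z ∨ x' ≤ y + x) : P ∉ b x' :=
  h.rot.off_a (x := y) (y := z) (z := x) (by omega) (by rwa [← cut_rot]) hx' hne hle.symm

theorem Tri.off_c (h : Tri n X a b c) {x y z x' : ℕ} (e : x + y + z = n) {P : ℝ × ℝ}
    (hP : P ∈ cut X a b c x y z) (hx' : x' < n) (hne : x' ≠ z) (hle : x' ≤ z + y ∨ x' ≤ z + x) : P ∉ c x' :=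
  h.rot.rot.off_a (x := z) (y := x) (z := y) (by omega) (by rwa [← cut_rot, ← cut_rot]) hx' hne hle

theorem cut_shift (x y z : ℕ) : cut (rm X (c 0)) a b (fun i => c (i + 1)) x y z = cut X a b c x y (z + 1) := by
  ext P
  simp only [mem_cut, mem_rm]
  constructor
  · rintro ⟨⟨h1, h2⟩, h3, h4, h5⟩
    refine ⟨h1, h3, h4, ?_⟩
    intro i hi
    rcases i with _ | i
    · exact h2
    · exact h5 i (by omega)
  · rintro ⟨h1, h3, h4, h5⟩
    exact ⟨⟨h1, h5 0 (by omega)⟩, h3, h4, fun i hi => h5 (i + 1) (by omega)⟩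

theorem Tri.shift (h : Tri (n + 1) X a b c) (hn : 0 < n) : Tri n (rm X (c 0)) a b (fun i => c (i + 1)) where
  pos := hn
  tt x y z d e := by
    have := h.tt x y (z + 1) d (by omega)
    unfold TT at this ⊢
    rw [cut_shift]
    exact this
  na x d e := by
    rw [cut_shift, cut_succ_c]
    obtain ⟨h1, h2, h3, h4, h5, h6, h7⟩ := h.tt x 0 0 (d + 2) (by omega)
    exact (h.na x (d + 1) (by omega)).persist h1.1 h2 h4 h6
  nb x d e := by
    rw [cut_shift, cut_succ_c]
    obtain ⟨h1, h2, h3, h4, h5, h6, h7⟩ := h.tt 0 x 0 (d + 2) (by omega)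
    exact (h.nb x (d + 1) (by omega)).persist h1.1 h3 h4 h7
  nc x d e := by
    rw [cut_shift]
    exact h.nc (x + 1) d (by omega)

end

/-- dual data for the lines of a triangle -/
structure DD (n : ℕ) (X : Finset (ℝ × ℝ)) (a b c : LSeq) (δ : Set (ℝ × ℝ) → ℝ × ℝ) (D : ℝ × ℝ → Poly2) : Prop where
  ia : ∀ x < n, ∀ P, P ∈ a x ↔ evalPt (D P) (δ (a x)) = 0
  ib : ∀ x < n, ∀ P, P ∈ b x ↔ evalPt (D P) (δ (b x)) = 0
  ic : ∀ x < n, ∀ P, P ∈ c x ↔ evalPt (D P) (δ (c x)) = 0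
  dg : ∀ P ∈ X, (D P).totalDegree = 1

section
variable {n : ℕ} {X : Finset (ℝ × ℝ)} {a b c : LSeq} {δ : Set (ℝ × ℝ) → ℝ × ℝ} {D : ℝ × ℝ → Poly2}

theorem DD.rot (h : DD n X a b c δ D) : DD n X b c a δ D := ⟨h.ib, h.ic, h.ia, h.dg⟩

theorem DD.shift (h : DD (n + 1) X a b c δ D) : DD n (rm X (c 0)) a b (fun i => c (i + 1)) δ D :=
  ⟨fun x hx => h.ia x (by omega), fun x hx => h.ib x (by omega), fun x hx => h.ic (x + 1) (by omega),
    fun P hP => h.dg P (mem_rm.1 hP).1⟩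

theorem Tri.ne_bc (h : Tri n X a b c) {x y : ℕ} (e : x + y ≤ n) (hx : x < n) (hy : y < n) : b x ≠ c y :=
  h.rot.ne_ab e hx hy

theorem Tri.ne_ca (h : Tri n X a b c) {x y : ℕ} (e : x + y ≤ n) (hx : x < n) (hy : y < n) : c x ≠ a y :=
  h.rot.rot.ne_ab e hx hy

theorem step9 (h : Tri n X a b c) (hD : DD n X a b c δ D) {F : Poly2} (hF : DegLT F 4) {i1 i2 i3 j0 j1 j2 k0 k1 k2 : ℕ}
    (s1 : i2 + j2 + k2 = n) (s2 : i3 + j0 + k1 = n) (s3 : i1 + j1 + k0 = n)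
    (s4 : i1 + j2 + k1 = n) (s5 : i3 + j1 + k2 = n) (s6 : i2 + j0 + k0 = n)
    (l : (i1 < n ∧ i2 < n ∧ i3 < n) ∧ (j0 < n ∧ j1 < n ∧ j2 < n) ∧ (k0 < n ∧ k1 < n ∧ k2 < n))
    (n1 : k1 ≠ k2 ∧ (k1 ≤ k2 + j2 ∨ k1 ≤ k2 + i2))
    (n2 : i3 ≠ i2 ∧ (i3 ≤ i2 + k2 ∨ i3 ≤ i2 + j2))
    (n3 : j0 ≠ j2 ∧ (j0 ≤ j2 + k2 ∨ j0 ≤ j2 + i2))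
    (n4 : i1 ≠ i2 ∧ (i1 ≤ i2 + k2 ∨ i1 ≤ i2 + j2))
    (n5 : j1 ≠ j2 ∧ (j1 ≤ j2 + k2 ∨ j1 ≤ j2 + i2))
    (n6 : i1 ≠ i3 ∧ (i1 ≤ i3 + k1 ∨ i1 ≤ i3 + j0))
    (n7 : j1 ≠ j0 ∧ (j1 ≤ j0 + k1 ∨ j1 ≤ j0 + i3))
    (fa1 : evalPt F (δ (a i1)) = 0) (fa2 : evalPt F (δ (a i2)) = 0) (fa3 : evalPt F (δ (a i3)) = 0)
    (fb0 : evalPt F (δ (b j0)) = 0) (fb1 : evalPt F (δ (b j1)) = 0) (fb2 : evalPt F (δ (b j2)) = 0)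
    (fc1 : evalPt F (δ (c k1)) = 0) (fc2 : evalPt F (δ (c k2)) = 0) : evalPt F (δ (c k0)) = 0 := by
  obtain ⟨⟨li1, li2, li3⟩, ⟨lj0, lj1, lj2⟩, lk0, lk1, lk2⟩ := l
  obtain ⟨P1, hP1⟩ := h.exists_node s1
  obtain ⟨P2, hP2⟩ := h.exists_node s2
  obtain ⟨P3, hP3⟩ := h.exists_node s3
  obtain ⟨R1, hR1⟩ := h.exists_node s4
  obtain ⟨R2, hR2⟩ := h.exists_node s5
  obtain ⟨R3, hR3⟩ := h.exists_node s6
  have mX : ∀ {P x y z}, P ∈ cut X a b c x y z → P ∈ X := fun h => (mem_cut.1 h).1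
  have ab : ∀ {x y}, x + y ≤ n → x < n → y < n → δ (a x) ≠ δ (b y) := by
    intro x y e hx hy he
    apply h.ne_ab e hx hy
    ext P; rw [hD.ia x hx, hD.ib y hy, he]
  have bc : ∀ {x y}, x + y ≤ n → x < n → y < n → δ (b x) ≠ δ (c y) := by
    intro x y e hx hy he
    apply h.ne_bc e hx hy
    ext P; rw [hD.ib x hx, hD.ic y hy, he]
  have ca : ∀ {x y}, x + y ≤ n → x < n → y < n → δ (c x) ≠ δ (a y) := by
    intro x y e hx hy he
    apply h.ne_ca e hx hy
    ext P; rw [hD.ic x hx, hD.ia y hy, he]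
  exact cb_lemma (hD.dg _ (mX hR1)) (hD.dg _ (mX hR2)) (hD.dg _ (mX hR3)) (hD.dg _ (mX hP1)) (hD.dg _ (mX hP2)) (hD.dg _ (mX hP3)) hF
    ((hD.ib _ lj2 _).1 (h.mem_b s4 lj2 hR1)) ((hD.ic _ lk1 _).1 (h.mem_c s4 lk1 hR1)) ((hD.ia _ li1 _).1 (h.mem_a s4 li1 hR1))
    ((hD.ic _ lk2 _).1 (h.mem_c s5 lk2 hR2)) ((hD.ia _ li3 _).1 (h.mem_a s5 li3 hR2)) ((hD.ib _ lj1 _).1 (h.mem_b s5 lj1 hR2))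
    ((hD.ia _ li2 _).1 (h.mem_a s6 li2 hR3)) ((hD.ib _ lj0 _).1 (h.mem_b s6 lj0 hR3)) ((hD.ic _ lk0 _).1 (h.mem_c s6 lk0 hR3))
    ((hD.ib _ lj2 _).1 (h.mem_b s1 lj2 hP1)) ((hD.ic _ lk2 _).1 (h.mem_c s1 lk2 hP1)) ((hD.ia _ li2 _).1 (h.mem_a s1 li2 hP1))
    ((hD.ic _ lk1 _).1 (h.mem_c s2 lk1 hP2)) ((hD.ia _ li3 _).1 (h.mem_a s2 li3 hP2)) ((hD.ib _ lj0 _).1 (h.mem_b s2 lj0 hP2))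
    ((hD.ia _ li1 _).1 (h.mem_a s3 li1 hP3)) ((hD.ib _ lj1 _).1 (h.mem_b s3 lj1 hP3)) ((hD.ic _ lk0 _).1 (h.mem_c s3 lk0 hP3))
    fb2 fc1 fa1 fc2 fa3 fb1 fa2 fb0
    (bc (by omega) lj2 lk2) (ab (by omega) li2 lj2).symm (ca (by omega) lk2 li2)
    (ca (by omega) lk1 li3) (bc (by omega) lj0 lk1).symm (ab (by omega) li3 lj0) (ab (by omega) li1 lj1)
    (fun t => h.off_c s1 hP1 lk1 n1.1 n1.2 ((hD.ic _ lk1 _).2 t))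
    (fun t => h.off_a s1 hP1 li3 n2.1 n2.2 ((hD.ia _ li3 _).2 t))
    (fun t => h.off_b s1 hP1 lj0 n3.1 n3.2 ((hD.ib _ lj0 _).2 t))
    (fun t => h.off_a s1 hP1 li1 n4.1 n4.2 ((hD.ia _ li1 _).2 t))
    (fun t => h.off_b s1 hP1 lj1 n5.1 n5.2 ((hD.ib _ lj1 _).2 t))
    (fun t => h.off_a s2 hP2 li1 n6.1 n6.2 ((hD.ia _ li1 _).2 t))
    (fun t => h.off_b s2 hP2 lj1 n7.1 n7.2 ((hD.ib _ lj1 _).2 t))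

theorem step_up (h : Tri n X a b c) (hD : DD n X a b c δ D) {F : Poly2} (hF : DegLT F 4) (hn : 4 ≤ n)
    (fa : ∀ x < 3, evalPt F (δ (a x)) = 0) (fb : ∀ x < 3, evalPt F (δ (b x)) = 0)
    (fc : ∀ x < 3, 0 < x → evalPt F (δ (c (n - 1 - x))) = 0) : evalPt F (δ (c (n - 1))) = 0 := by
  refine step9 h hD hF (i1 := 0) (i2 := 1) (i3 := 2) (j0 := 0) (j1 := 1) (j2 := 2) (k0 := n - 1) (k1 := n - 1 - 1) (k2 := n - 1 - 2)
    (by omega) (by omega) (by omega) (by omega) (by omega) (by omega) (by omega) (by omega) (by omega) (by omega) (by omega) (by omega)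
    (by omega) (by omega) (fa 0 (by omega)) (fa 1 (by omega)) (fa 2 (by omega)) (fb 0 (by omega)) (fb 1 (by omega)) (fb 2 (by omega))
    (fc 1 (by omega) (by omega)) (fc 2 (by omega) (by omega))

theorem step_down (h : Tri n X a b c) (hD : DD n X a b c δ D) {F : Poly2} (hF : DegLT F 4) (hn : 5 ≤ n)
    (fa : ∀ x < n - 1, evalPt F (δ (a x)) = 0) (fb : ∀ x < n - 1, evalPt F (δ (b x)) = 0)
    (fc : ∀ x < n, 0 < x → evalPt F (δ (c x)) = 0) : evalPt F (δ (c 0)) = 0 := by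
  refine step9 h hD hF (i1 := 3) (i2 := 2) (i3 := 1) (j0 := n - 2) (j1 := n - 3) (j2 := n - 4) (k0 := 0) (k1 := 1) (k2 := 2)
    (by omega) (by omega) (by omega) (by omega) (by omega) (by omega) (by omega) (by omega) (by omega) (by omega) (by omega) (by omega)
    (by omega) (by omega) (fa _ (by omega)) (fa _ (by omega)) (fa _ (by omega)) (fb _ (by omega)) (fb _ (by omega)) (fb _ (by omega))
    (fc 1 (by omega) (by omega)) (fc 2 (by omega) (by omega))

end

theorem cubic_thm (m : ℕ) : ∀ (X : Finset (ℝ × ℝ)) (a b c : LSeq) (δ : Set (ℝ × ℝ) → ℝ × ℝ) (D : ℝ × ℝ → Poly2),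
    Tri (m + 4) X a b c → DD (m + 4) X a b c δ D → ∃ F : Poly2, F ≠ 0 ∧ DegLT F 4 ∧
      (∀ x < m + 4, evalPt F (δ (a x)) = 0) ∧ (∀ x < m + 4, evalPt F (δ (b x)) = 0) ∧
      (∀ x < m + 4, evalPt F (δ (c x)) = 0) := by
  induction m with
  | zero =>
    intro X a b c δ D h hD
    obtain ⟨F, h0, h4, hF⟩ := exists_cubic ![δ (a 0), δ (a 1), δ (a 2), δ (b 0), δ (b 1), δ (b 2), δ (c 0), δ (c 1), δ (c 2)]
    have fa : ∀ x < 3, evalPt F (δ (a x)) = 0 := by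
      intro x hx
      interval_cases x
      · exact hF 0
      · exact hF 1
      · exact hF 2
    have fb : ∀ x < 3, evalPt F (δ (b x)) = 0 := by
      intro x hx
      interval_cases x
      · exact hF 3
      · exact hF 4
      · exact hF 5
    have fc : ∀ x < 3, evalPt F (δ (c x)) = 0 := by
      intro x hx
      interval_cases x
      · exact hF 6
      · exact hF 7
      · exact hF 8
    have c3 := step_up h hD h4 (by omega) fa fb (fun x hx hx' => fc _ (by omega))
    have a3 := step_up h.rot hD.rot h4 (by omega) fb fc (fun x hx hx' => fa _ (by omega))
    have b3 := step_up h.rot.rot hD.rot.rot h4 (by omega) fc fa (fun x hx hx' => fb _ (by omega))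
    refine ⟨F, h0, h4, ?_, ?_, ?_⟩
    · intro x hx
      rcases Nat.lt_or_ge x 3 with hl | hl
      · exact fa x hl
      · obtain rfl : x = 3 := by omega
        exact a3
    · intro x hx
      rcases Nat.lt_or_ge x 3 with hl | hl
      · exact fb x hl
      · obtain rfl : x = 3 := by omega
        exact b3
    · intro x hx
      rcases Nat.lt_or_ge x 3 with hl | hl
      · exact fc x hl
      · obtain rfl : x = 3 := by omega
        exact c3
  | succ m ih =>
    intro X a b c δ D h hD
    have h' : Tri (m + 4 + 1) X a b c := by rwa [show m + 4 + 1 = m + 1 + 4 by omega]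
    have hD' : DD (m + 4 + 1) X a b c δ D := by rwa [show m + 4 + 1 = m + 1 + 4 by omega]
    obtain ⟨F, h0, h4, fa, fb, fc⟩ := ih _ _ _ _ _ _ (h'.shift (by omega)) hD'.shift
    have fc' : ∀ x < m + 1 + 4, 0 < x → evalPt F (δ (c x)) = 0 := by
      intro x hx hx'
      obtain ⟨x, rfl⟩ : ∃ k, x = k + 1 := ⟨x - 1, by omega⟩
      exact fc x (by omega)
    have c0 := step_down h hD h4 (by omega) (fun x hx => fa x (by omega)) (fun x hx => fb x (by omega)) fc'
    have fc'' : ∀ x < m + 1 + 4, evalPt F (δ (c x)) = 0 := by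
      intro x hx
      rcases Nat.eq_zero_or_pos x with rfl | hp
      · exact c0
      · exact fc' x hx hp
    have al := step_up h.rot hD.rot h4 (by omega) (fun x hx => fb x (by omega)) (fun x hx => fc'' x (by omega))
      (fun x hx hx' => fa _ (by omega))
    have bl := step_up h.rot.rot hD.rot.rot h4 (by omega) (fun x hx => fc'' x (by omega)) (fun x hx => fa x (by omega))
      (fun x hx hx' => fb _ (by omega))
    refine ⟨F, h0, h4, ?_, ?_, fc''⟩
    · intro x hx
      rcases Nat.lt_or_ge x (m + 4) with hl | hl
      · exact fa x hl
      · obtain rfl : x = m + 1 + 4 - 1 := by omega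
        exact al
    · intro x hx
      rcases Nat.lt_or_ge x (m + 4) with hl | hl
      · exact fb x hl
      · obtain rfl : x = m + 1 + 4 - 1 := by omega
        exact bl

section
variable {n : ℕ} {X : Finset (ℝ × ℝ)} {a b c : LSeq}

theorem Tri.exists_dd (h : Tri n X a b c) : ∃ δ D, DD n X a b c δ D := by
  classical
  obtain ⟨δ, D, h1, h2⟩ := exists_dual ((Finset.range n).image a ∪ (Finset.range n).image b ∪ (Finset.range n).image c) (by
    intro L hL
    simp only [Finset.mem_union, Finset.mem_image, Finset.mem_range] at hL
    rcases hL with (⟨x, hx, rfl⟩ | ⟨x, hx, rfl⟩) | ⟨x, hx, rfl⟩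
    · exact h.la hx
    · exact h.lb hx
    · exact h.lc hx)
  have ma : ∀ x < n, a x ∈ (Finset.range n).image a ∪ (Finset.range n).image b ∪ (Finset.range n).image c := by
    intro x hx
    exact Finset.mem_union_left _ (Finset.mem_union_left _ (Finset.mem_image_of_mem _ (Finset.mem_range.2 hx)))
  have mb : ∀ x < n, b x ∈ (Finset.range n).image a ∪ (Finset.range n).image b ∪ (Finset.range n).image c := by
    intro x hx
    exact Finset.mem_union_left _ (Finset.mem_union_right _ (Finset.mem_image_of_mem _ (Finset.mem_range.2 hx)))
  have mc : ∀ x < n, c x ∈ (Finset.range n).image a ∪ (Finset.range n).image b ∪ (Finset.range n).image c := by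
    intro x hx
    exact (Finset.mem_union_right _ (Finset.mem_image_of_mem _ (Finset.mem_range.2 hx)))
  refine ⟨δ, D, fun x hx => h1 _ (ma x hx), fun x hx => h1 _ (mb x hx), fun x hx => h1 _ (mc x hx), ?_⟩
  intro P hP
  have := h.pos
  obtain ⟨x, y, z, e, hc⟩ := h.exists_index hP
  rcases Nat.lt_or_ge x n with hx | hx
  · exact h2 _ (ma x hx) P (h.mem_a e hx hc)
  · exact h2 _ (mb y (by omega)) P (h.mem_b e (by omega) hc)

theorem Tri.disj_c (h : Tri n X a b c) {t : ℕ} (ht : 0 < t) (htn : t < n) {P : ℝ × ℝ} (hP : P ∈ X) (h0 : P ∈ c 0) :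
    P ∉ c t := by
  classical
  intro hPt
  obtain ⟨i, j, z, e, hc⟩ := h.exists_index hP
  obtain rfl : z = 0 := by
    by_contra hz
    exact (mem_cut.1 hc).2.2.2 0 (by omega) h0
  have hij : i < t ∧ j < t := by
    by_contra hcon
    exact h.off_c e hc htn (by omega) (by omega) hPt
  obtain ⟨hi, hj⟩ := hij
  obtain ⟨m, rfl⟩ : ∃ m, n = m + 4 := ⟨n - 4, by omega⟩
  obtain ⟨δ, D, hD⟩ := h.exists_dd
  obtain ⟨F, F0, F4, fa, fb, fc⟩ := cubic_thm m _ _ _ _ _ _ h hD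
  have mX : ∀ {P x y z}, P ∈ cut X a b c x y z → P ∈ X := fun h => (mem_cut.1 h).1
  have ab : ∀ {x y}, x < m + 4 → y < m + 4 → a x ≠ b y → δ (a x) ≠ δ (b y) := by
    intro x y hx hy hne he
    apply hne
    ext P; rw [hD.ia x hx, hD.ib y hy, he]
  have ac : ∀ {x y}, x < m + 4 → y < m + 4 → a x ≠ c y → δ (a x) ≠ δ (c y) := by
    intro x y hx hy hne he
    apply hne
    ext P; rw [hD.ia x hx, hD.ic y hy, he]
  have bc : ∀ {x y}, x < m + 4 → y < m + 4 → b x ≠ c y → δ (b x) ≠ δ (c y) := by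
    intro x y hx hy hne he
    apply hne
    ext P; rw [hD.ib x hx, hD.ic y hy, he]
  obtain ⟨Q, hQ⟩ := h.exists_node (x := m + 4 - t) (y := 0) (z := t) (by omega)
  obtain ⟨Q', hQ'⟩ := h.exists_node (x := 0) (y := m + 4 - t) (z := t) (by omega)
  have e1 : δ (a i) ≠ δ (c t) := by
    refine ac (by omega) htn fun he => ?_
    refine h.off_a (x' := i) (by omega) hQ (by omega) (by omega) (by omega) ?_
    rw [he]; exact h.mem_c (by omega) htn hQ
  have e2 : δ (b j) ≠ δ (c t) := by
    refine bc (by omega) htn fun he => ?_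
    refine h.off_b (x' := j) (by omega) hQ' (by omega) (by omega) (by omega) ?_
    rw [he]; exact h.mem_c (by omega) htn hQ'
  have e3 : δ (c 0) ≠ δ (c t) := by
    intro he
    have he' : c 0 = c t := by
      ext P; rw [hD.ic 0 (by omega), hD.ic t htn, he]
    refine (mem_cut.1 hQ).2.2.2 0 ht ?_
    rw [he']; exact h.mem_c (by omega) htn hQ
  have e4 : δ (a i) ≠ δ (b j) := ab (by omega) (by omega) (h.ne_ab (by omega) (by omega) (by omega))
  have e5 : δ (a i) ≠ δ (c 0) := ac (by omega) (by omega) (h.ne_ca (by omega) (by omega) (by omega)).symm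
  have e6 : δ (b j) ≠ δ (c 0) := bc (by omega) (by omega) (h.ne_bc (by omega) (by omega) (by omega))
  obtain ⟨F1, hF1⟩ : D P ∣ F := by
    apply dvd_of_zeros (hD.dg _ hP) F4 {δ (a i), δ (b j), δ (c 0), δ (c t)}
    · rw [Finset.card_insert_of_notMem (by simp [*]), Finset.card_insert_of_notMem (by simp [*]),
        Finset.card_pair e3]
    · intro R hR
      simp only [Finset.mem_insert, Finset.mem_singleton] at hR
      rcases hR with rfl | rfl | rfl | rfl
      · exact ⟨(hD.ia i (by omega) P).1 (h.mem_a e (by omega) hc), fa i (by omega)⟩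
      · exact ⟨(hD.ib j (by omega) P).1 (h.mem_b e (by omega) hc), fb j (by omega)⟩
      · exact ⟨(hD.ic 0 (by omega) P).1 h0, fc 0 (by omega)⟩
      · exact ⟨(hD.ic t (by omega) P).1 hPt, fc t (by omega)⟩
  obtain ⟨P1, hP1⟩ := h.exists_node (x := i - 1) (y := j - 1) (z := 2) (by omega)
  obtain ⟨P2, hP2⟩ := h.exists_node (x := i - 2) (y := j - 2) (z := 4) (by omega)
  rw [hF1] at F4
  have d1 := F4.mul_cancel (hD.dg _ hP)
  have za : ∀ {R x y z x'}, R ∈ cut X a b c x y z → x' < x → x' < m + 4 → ∀ H, evalPt (D R * H) (δ (a x')) = 0 → evalPt H (δ (a x')) = 0 := by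
    intro R x y z x' hR hx hx' H hH
    rw [evalPt_mul] at hH
    refine (mul_eq_zero.1 hH).resolve_left fun h0 => (mem_cut.1 hR).2.1 x' hx ((hD.ia x' hx' R).2 h0)
  have zb : ∀ {R x y z x'}, R ∈ cut X a b c x y z → x' < y → x' < m + 4 → ∀ H, evalPt (D R * H) (δ (b x')) = 0 → evalPt H (δ (b x')) = 0 := by
    intro R x y z x' hR hx hx' H hH
    rw [evalPt_mul] at hH
    refine (mul_eq_zero.1 hH).resolve_left fun h0 => (mem_cut.1 hR).2.2.1 x' hx ((hD.ib x' hx' R).2 h0)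
  have zc : ∀ {R x'}, R ∉ c x' → x' < m + 4 → ∀ H, evalPt (D R * H) (δ (c x')) = 0 → evalPt H (δ (c x')) = 0 := by
    intro R x' hR hx' H hH
    rw [evalPt_mul] at hH
    refine (mul_eq_zero.1 hH).resolve_left fun h0 => hR ((hD.ic x' hx' R).2 h0)
  rw [hF1] at fa fb fc
  obtain ⟨F2, hF2⟩ : D P1 ∣ F1 := by
    apply dvd_of_zeros (hD.dg _ (mX hP1)) d1 {δ (a (i - 1)), δ (b (j - 1)), δ (c 2)}
    · have g1 : δ (a (i - 1)) ≠ δ (b (j - 1)) := ab (by omega) (by omega) (h.ne_ab (by omega) (by omega) (by omega))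
      have g2 : δ (a (i - 1)) ≠ δ (c 2) := ac (by omega) (by omega) (h.ne_ca (by omega) (by omega) (by omega)).symm
      have g3 : δ (b (j - 1)) ≠ δ (c 2) := bc (by omega) (by omega) (h.ne_bc (by omega) (by omega) (by omega))
      rw [Finset.card_insert_of_notMem (by simp [*]), Finset.card_pair g3]
    · intro R hR
      simp only [Finset.mem_insert, Finset.mem_singleton] at hR
      rcases hR with rfl | rfl | rfl
      · exact ⟨(hD.ia _ (by omega) _).1 (h.mem_a (by omega) (by omega) hP1), za hc (by omega) (by omega) _ (fa (i - 1) (by omega))⟩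
      · exact ⟨(hD.ib _ (by omega) _).1 (h.mem_b (by omega) (by omega) hP1), zb hc (by omega) (by omega) _ (fb (j - 1) (by omega))⟩
      · exact ⟨(hD.ic _ (by omega) _).1 (h.mem_c (by omega) (by omega) hP1),
          zc (h.off_c e hc (by omega) (by omega) (by omega)) (by omega) _ (fc 2 (by omega))⟩
  rw [hF2] at d1
  have d2 := d1.mul_cancel (hD.dg _ (mX hP1))
  obtain ⟨F3, hF3⟩ : D P2 ∣ F2 := by
    apply dvd_of_zeros (hD.dg _ (mX hP2)) d2 {δ (a (i - 2)), δ (b (j - 2))}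
    · rw [Finset.card_pair]
      exact ab (by omega) (by omega) (h.ne_ab (by omega) (by omega) (by omega))
    · intro R hR
      simp only [Finset.mem_insert, Finset.mem_singleton] at hR
      rcases hR with rfl | rfl
      · refine ⟨(hD.ia _ (by omega) _).1 (h.mem_a (by omega) (by omega) hP2), za hP1 (by omega) (by omega) _ ?_⟩
        rw [← hF2]
        exact za hc (by omega) (by omega) _ (fa _ (by omega))
      · refine ⟨(hD.ib _ (by omega) _).1 (h.mem_b (by omega) (by omega) hP2), zb hP1 (by omega) (by omega) _ ?_⟩
        rw [← hF2]
        exact zb hc (by omega) (by omega) _ (fb _ (by omega))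
  rw [hF3] at d2
  have d3 := d2.mul_cancel (hD.dg _ (mX hP2))
  have f3 : evalPt F3 (δ (c 1)) = 0 := by
    refine zc (R := P2) ((mem_cut.1 hP2).2.2.2 1 (by omega)) (by omega) _ ?_
    rw [← hF3]
    refine zc (R := P1) ((mem_cut.1 hP1).2.2.2 1 (by omega)) (by omega) _ ?_
    rw [← hF2]
    exact zc (h.off_c e hc (by omega) (by omega) (by omega)) (by omega) _ (fc 1 (by omega))
  obtain ⟨S, hS⟩ := h.exists_node (x := 0) (y := m + 3) (z := 1) (by omega)
  obtain ⟨F5, hF5⟩ : D S ∣ F3 := by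
    apply dvd_of_zeros (hD.dg _ (mX hS)) d3 {δ (c 1)}
    · simp
    · intro R hR
      simp only [Finset.mem_singleton] at hR
      subst hR
      exact ⟨(hD.ic _ (by omega) _).1 (h.mem_c (by omega) (by omega) hS), f3⟩
  rw [hF5] at d3
  have := (d3.mul_cancel (hD.dg _ (mX hS))).zero
  apply F0
  rw [hF1, hF2, hF3, hF5, this]; ring

theorem Tri.disj_a (h : Tri n X a b c) {t : ℕ} (ht : 0 < t) (htn : t < n) {P : ℝ × ℝ} (hP : P ∈ X) (h0 : P ∈ a 0) :
    P ∉ a t := h.rot.disj_c ht htn hP h0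

theorem Tri.disj_b (h : Tri n X a b c) {t : ℕ} (ht : 0 < t) (htn : t < n) {P : ℝ × ℝ} (hP : P ∈ X) (h0 : P ∈ b 0) :
    P ∉ b t := h.rot.rot.disj_c ht htn hP h0
end

/-- four maximal lines -/
structure Four (n : ℕ) (X : Finset (ℝ × ℝ)) (L A B D : Set (ℝ × ℝ)) : Prop where
  g : G n X
  mL : Mx n X L
  mA : Mx n X A
  mB : Mx n X B
  mD : Mx n X D
  LA : L ≠ A
  LB : L ≠ B
  LD : L ≠ D
  AB : A ≠ B
  AD : A ≠ D
  BD : B ≠ D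
  all : ∀ K, Mx n X K → K = L ∨ K = A ∨ K = B ∨ K = D

theorem four_of_pair {n : ℕ} {X : Finset (ℝ × ℝ)} (hX : G (n + 1) X) (h : mm (n + 1) X = 4) {L A : Set (ℝ × ℝ)}
    (hL : Mx (n + 1) X L) (hA : Mx (n + 1) X A) (hLA : L ≠ A) : ∃ B D, Four (n + 1) X L A B D := by
  have f := finite_mx n X
  have h1 : ({K | Mx (n + 1) X K} \ {L}).ncard + 1 = 4 := by
    rw [Set.ncard_sdiff_singleton_add_one (show L ∈ {K | Mx (n + 1) X K} from hL) f]; exact h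
  have h2 : (({K | Mx (n + 1) X K} \ {L}) \ {A}).ncard + 1 = ({K | Mx (n + 1) X K} \ {L}).ncard := by
    rw [Set.ncard_sdiff_singleton_add_one _ (f.sdiff)]
    exact ⟨hA, fun h => hLA h.symm⟩
  obtain ⟨B, D, hBD, hs⟩ := Set.ncard_eq_two.1 (show (({K | Mx (n + 1) X K} \ {L}) \ {A}).ncard = 2 by omega)
  have key : ∀ K, ((Mx (n + 1) X K ∧ K ≠ L) ∧ K ≠ A) ↔ (K = B ∨ K = D) := by
    intro K
    have : K ∈ (({K | Mx (n + 1) X K} \ {L}) \ {A}) ↔ K ∈ ({B, D} : Set _) := by rw [hs]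
    simpa using this
  have kB := (key B).2 (Or.inl rfl)
  have kD := (key D).2 (Or.inr rfl)
  refine ⟨B, D, hX, hL, hA, kB.1.1, kD.1.1, hLA, kB.1.2.symm, kD.1.2.symm, kB.2.symm, kD.2.symm, hBD, ?_⟩
  intro K hK
  by_cases e1 : K = L
  · exact Or.inl e1
  by_cases e2 : K = A
  · exact Or.inr (Or.inl e2)
  exact Or.inr (Or.inr ((key K).1 ⟨⟨hK, e1⟩, e2⟩))

theorem Four.swapLA {n : ℕ} {X : Finset (ℝ × ℝ)} {L A B D : Set (ℝ × ℝ)} (h : Four n X L A B D) : Four n X A L B D :=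
  ⟨h.g, h.mA, h.mL, h.mB, h.mD, h.LA.symm, h.AB, h.AD, h.LB, h.LD, h.BD, fun K hK => by have := h.all K hK; tauto⟩

theorem Four.rot3 {n : ℕ} {X : Finset (ℝ × ℝ)} {L A B D : Set (ℝ × ℝ)} (h : Four n X L A B D) : Four n X L B D A :=
  ⟨h.g, h.mL, h.mB, h.mD, h.mA, h.LB, h.LD, h.LA, h.BD, h.AB.symm, h.AD.symm, fun K hK => by have := h.all K hK; tauto⟩

theorem Four.ex3 {n : ℕ} {X : Finset (ℝ × ℝ)} {L A B D : Set (ℝ × ℝ)} (h : Four (n + 1) X L A B D)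
    (hno : ∀ K, ¬ Nx (n + 1) X L K) : Ex3 n (rm X L) A B D := by
  refine ⟨h.g.rm h.mL, mx_rm h.g.1 h.mL h.mA h.LA, mx_rm h.g.1 h.mL h.mB h.LB, mx_rm h.g.1 h.mL h.mD h.LD, h.AB, h.AD, h.BD, ?_⟩
  intro K hK
  rcases rm_mx_cases h.mL.1 hK with ⟨e, f⟩ | e
  · rcases h.all K e with r | r
    · exact absurd r.symm f
    · exact r
  · exact absurd e (hno K)

theorem Tri.b_unique {m : ℕ} {Y : Finset (ℝ × ℝ)} {a b c a' b' c' : LSeq} (h : Tri m Y a b c) (h' : Tri m Y a' b' c')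
    (h0 : b 0 = b' 0) : ∀ j < m, b j = b' j := by
  intro j
  induction j using Nat.strong_induction_on with
  | _ j ih =>
    intro hj
    rcases j with _ | j
    · exact h0
    · have e : cut Y a b c 0 j 0 = cut Y a' b' c' 0 j 0 := by
        ext P
        simp only [mem_cut]
        constructor
        · rintro ⟨h1, -, h2, -⟩
          exact ⟨h1, by simp, fun i hi => by rw [← ih i (by omega) (by omega)]; exact h2 i hi, by simp⟩
        · rintro ⟨h1, -, h2, -⟩
          exact ⟨h1, by simp, fun i hi => by rw [ih i (by omega) (by omega)]; exact h2 i hi, by simp⟩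
      have n1 := h.nb j (m - j - 2) (by omega)
      have n2 := h'.nb j (m - j - 2) (by omega)
      obtain ⟨g1, g2, g3, -⟩ := h.tt 0 j 0 (m - j - 1) (by omega)
      rw [← e, ← ih j (by omega) (by omega)] at n2
      rw [show m - j - 1 + 1 = m - j - 2 + 2 by omega] at g1 g3
      exact nx_unique (by omega) g1 g3 n1 n2

theorem j2_lemma {m : ℕ} {X : Finset (ℝ × ℝ)} {L A B D : Set (ℝ × ℝ)} (h : Four (m + 5) X L A B D)
    (hL : ∀ K, ¬ Nx (m + 5) X L K) (hA : ∀ K, ¬ Nx (m + 5) X A K) : False := by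
  obtain ⟨a, b, c, a0, b0, c0, T⟩ := tri_of_ex3 (n := m + 3) (h.ex3 hL)
  obtain ⟨a', b', c', a0', b0', c0', T'⟩ := tri_of_ex3 (n := m + 3) (h.swapLA.ex3 hA)
  have S := T.rot.shift (n := m + 3) (by omega)
  have S' := T'.rot.shift (n := m + 3) (by omega)
  rw [a0] at S
  rw [a0', rm_comm] at S'
  have eb := S.rot.rot.b_unique S'.rot.rot (b0.trans b0'.symm) 2 (by omega)
  have ec := S.b_unique S' (c0.trans c0'.symm) (m + 2) (by omega)
  obtain ⟨P, hP⟩ := T.exists_node (x := 0) (y := 2) (z := m + 2) (by omega)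
  obtain ⟨Q, hQ⟩ := T'.exists_node (x := 0) (y := 2) (z := m + 2) (by omega)
  have q1 := T'.mem_b (by omega) (by omega) hQ
  have q2 := T'.mem_c (by omega) (by omega) hQ
  rw [← eb] at q1
  rw [← ec] at q2
  have hQP : Q = P := T.rot.inter_ab (x := 2) (y := m + 2) (z := 0) (by omega) (by omega) (by omega) (by rwa [← cut_rot]) q1 q2
  have p1 := T.mem_a (by omega) (by omega) hP
  rw [a0, ← hQP] at p1
  exact (mem_rm.1 (mem_cut.1 hQ).1).2 p1

theorem peel_g {n : ℕ} {X : Finset (ℝ × ℝ)} (hX : G (n + 2) X) {L N : Set (ℝ × ℝ)} (hL : Mx (n + 2) X L) (hN : Nx (n + 2) X L N) :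
    G n (rm (rm X L) N) := (hX.rm hL).rm hN.mx

theorem peel_mx {n : ℕ} {X : Finset (ℝ × ℝ)} (hX : G (n + 2) X) {L N M : Set (ℝ × ℝ)} (hL : Mx (n + 2) X L) (hN : Nx (n + 2) X L N)
    (hM : Mx (n + 2) X M) (hLM : L ≠ M) : Mx n (rm (rm X L) N) M := by
  refine mx_rm (hX.rm hL).1 hN.mx (mx_rm hX.1 hL hM hLM) ?_
  rintro rfl
  exact hN.not_mx hM

theorem peel_nx {n : ℕ} {X : Finset (ℝ × ℝ)} (hX : G (n + 3) X) {L N M K : Set (ℝ × ℝ)} (hL : Mx (n + 3) X L) (hN : Nx (n + 3) X L N)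
    (hM : Mx (n + 3) X M) (hLM : L ≠ M) (hK : Nx (n + 3) X M K) : Nx (n + 1) (rm (rm X L) N) M K := by
  refine Nx.persist (hX.rm hL).1 (mx_rm hX.1 hL hM hLM) (hK.persist hX.1 hM hL hLM.symm) hN.mx ?_
  rintro rfl
  exact hN.not_mx hM

theorem gz_card {X : Finset (ℝ × ℝ)} (h : G 0 X) : X.card = 1 := h.1.1.1

theorem mx_one_cases {Y : Finset (ℝ × ℝ)} (h : G 1 Y) {A B D T : Set (ℝ × ℝ)} (hA : Mx 1 Y A) (hB : Mx 1 Y B) (hD : Mx 1 Y D)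
    (hT : Mx 1 Y T) (hAB : A ≠ B) (hAD : A ≠ D) (hBD : B ≠ D) : T = A ∨ T = B ∨ T = D := by
  by_contra hc
  push Not at hc
  have h3 := mm_le (n := 0) h
  have f := finite_mx 0 Y
  have hs : ({T, A, B, D} : Set (Set (ℝ × ℝ))) ⊆ {L | Mx (0 + 1) Y L} := by
    rintro K (rfl | rfl | rfl | rfl) <;> assumption
  have := Set.ncard_le_ncard hs f
  rw [Set.ncard_insert_of_notMem (by simp [hc]), Set.ncard_insert_of_notMem (by simp [hAB, hAD]), Set.ncard_pair hBD] at this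
  unfold mm at h3
  omega

theorem ii_aux {X : Finset (ℝ × ℝ)} {L : Set (ℝ × ℝ)} {a b c : LSeq} (h : Four 6 X L (a 0) (b 0) (c 0)) (T : Tri 5 (rm X L) a b c)
    (na : Nx 6 X (a 0) (a 1)) (nb : Nx 6 X (b 0) (b 1)) (nc : Nx 6 X (c 0) (c 1)) :
    ∃ M ∈ L, (∀ Q ∈ X, Q ∉ a 0 → Q ∉ a 1 → Q ∉ b 0 → Q ∉ b 1 → Q ∉ c 0 → Q ∉ c 1 → Q = M) ∧ (M ∈ X ∧ M ∉ a 0 ∧ M ∉ a 1 ∧ M ∉ b 0 ∧ M ∉ b 1 ∧ M ∉ c 0 ∧ M ∉ c 1) ∧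
    (M ∈ b 2 ∨ M ∈ c 2) := by
  have g4 : G 4 _ := peel_g h.g h.mB nb
  have L4 : Mx 4 _ _ := peel_mx h.g h.mB nb h.mL h.LB.symm
  have A4 : Mx 4 _ _ := peel_mx h.g h.mB nb h.mA h.AB.symm
  have D4 : Mx 4 _ _ := peel_mx h.g h.mB nb h.mD h.BD
  have nA4 : Nx 4 _ _ _ := peel_nx (n := 3) h.g h.mB nb h.mA h.AB.symm na
  have nD4 : Nx 4 _ _ _ := peel_nx (n := 3) h.g h.mB nb h.mD h.BD nc
  have g2 : G 2 _ := peel_g g4 D4 nD4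
  have L2 : Mx 2 _ _ := peel_mx g4 D4 nD4 L4 h.LD.symm
  have A2 : Mx 2 _ _ := peel_mx g4 D4 nD4 A4 h.AD.symm
  have nA2 : Nx 2 _ _ _ := peel_nx (n := 1) g4 D4 nD4 A4 h.AD.symm nA4
  set V := rm (rm (rm (rm X (b 0)) (b 1)) (c 0)) (c 1) with hV
  obtain ⟨K, K1, K2, K3⟩ := (G.three (n := 1) g2).other L (a 0)
  have g0 : G 0 _ := peel_g g2 A2 nA2
  have L0 : Mx 0 _ _ := peel_mx g2 A2 nA2 L2 h.LA.symm
  have K0 : Mx 0 _ _ := peel_mx g2 A2 nA2 K1 K3.symm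
  obtain ⟨M, hM⟩ := Finset.card_pos.1 (by rw [gz_card g0]; omega)
  have ML := mem_of_mx_zero (gz_card g0) L0 hM
  have MK := mem_of_mx_zero (gz_card g0) K0 hM
  refine ⟨M, ML, ?_, ?_, ?_⟩
  · intro Q h1 h2 h3 h4 h5 h6 h7
    refine Finset.card_le_one.1 (gz_card g0).le _ ?_ _ hM
    simp only [hV, mem_rm]; tauto
  · simp only [hV, mem_rm] at hM; tauto
  · have e : rm V L = cut (rm X L) a b c 0 2 2 := by
      ext P
      simp only [hV, mem_rm, mem_cut]
      constructor
      · rintro ⟨⟨⟨⟨⟨h1, h2⟩, h3⟩, h4⟩, h5⟩, h6⟩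
        refine ⟨⟨h1, h6⟩, by simp, ?_, ?_⟩ <;> intro i hi <;> interval_cases i <;> assumption
      · rintro ⟨⟨h1, h6⟩, -, h2, h3⟩
        exact ⟨⟨⟨⟨⟨h1, h2 0 (by omega)⟩, h2 1 (by omega)⟩, h3 0 (by omega)⟩, h3 1 (by omega)⟩, h6⟩
    have K1' : Mx 1 _ _ := mx_rm g2.1 L2 K1 K2.symm
    rw [e] at K1'
    obtain ⟨t1, t2, t3, t4, t5, t6, t7⟩ := T.tt 0 2 2 0 (by omega)
    rcases mx_one_cases t1 t2 t3 t4 K1' t5 t6 t7 with r | r | r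
    · exact absurd r K3
    · left; rw [← r]; exact MK
    · right; rw [← r]; exact MK

theorem ii_lemma {X : Finset (ℝ × ℝ)} {L A B D : Set (ℝ × ℝ)} (h : Four 6 X L A B D)
    (hL : ∀ K, ¬ Nx 6 X L K) (hA : ∃ K, Nx 6 X A K) (hB : ∃ K, Nx 6 X B K) (hD : ∃ K, Nx 6 X D K) : False := by
  obtain ⟨NA, hA⟩ := hA
  obtain ⟨NB, hB⟩ := hB
  obtain ⟨ND, hD⟩ := hD
  obtain ⟨a, b, c, rfl, rfl, rfl, T⟩ := tri_of_ex3 (n := 4) (h.ex3 (n := 5) hL)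
  have e := h.ex3 (n := 5) hL
  have na : NA = a 1 := nx_unique (by omega) e.1 e.2.1 (hA.persist h.g.1 h.mA h.mL h.LA.symm) (by have := T.na 0 3 (by omega); rwa [cut_zero] at this)
  have nb : NB = b 1 := nx_unique (by omega) e.1 e.2.2.1 (hB.persist h.g.1 h.mB h.mL h.LB.symm) (by have := T.nb 0 3 (by omega); rwa [cut_zero] at this)
  have nd : ND = c 1 := nx_unique (by omega) e.1 e.2.2.2.1 (hD.persist h.g.1 h.mD h.mL h.LD.symm) (by have := T.nc 0 3 (by omega); rwa [cut_zero] at this)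
  subst na nb nd
  obtain ⟨M, ML, -, ⟨m1, m2, m3, m4, m5, m6, m7⟩, i1⟩ := ii_aux h T hA hB hD
  obtain ⟨M', -, u', -, i2⟩ := ii_aux h.rot3 T.rot hB hD hA
  obtain ⟨M'', -, u'', -, i3⟩ := ii_aux h.rot3.rot3 T.rot.rot hD hA hB
  rw [← u' M m1 m4 m5 m6 m7 m2 m3] at i2
  rw [← u'' M m1 m6 m7 m2 m3 m4 m5] at i3
  have key : ∀ {a b c : LSeq}, Tri 5 (rm X L) a b c → M ∈ a 2 → M ∈ b 2 → False := by
    intro a b c T h1 h2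
    obtain ⟨P, hP⟩ := T.exists_node (x := 2) (y := 2) (z := 1) (by omega)
    have := T.inter_ab (by omega) (by omega) (by omega) hP h1 h2
    rw [← this] at hP
    exact (mem_rm.1 (mem_cut.1 hP).1).2 ML
  have k1 := key T
  have k2 := key T.rot
  have k3 := key T.rot.rot
  tauto

/-- three by three determinant -/
def d3 (a b c d e f g h i : ℝ) : ℝ := a * (e * i - f * h) - b * (d * i - f * g) + c * (d * h - e * g)

theorem n6_det (a b c x y : Fin 4 → ℝ) (g : Fin 4 → Fin 4 → ℝ) (hg : ∀ i j, g i j = a i * x j + b i * y j + c i) :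
   g 0 0 * d3 (g 1 1) (g 1 2) (g 1 3) (g 2 1) (g 2 2) (g 2 3) (g 3 1) (g 3 2) (g 3 3)
   - g 0 1 * d3 (g 1 0) (g 1 2) (g 1 3) (g 2 0) (g 2 2) (g 2 3) (g 3 0) (g 3 2) (g 3 3)
   + g 0 2 * d3 (g 1 0) (g 1 1) (g 1 3) (g 2 0) (g 2 1) (g 2 3) (g 3 0) (g 3 1) (g 3 3)
   - g 0 3 * d3 (g 1 0) (g 1 1) (g 1 2) (g 2 0) (g 2 1) (g 2 2) (g 3 0) (g 3 1) (g 3 2) = 0 := by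
  simp only [hg, d3]
  ring

theorem n6_fac (u v w p q r : ℝ) (hu : u ≠ 0) (hv : v ≠ 0) (hw : w ≠ 0) (hp : p ≠ 0) (hq : q ≠ 0) (hr : r ≠ 0)
  (h : 1 * d3 1 p q p⁻¹ 1 r q⁻¹ r⁻¹ 1 - u * d3 u⁻¹ p q v⁻¹ 1 r w⁻¹ r⁻¹ 1 + v * d3 u⁻¹ 1 q v⁻¹ p⁻¹ r w⁻¹ q⁻¹ 1
    - w * d3 u⁻¹ 1 p v⁻¹ p⁻¹ 1 w⁻¹ q⁻¹ r⁻¹ = 0) : (u * p - v) * (u * q - w) * (v * r - w) * (q - p * r) = 0 := by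
  have e : 1 * d3 1 p q p⁻¹ 1 r q⁻¹ r⁻¹ 1 - u * d3 u⁻¹ p q v⁻¹ 1 r w⁻¹ r⁻¹ 1 + v * d3 u⁻¹ 1 q v⁻¹ p⁻¹ r w⁻¹ q⁻¹ 1
    - w * d3 u⁻¹ 1 p v⁻¹ p⁻¹ 1 w⁻¹ q⁻¹ r⁻¹ = (u * p - v) * (u * q - w) * (v * r - w) * (q - p * r) / (u * v * w * p * q * r) := by
    unfold d3
    field_simp
    ring
  rw [e, div_eq_zero_iff] at h
  refine h.resolve_right (by positivity)

theorem line_param {K : Set (ℝ × ℝ)} (hK : IsLine K) {P Q R : ℝ × ℝ} (hP : P ∈ K) (hQ : Q ∈ K) (hR : R ∈ K) (hPQ : P ≠ Q) :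
    ∃ s : ℝ, R.1 = P.1 + s * (Q.1 - P.1) ∧ R.2 = P.2 + s * (Q.2 - P.2) := by
  obtain ⟨l, hl, rfl⟩ := hK
  obtain ⟨a, b, c, rfl, hab⟩ := lin_form hl
  rw [mem_zeroSet, evalPt_lin] at hP hQ hR
  have hd : (Q.1 - P.1) * (R.2 - P.2) = (Q.2 - P.2) * (R.1 - P.1) := by
    rcases hab with h | h
    · apply mul_left_cancel₀ h
      linear_combination (R.2 - P.2) * (hQ - hP) - (Q.2 - P.2) * (hR - hP)
    · apply mul_left_cancel₀ h
      linear_combination (Q.1 - P.1) * (hR - hP) - (R.1 - P.1) * (hQ - hP)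
  by_cases hx : Q.1 - P.1 = 0
  · have hy : Q.2 - P.2 ≠ 0 := by
      intro hy
      exact hPQ (Prod.ext (by linarith) (by linarith))
    refine ⟨(R.2 - P.2) / (Q.2 - P.2), ?_, ?_⟩
    · rw [hx] at hd ⊢
      have : R.1 - P.1 = 0 := by
        rw [zero_mul] at hd
        exact (mul_eq_zero.1 hd.symm).resolve_left hy
      linarith
    · field_simp; ring
  · refine ⟨(R.1 - P.1) / (Q.1 - P.1), ?_, ?_⟩
    · field_simp; ring
    · field_simp; linarith

theorem mem_line_of_det {K : Set (ℝ × ℝ)} (hK : IsLine K) {P Q R : ℝ × ℝ} (hP : P ∈ K) (hQ : Q ∈ K) (hPQ : P ≠ Q)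
    (hd : (Q.1 - P.1) * (R.2 - P.2) = (Q.2 - P.2) * (R.1 - P.1)) : R ∈ K := by
  obtain ⟨l, hl, rfl⟩ := hK
  obtain ⟨a, b, c, rfl, hab⟩ := lin_form hl
  rw [mem_zeroSet, evalPt_lin] at hP hQ ⊢
  by_cases hx : Q.1 - P.1 = 0
  · have hy : Q.2 - P.2 ≠ 0 := by
      intro hy
      exact hPQ (Prod.ext (by linarith) (by linarith))
    apply mul_left_cancel₀ hy
    linear_combination (Q.2 - P.2) * hP + (R.2 - P.2) * (hQ - hP) - a * hd
  · apply mul_left_cancel₀ hx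
    linear_combination (Q.1 - P.1) * hP + (R.1 - P.1) * (hQ - hP) + b * hd

theorem n6_a {X : Finset (ℝ × ℝ)} (hX : G 6 X) {A B C D NB NC ND : Set (ℝ × ℝ)} (mA : Mx 6 X A) (mB : Mx 6 X B)
    (mC : Mx 6 X C) (mD : Mx 6 X D) (nB : Nx 6 X B NB) (nC : Nx 6 X C NC) (nD : Nx 6 X D ND)
    (AB : A ≠ B) (AC : A ≠ C) (AD : A ≠ D) (BC : B ≠ C) (BD : B ≠ D) (CD : C ≠ D) :
    ∃ M ∈ X, M ∈ A ∧ M ∉ B ∧ M ∉ NB ∧ M ∉ C ∧ M ∉ NC ∧ M ∉ D ∧ M ∉ ND := by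
  have g4 : G 4 _ := peel_g hX mB nB
  have A4 : Mx 4 _ _ := peel_mx hX mB nB mA AB.symm
  have C4 : Mx 4 _ _ := peel_mx hX mB nB mC BC
  have D4 : Mx 4 _ _ := peel_mx hX mB nB mD BD
  have nC4 : Nx 4 _ _ _ := peel_nx (n := 3) hX mB nB mC BC nC
  have nD4 : Nx 4 _ _ _ := peel_nx (n := 3) hX mB nB mD BD nD
  have g2 : G 2 _ := peel_g g4 C4 nC4
  have A2 : Mx 2 _ _ := peel_mx g4 C4 nC4 A4 AC.symm
  have D2 : Mx 2 _ _ := peel_mx g4 C4 nC4 D4 CD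
  have nD2 : Nx 2 _ _ _ := peel_nx (n := 1) g4 C4 nC4 D4 CD nD4
  have g0 : G 0 _ := peel_g g2 D2 nD2
  have A0 : Mx 0 _ _ := peel_mx g2 D2 nD2 A2 AD.symm
  obtain ⟨M, hM⟩ := Finset.card_pos.1 (by rw [gz_card g0]; omega)
  have MA := mem_of_mx_zero (gz_card g0) A0 hM
  simp only [mem_rm] at hM
  exact ⟨M, by tauto⟩

theorem n6_b {X : Finset (ℝ × ℝ)} (hX : G 6 X) {A B C D NA NB NC ND : Set (ℝ × ℝ)} (mA : Mx 6 X A) (mB : Mx 6 X B)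
    (mC : Mx 6 X C) (mD : Mx 6 X D) (nA : Nx 6 X A NA) (nB : Nx 6 X B NB) (nC : Nx 6 X C NC) (nD : Nx 6 X D ND)
    (AB : A ≠ B) (AC : A ≠ C) (AD : A ≠ D) (BC : B ≠ C) (BD : B ≠ D) (CD : C ≠ D) {M N : ℝ × ℝ} (hM : M ∈ X)
    (hN : N ∈ X) (m : M ∉ B ∧ M ∉ NB ∧ M ∉ C ∧ M ∉ NC ∧ M ∉ D ∧ M ∉ ND) (n : N ∉ A ∧ N ∉ NA ∧ N ∉ C ∧ N ∉ NC ∧ N ∉ D ∧ N ∉ ND) :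
    ∃ K O, IsLine K ∧ M ∈ K ∧ N ∈ K ∧ O ∈ K ∧ O ∈ NA ∧ O ∈ NB ∧ O ∉ NC ∧ O ∉ ND := by
  have g4 : G 4 _ := peel_g hX mC nC
  have A4 : Mx 4 _ _ := peel_mx hX mC nC mA AC.symm
  have B4 : Mx 4 _ _ := peel_mx hX mC nC mB BC.symm
  have D4 : Mx 4 _ _ := peel_mx hX mC nC mD CD
  have nA4 : Nx 4 _ _ _ := peel_nx (n := 3) hX mC nC mA AC.symm nA
  have nB4 : Nx 4 _ _ _ := peel_nx (n := 3) hX mC nC mB BC.symm nB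
  have nD4 : Nx 4 _ _ _ := peel_nx (n := 3) hX mC nC mD CD nD
  have g2 : G 2 _ := peel_g g4 D4 nD4
  have A2 : Mx 2 _ _ := peel_mx g4 D4 nD4 A4 AD.symm
  have B2 : Mx 2 _ _ := peel_mx g4 D4 nD4 B4 BD.symm
  have nA2 : Nx 2 _ _ _ := peel_nx (n := 1) g4 D4 nD4 A4 AD.symm nA4
  have nB2 : Nx 2 _ _ _ := peel_nx (n := 1) g4 D4 nD4 B4 BD.symm nB4
  obtain ⟨K, K2, KA, KB⟩ := (G.three (n := 1) g2).other A B
  have gA : G 0 _ := peel_g g2 A2 nA2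
  have kA : Mx 0 _ _ := peel_mx g2 A2 nA2 K2 KA.symm
  have gB : G 0 _ := peel_g g2 B2 nB2
  have kB : Mx 0 _ _ := peel_mx g2 B2 nB2 K2 KB.symm
  have g1 : G 1 _ := g2.rm A2
  have B1 : Mx 1 _ _ := mx_rm g2.1 A2 B2 AB
  have K1 : Mx 1 _ _ := mx_rm g2.1 A2 K2 KA.symm
  have g0 : G 0 _ := g1.rm B1
  have K0 : Mx 0 _ _ := mx_rm g1.1 B1 K1 KB.symm
  have NA0 : Mx 0 _ _ := mx_rm g1.1 B1 nA2.mx (fun e => nA2.not_mx (e ▸ B2))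
  have NB0 : Mx 0 _ _ := mx_rm (g2.rm B2).1 (mx_rm g2.1 B2 A2 AB.symm) nB2.mx (fun e => nB2.not_mx (e ▸ A2))
  rw [rm_comm] at NB0
  obtain ⟨O, hO⟩ := Finset.card_pos.1 (by rw [gz_card g0]; omega)
  refine ⟨K, O, K2.1, ?_, ?_, mem_of_mx_zero (gz_card g0) K0 hO, mem_of_mx_zero (gz_card g0) NA0 hO,
    mem_of_mx_zero (gz_card g0) NB0 hO, ?_⟩
  · refine mem_of_mx_zero (gz_card gB) kB ?_
    simp only [mem_rm]; tauto
  · refine mem_of_mx_zero (gz_card gA) kA ?_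
    simp only [mem_rm]; tauto
  · simp only [mem_rm] at hO; tauto

theorem n6_core {lam nu : Fin 4 → Set (ℝ × ℝ)} {M : Fin 4 → ℝ × ℝ} (hnu : ∀ i, IsLine (nu i)) (h1 : ∀ i, M i ∈ lam i)
    (h2 : ∀ i j, j ≠ i → M i ∉ lam j) (h3 : ∀ i, M i ∉ nu i)
    (h4 : ∀ i j, i ≠ j → ∃ K O, IsLine K ∧ M i ∈ K ∧ M j ∈ K ∧ O ∈ K ∧ O ∈ nu i ∧ O ∈ nu j ∧ ∀ k, k ≠ i → k ≠ j → O ∉ nu k) : False := by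
  have hM : ∀ i j, i ≠ j → M i ≠ M j := by
    intro i j hij he
    apply h2 j i hij
    rw [← he]; exact h1 i
  have hp : ∀ i, ∃ a b c : ℝ, (a ≠ 0 ∨ b ≠ 0) ∧ (∀ P, P ∈ nu i ↔ a * P.1 + b * P.2 + c = 0) ∧ a * (M i).1 + b * (M i).2 + c = 1 := by
    intro i
    obtain ⟨l, hl, he⟩ := hnu i
    obtain ⟨a, b, c, rfl, hab⟩ := lin_form hl
    have h := h3 i
    rw [he, mem_zeroSet, evalPt_lin] at h
    generalize hw : a * (M i).1 + b * (M i).2 + c = w at h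
    have h' : w ≠ 0 := h
    refine ⟨a / w, b / w, c / w, ?_, ?_, ?_⟩
    · rcases hab with h | h
      · left; positivity
      · right; positivity
    · intro P
      rw [he, mem_zeroSet, evalPt_lin]
      have : a / w * P.1 + b / w * P.2 + c / w = (a * P.1 + b * P.2 + c) / w := by ring
      rw [this, div_eq_zero_iff]
      tauto
    · have : a / w * (M i).1 + b / w * (M i).2 + c / w = (a * (M i).1 + b * (M i).2 + c) / w := by ring
      rw [this, hw, div_self h']
  choose a b c hab hmem hone using hp
  obtain ⟨g, hg⟩ : ∃ g : Fin 4 → Fin 4 → ℝ, ∀ i j, g i j = a i * (M j).1 + b i * (M j).2 + c i := ⟨_, fun _ _ => rfl⟩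
  have g1 : ∀ i, g i i = 1 := fun i => by rw [hg, hone]
  have g2 : ∀ i j, i ≠ j → g i j * g j i = 1 := by
    intro i j hij
    obtain ⟨K, O, k1, k2, k3, k4, k5, k6, -⟩ := h4 i j hij
    obtain ⟨s, s1, s2⟩ := line_param k1 k2 k3 k4 (hM i j hij)
    rw [hmem, s1, s2] at k5 k6
    have e1 : (1 - s) + s * g i j = 0 := by
      rw [hg]; linear_combination k5 - (1 - s) * hone i
    have e2 : (1 - s) * g j i + s = 0 := by
      rw [hg]; linear_combination k6 - s * hone j
    have hs : s ≠ 0 := by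
      rintro rfl
      linarith
    apply mul_left_cancel₀ hs
    linear_combination g j i * e1 - e2
  have tri : ∀ i j k, i ≠ j → i ≠ k → j ≠ k → g i j * g j k * g k i ≠ 1 := by
    intro i j k hij hik hjk hc
    have c2 : g i k * g k j * g j i = 1 := by
      have x1 := g2 i j hij
      have x2 := g2 j k hjk
      have x3 := g2 k i hik.symm
      calc g i k * g k j * g j i = (g i k * g k j * g j i) * (g i j * g j k * g k i) := by rw [hc, mul_one]
        _ = (g i j * g j i) * (g j k * g k j) * (g k i * g i k) := by ring
        _ = 1 := by rw [x1, x2, x3]; ring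
    have dz : d3 (g i i) (g i j) (g i k) (g j i) (g j j) (g j k) (g k i) (g k j) (g k k) = 0 := by
      unfold d3
      rw [g1, g1, g1]
      linear_combination hc + c2 - g2 i j hij - g2 j k hjk - g2 k i hik.symm
    have fac : d3 (g i i) (g i j) (g i k) (g j i) (g j j) (g j k) (g k i) (g k j) (g k k)
        = d3 (a i) (b i) (c i) (a j) (b j) (c j) (a k) (b k) (c k)
          * (((M j).1 - (M i).1) * ((M k).2 - (M i).2) - ((M j).2 - (M i).2) * ((M k).1 - (M i).1)) := by
      simp only [hg, d3]; ring
    rw [fac] at dz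
    obtain ⟨K, O, k1, k2, k3, k4, k5, k6, k7⟩ := h4 i j hij
    obtain ⟨K', O', k1', k2', k3', k4', k5', k6', k7'⟩ := h4 i k hik
    have oj := k7' j hij.symm hjk
    have ok := k7 k hik.symm hjk.symm
    rcases mul_eq_zero.1 dz with h | h
    · rw [hmem] at k5 k6 k5' oj ok
      have f1 : (a i * b j - a j * b i) * (a k * O.1 + b k * O.2 + c k) = 0 := by
        unfold d3 at h
        linear_combination h - (a j * b k - a k * b j) * k5 + (a i * b k - a k * b i) * k6
      have f2 := (mul_eq_zero.1 f1).resolve_right ok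
      have f3 : a i * (a j * O'.1 + b j * O'.2 + c j) = 0 := by
        linear_combination a i * k6 + a j * k5' - a j * k5 + (O'.2 - O.2) * f2
      have f4 : b i * (a j * O'.1 + b j * O'.2 + c j) = 0 := by
        linear_combination b i * k6 + b j * k5' - b j * k5 - (O'.1 - O.1) * f2
      rcases hab i with r | r
      · exact oj ((mul_eq_zero.1 f3).resolve_left r)
      · exact oj ((mul_eq_zero.1 f4).resolve_left r)
    · have mk : M k ∈ K := mem_line_of_det k1 k2 k3 (hM i j hij) (by linarith)
      have eK : K = K' := line_eq k1 k1' (hM i k hik) k2 mk k2' k3'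
      subst eK
      have hO : O ≠ O' := by
        rintro rfl
        exact oj k6
      have := line_eq k1 (hnu i) hO k4 k4' k5 k5'
      exact h3 i (this ▸ k2)
  have nz : ∀ i j, i ≠ j → g i j ≠ 0 := by
    intro i j hij h0
    have := g2 i j hij
    rw [h0] at this
    simp at this
  have inv : ∀ i j, i ≠ j → g j i = (g i j)⁻¹ := by
    intro i j hij
    exact eq_inv_of_mul_eq_one_left (by rw [mul_comm]; exact g2 i j hij)
  have det := n6_det a b c (fun j => (M j).1) (fun j => (M j).2) g hg
  rw [g1, g1, g1, g1, inv 0 1 (by decide), inv 0 2 (by decide), inv 0 3 (by decide), inv 1 2 (by decide), inv 1 3 (by decide),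
    inv 2 3 (by decide)] at det
  have fac := n6_fac _ _ _ _ _ _ (nz 0 1 (by decide)) (nz 0 2 (by decide)) (nz 0 3 (by decide)) (nz 1 2 (by decide))
    (nz 1 3 (by decide)) (nz 2 3 (by decide)) det
  have fin : ∀ i j k, i ≠ j → i ≠ k → j ≠ k → g i j * g j k - g i k ≠ 0 := by
    intro i j k hij hik hjk h
    apply tri i j k hij hik hjk
    rw [sub_eq_zero.1 h]; exact g2 i k hik
  rcases mul_eq_zero.1 fac with h | h
  · rcases mul_eq_zero.1 h with h | h
    · rcases mul_eq_zero.1 h with h | h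
      · exact fin 0 1 2 (by decide) (by decide) (by decide) h
      · exact fin 0 1 3 (by decide) (by decide) (by decide) h
    · exact fin 0 2 3 (by decide) (by decide) (by decide) h
  · exact fin 1 2 3 (by decide) (by decide) (by decide) (by linarith)

theorem n6_lemma {X : Finset (ℝ × ℝ)} (hX : G 6 X) (lam nu : Fin 4 → Set (ℝ × ℝ)) (hinj : Function.Injective lam)
    (hl : ∀ i, Mx 6 X (lam i)) (hn : ∀ i, Nx 6 X (lam i) (nu i)) : False := by
  have perm : ∀ i j : Fin 4, i ≠ j → ∃ k l, i ≠ k ∧ i ≠ l ∧ j ≠ k ∧ j ≠ l ∧ k ≠ l ∧ ∀ t, t = i ∨ t = j ∨ t = k ∨ t = l := by decide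
  have perm1 : ∀ i : Fin 4, ∃ j, i ≠ j := by decide
  have ne : ∀ {i j}, i ≠ j → lam i ≠ lam j := fun h e => h (hinj e)
  have hA : ∀ i, ∃ M ∈ X, M ∈ lam i ∧ ∀ j, j ≠ i → M ∉ lam j ∧ M ∉ nu j := by
    intro i
    obtain ⟨j, hij⟩ := perm1 i
    obtain ⟨k, l, q1, q2, q3, q4, q5, q6⟩ := perm i j hij
    obtain ⟨M, m1, m2, m3, m4, m5, m6, m7, m8⟩ := n6_a hX (hl i) (hl j) (hl k) (hl l) (hn j) (hn k) (hn l) (ne hij) (ne q1) (ne q2)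
      (ne q3) (ne q4) (ne q5)
    refine ⟨M, m1, m2, fun t ht => ?_⟩
    rcases q6 t with rfl | rfl | rfl | rfl
    · exact absurd rfl ht
    · exact ⟨m3, m4⟩
    · exact ⟨m5, m6⟩
    · exact ⟨m7, m8⟩
  choose M m1 m2 m3 using hA
  refine n6_core (lam := lam) (nu := nu) (M := M) (fun i => (hn i).1) m2 (fun i j h => (m3 i j h).1) (fun i => (hn i).2.2 _ (m1 i) (m2 i)) ?_
  intro i j hij
  obtain ⟨k, l, q1, q2, q3, q4, q5, q6⟩ := perm i j hij
  obtain ⟨K, O, o1, o2, o3, o4, o5, o6, o7, o8⟩ := n6_b hX (hl i) (hl j) (hl k) (hl l) (hn i) (hn j) (hn k) (hn l) (ne hij) (ne q1) (ne q2)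
      (ne q3) (ne q4) (ne q5) (m1 i) (m1 j)
      ⟨(m3 i j hij.symm).1, (m3 i j hij.symm).2, (m3 i k q1.symm).1, (m3 i k q1.symm).2, (m3 i l q2.symm).1, (m3 i l q2.symm).2⟩
      ⟨(m3 j i hij).1, (m3 j i hij).2, (m3 j k q3.symm).1, (m3 j k q3.symm).2, (m3 j l q4.symm).1, (m3 j l q4.symm).2⟩
  refine ⟨K, O, o1, o2, o3, o4, o5, o6, fun t h1 h2 => ?_⟩
  rcases q6 t with rfl | rfl | rfl | rfl
  · exact absurd rfl h1
  · exact absurd rfl h2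
  · exact o7
  · exact o8

theorem mm_four_six {X : Finset (ℝ × ℝ)} (hX : G 6 X) (h4 : mm 6 X = 4) : False := by
  classical
  by_cases hall : ∀ L, Mx 6 X L → ∃ K, Nx 6 X L K
  · obtain ⟨L, hL⟩ := hX.ex
    obtain ⟨A, hA, hAL, -⟩ := (G.three (n := 5) hX).other L L
    obtain ⟨B, D, F⟩ := four_of_pair (n := 5) hX h4 hL hA hAL.symm
    obtain ⟨n1, e1⟩ := hall _ F.mL
    obtain ⟨n2, e2⟩ := hall _ F.mA
    obtain ⟨n3, e3⟩ := hall _ F.mB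
    obtain ⟨n4, e4⟩ := hall _ F.mD
    refine n6_lemma hX ![L, A, B, D] ![n1, n2, n3, n4] ?_ ?_ ?_
    · have := F.LA
      have := F.LB
      have := F.LD
      have := F.AB
      have := F.AD
      have := F.BD
      intro i j hij
      fin_cases i <;> fin_cases j <;> simp_all
    · intro i
      fin_cases i
      · exact F.mL
      · exact F.mA
      · exact F.mB
      · exact F.mD
    · intro i
      fin_cases i
      · exact e1
      · exact e2
      · exact e3
      · exact e4
  · push Not at hall
    obtain ⟨L, hL, hLn⟩ := hall
    obtain ⟨A, hA, hAL, -⟩ := (G.three (n := 5) hX).other L L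
    obtain ⟨B, D, F⟩ := four_of_pair (n := 5) hX h4 hL hA hAL.symm
    have key : ∀ M, Mx 6 X M → L ≠ M → ∃ K, Nx 6 X M K := by
      intro M hM hLM
      by_contra hcon
      push Not at hcon
      obtain ⟨B', D', F'⟩ := four_of_pair (n := 5) hX h4 hL hM hLM
      exact j2_lemma (m := 1) F' hLn hcon
    exact ii_lemma F hLn (key _ F.mA F.LA) (key _ F.mB F.LB) (key _ F.mD F.LD)

theorem class_lemma : ∀ (n : ℕ) (X : Finset (ℝ × ℝ)), G n X → 4 ≤ mm n X → n ≤ mm n X + 1 := by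
  classical
  intro n
  induction n with
  | zero => intro X _ _; omega
  | succ n ih =>
    intro X hX h4
    by_cases hn : n + 1 ≤ 5
    · omega
    obtain ⟨k, rfl⟩ : ∃ k, n = k + 5 := ⟨n - 5, by omega⟩
    by_cases h5 : 5 ≤ mm (k + 5 + 1) X
    · by_cases hall : ∀ L, Mx (k + 5 + 1) X L → ∃ K, Nx (k + 5 + 1) X L K
      · obtain ⟨L, hL⟩ := hX.ex
        obtain ⟨K, hK⟩ := hall L hL
        have e := mm_rm_nx (n := k + 4) hX hL hK
        have := ih (rm X L) (hX.rm hL) (by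
          show 4 ≤ mm (k + 4 + 1) (rm X L)
          rw [e]; exact h4)
        change k + 5 ≤ mm (k + 4 + 1) (rm X L) + 1 at this
        rw [e] at this
        change k + 5 ≤ mm (k + 5 + 1) X + 1 at this
        by_contra hcon
        have r := r_lemma (finite_mx (k + 5) X).toFinset (k + 5 + 1) X hX (by
          rw [← Set.ncard_eq_toFinset_card _ (finite_mx (k + 5) X)]
          change mm (k + 5 + 1) X < _
          omega) (by
          intro M hM
          rw [Set.Finite.mem_toFinset] at hM
          exact ⟨hM, hall M hM⟩)
        rw [← Set.ncard_eq_toFinset_card _ (finite_mx (k + 5) X)] at r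
        change mm (k + 5 + 1) X + _ ≤ _ at r
        omega
      · push Not at hall
        obtain ⟨L, hL, hLn⟩ := hall
        have e := mm_rm_no (n := k + 4) hX hL hLn
        change mm (k + 5) (rm X L) + 1 = mm (k + 5 + 1) X at e
        have := ih (rm X L) (hX.rm hL) (by omega)
        omega
    · have h4' : mm (k + 5 + 1) X = 4 := by omega
      obtain _ | k := k
      · exact (mm_four_six hX h4').elim
      · obtain ⟨L, hL⟩ := hX.ex
        have hex : ∃ M, Mx (k + 1 + 5 + 1) X M ∧ ∃ K, Nx (k + 1 + 5 + 1) X M K := by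
          by_contra hcon
          push Not at hcon
          obtain ⟨A, hA, hAL, -⟩ := (G.three hX).other L L
          obtain ⟨B, D, F⟩ := four_of_pair hX h4' hL hA hAL.symm
          exact j2_lemma (m := k + 2) F (hcon L hL) (hcon A hA)
        obtain ⟨M, hM, K, hK⟩ := hex
        have e := mm_rm_nx (n := k + 5) hX hM hK
        change mm (k + 1 + 5) (rm X M) = mm (k + 1 + 5 + 1) X at e
        have := ih (rm X M) (hX.rm hM) (by omega)
        omega

/-- the three possible positions of a used line -/
def Cl (n : ℕ) (X : Finset (ℝ × ℝ)) (K : Set (ℝ × ℝ)) : Prop :=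
  Mx n X K ∨ (∃ M, Mx n X M ∧ ∀ P ∈ X, P ∈ M → P ∉ K) ∨
    (∃ M M' P, Mx n X M ∧ Mx n X M' ∧ M ≠ M' ∧ P ∈ X ∧ P ∈ M ∧ P ∈ M' ∧ P ∈ K)

theorem cl_three {n : ℕ} {X : Finset (ℝ × ℝ)} {K : Set (ℝ × ℝ)} {A : ℝ × ℝ} (hX : G (n + 1) X) (h3 : mm (n + 1) X = 3)
    (hU : Us (n + 1) X K A) : Cl (n + 1) X K := by
  obtain ⟨a, b, c, T⟩ := exists_tri hX h3
  obtain ⟨t1, t2, t3, t4, t5, t6, t7⟩ := T.tt 0 0 0 n (by omega)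
  rw [cut_zero] at t1 t2 t3 t4
  obtain ⟨x, y, z, e, -, ⟨i, hi, rfl⟩ | ⟨i, hi, rfl⟩ | ⟨i, hi, rfl⟩⟩ := T.us_cases hU
  · rcases Nat.eq_zero_or_pos i with rfl | h
    · exact Or.inl t2
    · exact Or.inr (Or.inl ⟨a 0, t2, fun P hP h0 => T.disj_a h (by omega) hP h0⟩)
  · rcases Nat.eq_zero_or_pos i with rfl | h
    · exact Or.inl t3
    · exact Or.inr (Or.inl ⟨b 0, t3, fun P hP h0 => T.disj_b h (by omega) hP h0⟩)
  · rcases Nat.eq_zero_or_pos i with rfl | h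
    · exact Or.inl t4
    · exact Or.inr (Or.inl ⟨c 0, t4, fun P hP h0 => T.disj_c h (by omega) hP h0⟩)

theorem us_one {X : Finset (ℝ × ℝ)} {K : Set (ℝ × ℝ)} {A : ℝ × ℝ} (hX : G 1 X) (hU : Us 1 X K A) : Mx 1 X K := by
  have h1 := mm_le (n := 0) hX
  have h2 := three_le_mm (n := 0) hX
  obtain ⟨a, b, c, T⟩ := exists_tri (n := 0) hX (by omega)
  obtain ⟨t1, t2, t3, t4, t5, t6, t7⟩ := T.tt 0 0 0 0 (by omega)
  rw [cut_zero] at t1 t2 t3 t4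
  obtain ⟨x, y, z, e, -, ⟨i, hi, rfl⟩ | ⟨i, hi, rfl⟩ | ⟨i, hi, rfl⟩⟩ := T.us_cases hU
  · obtain rfl : i = 0 := by omega
    exact t2
  · obtain rfl : i = 0 := by omega
    exact t3
  · obtain rfl : i = 0 := by omega
    exact t4

theorem star {n : ℕ} {X : Finset (ℝ × ℝ)} {K : Set (ℝ × ℝ)} {A : ℝ × ℝ} (hX : G (n + 1 + 1) X)
    (ih : ∀ Y, G (n + 1) Y → Us (n + 1) Y K A → Cl (n + 1) Y K) (hb : ¬ Cl (n + 1 + 1) X K)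
    (hU : Us (n + 1 + 1) X K A) {M : Set (ℝ × ℝ)} (hM : Mx (n + 1 + 1) X M) (hA : A ∉ M) :
    ∃ N, Nx (n + 1 + 1) X M N ∧ A ∉ N ∧ K ≠ N := by
  have b1 : ¬ Mx (n + 1 + 1) X K := fun h => hb (Or.inl h)
  have b2 : ∀ L, Mx (n + 1 + 1) X L → ¬ ∀ P ∈ X, P ∈ L → P ∉ K := fun L hL h => hb (Or.inr (Or.inl ⟨L, hL, h⟩))
  have b3 : ∀ L L' P, Mx (n + 1 + 1) X L → Mx (n + 1 + 1) X L' → L ≠ L' → P ∈ X → P ∈ L → P ∈ L' → P ∈ K → False :=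
    fun L L' P h1 h2 h3 h4 h5 h6 h7 => hb (Or.inr (Or.inr ⟨L, L', P, h1, h2, h3, h4, h5, h6, h7⟩))
  have hU' : Us (n + 1) (rm X M) K A := (us_down hM hA hU).resolve_left (fun h => b1 (h ▸ hM))
  have gY := hX.rm hM
  have bY : ¬ Mx (n + 1) (rm X M) K := by
    intro h
    rcases rm_mx_cases hM.1 h with h | h
    · exact b1 h.1
    · exact b2 M hM h.2.2
  have hKN : ∀ N, Nx (n + 1 + 1) X M N → K ≠ N := by
    rintro N hN rfl
    exact b2 M hM hN.2.2
  rcases ih _ gY hU' with h | ⟨N, hN, hd⟩ | ⟨N, N', P, hN, hN', hNN, hP, p1, p2, p3⟩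
  · exact absurd h bY
  · rcases rm_mx_cases hM.1 hN with ⟨h, hne⟩ | h
    · exfalso
      apply b2 N h
      intro P hP h1 h2
      by_cases h3 : P ∈ M
      · exact b3 M N P hM h hne hP h3 h1 h2
      · exact hd P (mem_rm.2 ⟨hP, h3⟩) h1 h2
    · exact ⟨N, h, fun hA' => us_disj hN hd hA' hU', hKN N h⟩
  · have kN : K ≠ N := by rintro rfl; exact bY hN
    have kN' : K ≠ N' := by rintro rfl; exact bY hN'
    rcases rm_mx_cases hM.1 hN with ⟨h, hne⟩ | h
    · rcases rm_mx_cases hM.1 hN' with ⟨h', hne'⟩ | h'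
      · exact (b3 N N' P h h' hNN (mem_rm.1 hP).1 p1 p2 p3).elim
      · exact ⟨N', h', fun hA' => us_adj gY.1 hN' hN hNN.symm p2 p1 p3 kN' kN hA' hU', hKN _ h'⟩
    · exact ⟨N, h, fun hA' => us_adj gY.1 hN hN' hNN p1 p2 p3 kN kN' hA' hU', hKN _ h⟩

theorem peel_count (S : Finset (Set (ℝ × ℝ))) (K : Set (ℝ × ℝ)) (A : ℝ × ℝ) : ∀ (n : ℕ) (X : Finset (ℝ × ℝ)), G n X → Us n X K A →
    (∀ L ∈ S, Mx n X L ∧ A ∉ L ∧ K ≠ L ∧ ∃ N, Nx n X L N ∧ A ∉ N ∧ K ≠ N) → 2 * S.card + 1 ≤ n := by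
  classical
  induction S using Finset.induction_on with
  | empty =>
    intro n X hX hU _
    rcases n with _ | n
    · exact (us_zero hU).elim
    · simp
  | insert L S hLS ih =>
    intro n X hX hU h
    obtain ⟨h1, h2, h3, N, h4, h5, h6⟩ := h L (Finset.mem_insert_self _ _)
    rw [Finset.card_insert_of_notMem hLS]
    rcases n with _ | n
    · exact (us_zero hU).elim
    have u1 := (us_down h1 h2 hU).resolve_left h3
    rcases n with _ | n
    · exact (us_zero u1).elim
    have u2 := (us_down h4.mx h5 u1).resolve_left h6
    rcases n with _ | n
    · exact (us_zero u2).elim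
    have := ih (n + 1) _ (peel_g hX h1 h4) u2 (by
      intro M hM
      obtain ⟨k1, k2, k3, N', k4, k5, k6⟩ := h M (Finset.mem_insert_of_mem hM)
      have hne : L ≠ M := by rintro rfl; exact hLS hM
      exact ⟨peel_mx hX h1 h4 k1 hne, k2, k3, N', peel_nx hX h1 h4 k1 hne k4, k5, k6⟩)
    omega

theorem us_b {n : ℕ} {X : Finset (ℝ × ℝ)} {a b c : LSeq} (T : Tri n X a b c) {A : ℝ × ℝ} {k : ℕ} (hk : k < n)
    (hA : A ∈ cut X a b c 0 k 0) (hA' : A ∉ b k) : Us n X (b k) A :=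
  T.rot.us_a hk (by rwa [← cut_rot]) hA'

theorem us_c {n : ℕ} {X : Finset (ℝ × ℝ)} {a b c : LSeq} (T : Tri n X a b c) {A : ℝ × ℝ} {k : ℕ} (hk : k < n)
    (hA : A ∈ cut X a b c 0 0 k) (hA' : A ∉ c k) : Us n X (c k) A :=
  T.rot.rot.us_a hk (by rwa [← cut_rot, ← cut_rot]) hA'

theorem five_r1 {X : Finset (ℝ × ℝ)} {L A B NA NB : Set (ℝ × ℝ)} (hX : G 5 X) (mL : Mx 5 X L) (mA : Mx 5 X A) (mB : Mx 5 X B)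
    (LA : L ≠ A) (LB : L ≠ B) (AB : A ≠ B) (hA : Nx 5 X A NA) (hB : Nx 5 X B NB) (hN : NA ≠ NB) {R : ℝ × ℝ}
    (r1 : R ∈ L) (r2 : R ∈ NA) : R ∉ B ∧ R ∉ NB := by
  have g4 : G 4 (rm X A) := hX.rm mA
  have L4 : Mx 4 (rm X A) L := mx_rm hX.1 mA mL LA.symm
  have B4 : Mx 4 (rm X A) B := mx_rm hX.1 mA mB AB
  have N4 : Mx 4 (rm X A) NA := hA.mx
  have n1 : L ≠ NA := by rintro rfl; exact hA.not_mx mL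
  have n2 : B ≠ NA := by rintro rfl; exact hA.not_mx mB
  have n3 : L ≠ NB := by rintro rfl; exact hB.not_mx mL
  have M4 : Nx 4 (rm X A) B NB := hB.persist (n := 3) hX.1 mB mA AB.symm
  have g3 : G 3 (rm (rm X A) B) := g4.rm B4
  refine ⟨fun h => no_three (n := 3) g4.1 L4 B4 N4 LB n1 n2 r1 h r2, fun h => ?_⟩
  exact no_three (n := 2) g3.1 (mx_rm g4.1 B4 L4 LB.symm) (mx_rm g4.1 B4 N4 n2) M4.mx n1 n3 hN r1 r2 h

theorem five_core {X : Finset (ℝ × ℝ)} {K L A B D : Set (ℝ × ℝ)} {P : ℝ × ℝ} (F : Four 5 X L A B D)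
    (hb : ¬ Cl 5 X K) (hU : Us 5 X K P) (hLn : ∀ N, ¬ Nx 5 X L N) (hon : ∀ Q, Us 5 X K Q → Q ∈ L)
    (nA : ∃ N, Nx 5 X A N) (nB : ∃ N, Nx 5 X B N ∧ P ∉ N) (nD : ∃ N, Nx 5 X D N ∧ P ∉ N) (pA : P ∈ A) : False := by
  have b1 : ¬ Mx 5 X K := fun h => hb (Or.inl h)
  have b2 : ∀ L, Mx 5 X L → ∃ P ∈ X, P ∈ L ∧ P ∈ K := by
    intro L hL
    by_contra h
    push Not at h
    exact hb (Or.inr (Or.inl ⟨L, hL, h⟩))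
  have b3 : ∀ L L' P, Mx 5 X L → Mx 5 X L' → L ≠ L' → P ∈ X → P ∈ L → P ∈ L' → P ∈ K → False :=
    fun L L' P h1 h2 h3 h4 h5 h6 h7 => hb (Or.inr (Or.inr ⟨L, L', P, h1, h2, h3, h4, h5, h6, h7⟩))
  have pL := hon P hU
  have pB : P ∉ B := fun h => no_three F.g.1 F.mL F.mA F.mB F.LA F.LB F.AB pL pA h
  have pD : P ∉ D := fun h => no_three F.g.1 F.mL F.mA F.mD F.LA F.LD F.AD pL pA h
  obtain ⟨NA, hA⟩ := nA
  obtain ⟨NB, hB, pNB⟩ := nB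
  obtain ⟨ND, hD, pND⟩ := nD
  obtain ⟨a, b, c, rfl, rfl, rfl, T⟩ := tri_of_ex3 (n := 3) (F.ex3 (n := 4) hLn)
  have e := F.ex3 (n := 4) hLn
  have na : NA = a 1 := nx_unique (by omega) e.1 e.2.1 (hA.persist F.g.1 F.mA F.mL F.LA.symm) (by have := T.na 0 2 (by omega); rwa [cut_zero] at this)
  have nb : NB = b 1 := nx_unique (by omega) e.1 e.2.2.1 (hB.persist F.g.1 F.mB F.mL F.LB.symm) (by have := T.nb 0 2 (by omega); rwa [cut_zero] at this)
  have nd : ND = c 1 := nx_unique (by omega) e.1 e.2.2.2.1 (hD.persist F.g.1 F.mD F.mL F.LD.symm) (by have := T.nc 0 2 (by omega); rwa [cut_zero] at this)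
  subst na nb nd
  have hK := hU.line
  have kne : ∀ M, Mx 5 X M → K ≠ M := by rintro M hM rfl; exact b1 hM
  have kN : ∀ M N, Mx 5 X M → Nx 5 X M N → K ≠ N := by
    rintro M N hM hN rfl
    obtain ⟨Q, q1, q2, q3⟩ := b2 M hM
    exact hN.2.2 Q q1 q2 q3
  -- the point R1
  obtain ⟨R1, r0, r1, r2⟩ := meet (F.g.rm F.mA).1 (mx_rm F.g.1 F.mA F.mL F.LA.symm) hA.mx
  obtain ⟨rX, rA⟩ := mem_rm.1 r0
  obtain ⟨rb0, rb1⟩ := five_r1 F.g F.mL F.mA F.mB F.LA F.LB F.AB hA hB (T.ne_ab (by omega) (by omega) (by omega)) r1 r2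
  obtain ⟨rc0, rc1⟩ := five_r1 F.g F.mL F.mA F.mD F.LA F.LD F.AD hA hD (T.ne_ca (by omega) (by omega) (by omega)).symm r1 r2
  -- the point R2
  obtain ⟨R2, hR2⟩ := T.exists_node (x := 0) (y := 2) (z := 2) (by omega)
  have hR2' := mem_cut.1 hR2
  have r2X := mem_rm.1 hR2'.1
  -- peeling
  have g3 : G 3 _ := peel_g F.g F.mB hB
  have D3 : Mx 3 _ _ := peel_mx F.g F.mB hB F.mD F.BD
  have nD3 : Nx 3 _ _ _ := peel_nx (n := 2) F.g F.mB hB F.mD F.BD hD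
  have g1 : G 1 _ := peel_g g3 D3 nD3
  have u4 : Us 4 _ K P := (us_down F.mB pB hU).resolve_left (kne _ F.mB)
  have u3 : Us 3 _ K P := (us_down hB.mx pNB u4).resolve_left (kN _ _ F.mB hB)
  have u2 : Us 2 _ K P := (us_down D3 pD u3).resolve_left (kne _ F.mD)
  have u1 : Us 1 _ K P := (us_down nD3.mx pND u2).resolve_left (kN _ _ F.mD hD)
  have hKm := us_one g1 u1
  have c1 := gz_card (g1.rm hKm)
  have key : ∀ Q ∈ X, Q ∉ b 0 → Q ∉ b 1 → Q ∉ c 0 → Q ∉ c 1 → Q ≠ P → Q ∈ K := by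
    intro Q q0 q1 q2 q3 q4 q5
    by_contra q6
    refine q5 (Finset.card_le_one.1 c1.le Q ?_ P ?_)
    · simp only [mem_rm]; tauto
    · have := hU.1
      have := hU.not_mem
      simp only [mem_rm]; tauto
  have R1K : R1 ∈ K := key R1 rX rb0 rb1 rc0 rc1 (by rintro rfl; exact rA pA)
  have R2K : R2 ∈ K := key R2 r2X.1 (hR2'.2.2.1 0 (by omega)) (hR2'.2.2.1 1 (by omega)) (hR2'.2.2.2 0 (by omega))
    (hR2'.2.2.2 1 (by omega)) (by rintro rfl; exact r2X.2 pL)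
  -- the points on the two other maximal lines
  obtain ⟨B3, s0, s1, s2⟩ := b2 _ F.mB
  have s3 : B3 ∉ L := fun h => b3 _ _ B3 F.mL F.mB F.LB s0 h s1 s2
  have s4 : B3 ∉ a 0 := fun h => b3 _ _ B3 F.mA F.mB F.AB s0 h s1 s2
  have s5 : B3 ∉ c 0 := fun h => b3 _ _ B3 F.mB F.mD F.BD s0 s1 h s2
  obtain ⟨x, y, z, hs, hc⟩ := T.exists_index (mem_rm.2 ⟨s0, s3⟩)
  obtain ⟨B4, s0', s1', s2'⟩ := b2 _ F.mD
  have s3' : B4 ∉ L := fun h => b3 _ _ B4 F.mL F.mD F.LD s0' h s1' s2'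
  have s4' : B4 ∉ a 0 := fun h => b3 _ _ B4 F.mA F.mD F.AD s0' h s1' s2'
  have s5' : B4 ∉ b 0 := fun h => b3 _ _ B4 F.mB F.mD F.BD s0' h s1' s2'
  obtain ⟨x', y', z', hs', hc'⟩ := T.exists_index (mem_rm.2 ⟨s0', s3'⟩)
  have noUse : ∀ Q, Us 4 (rm X L) K Q → False := by
    intro Q hQ
    exact (mem_rm.1 hQ.1).2 (hon Q (us_up F.mL.1 hQ))
  have hy : y = 0 := by
    by_contra h
    exact (mem_cut.1 hc).2.2.1 0 (by omega) s1
  have hz' : z' = 0 := by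
    by_contra h
    exact (mem_cut.1 hc').2.2.2 0 (by omega) s1'
  subst hy hz'
  have hx0 : x ≠ 0 := by rintro rfl; exact s4 (T.mem_a (by omega) (by omega) hc)
  have hz0 : z ≠ 0 := by rintro rfl; exact s5 (T.mem_c (by omega) (by omega) hc)
  have hx0' : x' ≠ 0 := by rintro rfl; exact s4' (T.mem_a (by omega) (by omega) hc')
  have hy0' : y' ≠ 0 := by rintro rfl; exact s5' (T.mem_b (by omega) (by omega) hc')
  have hx1 : x ≠ 1 := by
    rintro rfl
    have h1 := T.mem_a (by omega) (by omega) hc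
    exact kN _ _ F.mA hA (line_eq hK hA.1 (show R1 ≠ B3 by rintro rfl; exact s3 r1) R1K s2 r2 h1)
  have hx1' : x' ≠ 1 := by
    rintro rfl
    have h1 := T.mem_a (by omega) (by omega) hc'
    exact kN _ _ F.mA hA (line_eq hK hA.1 (show R1 ≠ B4 by rintro rfl; exact s3' r1) R1K s2' r2 h1)
  have hx2 : x ≠ 2 := by
    rintro rfl
    obtain rfl : z = 2 := by omega
    have h1 := T.mem_c (by omega) (by omega) hc
    have h2 := T.mem_c (by omega) (by omega) hR2
    have hKc : K = c 2 := line_eq hK (T.lc (by omega)) (show R2 ≠ B3 by rintro rfl; exact hR2'.2.2.1 0 (by omega) s1) R2K s2 h2 h1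
    obtain ⟨Q, hQ⟩ := T.exists_node (x := 1) (y := 0) (z := 3) (by omega)
    apply noUse Q
    rw [hKc]
    exact us_c T (by omega) (cut_mono (by omega) (by omega) (by omega) hQ) ((mem_cut.1 hQ).2.2.2 2 (by omega))
  have hx2' : x' ≠ 2 := by
    rintro rfl
    obtain rfl : y' = 2 := by omega
    have h1 := T.mem_b (by omega) (by omega) hc'
    have h2 := T.mem_b (by omega) (by omega) hR2
    have hKc : K = b 2 := line_eq hK (T.lb (by omega)) (show R2 ≠ B4 by rintro rfl; exact hR2'.2.2.2 0 (by omega) s1') R2K s2' h2 h1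
    obtain ⟨Q, hQ⟩ := T.exists_node (x := 1) (y := 3) (z := 0) (by omega)
    apply noUse Q
    rw [hKc]
    exact us_b T (by omega) (cut_mono (by omega) (by omega) (by omega) hQ) ((mem_cut.1 hQ).2.2.1 2 (by omega))
  obtain rfl : x = 3 := by omega
  obtain rfl : x' = 3 := by omega
  have h1 := T.mem_a (by omega) (by omega) hc
  have h2 := T.mem_a (by omega) (by omega) hc'
  have hKc : K = a 3 := line_eq hK (T.la (by omega)) (show B3 ≠ B4 by rintro rfl; exact s5 s1') s2 s2' h1 h2
  obtain ⟨Q, hQ⟩ := T.exists_node (x := 4) (y := 0) (z := 0) (by omega)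
  apply noUse Q
  rw [hKc]
  exact T.us_a (by omega) (cut_mono (by omega) (by omega) (by omega) hQ) ((mem_cut.1 hQ).2.1 3 (by omega))

theorem five_lemma {X : Finset (ℝ × ℝ)} {K : Set (ℝ × ℝ)} {P : ℝ × ℝ} (hX : G 5 X) (h4 : mm 5 X = 4)
    (hb : ¬ Cl 5 X K) (hU : Us 5 X K P)
    (st : ∀ Q, Us 5 X K Q → ∀ M, Mx 5 X M → Q ∉ M → ∃ N, Nx 5 X M N ∧ Q ∉ N ∧ K ≠ N) : False := by
  classical
  have kne : ∀ M, Mx 5 X M → K ≠ M := by rintro M hM rfl; exact hb (Or.inl hM)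
  have hno : ∃ L, Mx 5 X L ∧ ∀ N, ¬ Nx 5 X L N := by
    by_contra hcon
    push Not at hcon
    have r := r_lemma (finite_mx 4 X).toFinset 5 X hX (by
      rw [← Set.ncard_eq_toFinset_card _ (finite_mx 4 X)]
      change mm 5 X < _
      omega) (by
      intro M hM
      rw [Set.Finite.mem_toFinset] at hM
      exact ⟨hM, hcon M hM⟩)
    rw [← Set.ncard_eq_toFinset_card _ (finite_mx 4 X)] at r
    change mm 5 X + _ ≤ _ at r
    omega
  obtain ⟨L, hL, hLn⟩ := hno
  have hH : ∀ M, Mx 5 X M → L ≠ M → ∃ N, Nx 5 X M N := by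
    intro M hM hLM
    by_contra hcon
    push Not at hcon
    obtain ⟨B', D', F'⟩ := four_of_pair (n := 4) hX h4 hL hM hLM
    exact j2_lemma (m := 0) F' hLn hcon
  have hon : ∀ Q, Us 5 X K Q → Q ∈ L := by
    intro Q hQ
    by_contra h
    obtain ⟨N, hN, -⟩ := st Q hQ L hL h
    exact hLn N hN
  obtain ⟨A, hA, hAL, -⟩ := (G.three (n := 4) hX).other L L
  obtain ⟨B, D, F⟩ := four_of_pair (n := 4) hX h4 hL hA hAL.symm
  have fin : ∀ A B D, Four 5 X L A B D → P ∈ A → False := by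
    intro A B D F pA
    have pL := hon P hU
    have pB : P ∉ B := fun h => no_three F.g.1 F.mL F.mA F.mB F.LA F.LB F.AB pL pA h
    have pD : P ∉ D := fun h => no_three F.g.1 F.mL F.mA F.mD F.LA F.LD F.AD pL pA h
    obtain ⟨N, n1, n2, -⟩ := st P hU B F.mB pB
    obtain ⟨N', n1', n2', -⟩ := st P hU D F.mD pD
    exact five_core F hb hU hLn hon (hH A F.mA F.LA) ⟨N, n1, n2⟩ ⟨N', n1', n2'⟩ pA
  have f1 : P ∉ A := fin A B D F
  have f2 : P ∉ B := fin B D A F.rot3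
  have f3 : P ∉ D := fin D A B F.rot3.rot3
  have := peel_count {A, B, D} K P 5 X hX hU (by
    intro M hM
    simp only [Finset.mem_insert, Finset.mem_singleton] at hM
    rcases hM with rfl | rfl | rfl
    · exact ⟨F.mA, f1, kne _ F.mA, st P hU _ F.mA f1⟩
    · exact ⟨F.mB, f2, kne _ F.mB, st P hU _ F.mB f2⟩
    · exact ⟨F.mD, f3, kne _ F.mD, st P hU _ F.mD f3⟩)
  rw [Finset.card_eq_three.2 ⟨A, B, D, F.AB, F.AD, F.BD, rfl⟩] at this
  omega

theorem mx_through_le {n : ℕ} {X : Finset (ℝ × ℝ)} (hX : G (n + 1) X) (A : ℝ × ℝ) :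
    ∃ S : Finset (Set (ℝ × ℝ)), (∀ L ∈ S, Mx (n + 1) X L ∧ A ∉ L) ∧ mm (n + 1) X ≤ S.card + 2 := by
  classical
  refine ⟨(finite_mx n X).toFinset.filter (fun L => A ∉ L), ?_, ?_⟩
  · intro L hL
    rw [Finset.mem_filter, Set.Finite.mem_toFinset] at hL
    exact hL
  · have e := Finset.card_filter_add_card_filter_not (s := (finite_mx n X).toFinset) (p := fun L => A ∉ L)
    rw [← Set.ncard_eq_toFinset_card _ (finite_mx n X)] at e
    change _ = mm (n + 1) X at e
    have : ((finite_mx n X).toFinset.filter (fun L => ¬ A ∉ L)).card ≤ 2 := by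
      by_contra hcon
      obtain ⟨a, b, c, ha, hb, hc, hab, hac, hbc⟩ := Finset.two_lt_card_iff.1 (not_le.1 hcon)
      simp only [Finset.mem_filter, Set.Finite.mem_toFinset, not_not] at ha hb hc
      exact no_three hX.1 ha.1 hb.1 hc.1 hab hac hbc ha.2 hb.2 hc.2
    omega

theorem claim : ∀ (n : ℕ) (X : Finset (ℝ × ℝ)) (K : Set (ℝ × ℝ)) (A : ℝ × ℝ), G n X → Us n X K A → Cl n X K := by
  intro n
  induction n with
  | zero => intro X K A _ h; exact (us_zero h).elim
  | succ n ih =>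
    intro X K A hX hU
    have h3 := three_le_mm hX
    by_cases e3 : mm (n + 1) X = 3
    · exact cl_three hX e3 hU
    by_contra hb
    rcases n with _ | n
    · have := mm_le hX
      omega
    have st : ∀ Q, Us (n + 1 + 1) X K Q → ∀ M, Mx (n + 1 + 1) X M → Q ∉ M → ∃ N, Nx (n + 1 + 1) X M N ∧ Q ∉ N ∧ K ≠ N :=
      fun Q hQ M hM hQM => star hX (fun Y hY hUY => ih Y K Q hY hUY) hb hQ hM hQM
    obtain ⟨S, hS, hc⟩ := mx_through_le hX A
    have p := peel_count S K A _ X hX hU (by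
      intro L hL
      obtain ⟨h1, h2⟩ := hS L hL
      exact ⟨h1, h2, fun h => hb (Or.inl (h ▸ h1)), st A hU L h1 h2⟩)
    have q := class_lemma _ X hX (by omega)
    have e4 : mm (n + 1 + 1) X = 4 := by omega
    obtain rfl : n = 3 := by omega
    exact five_lemma hX e4 hb hU st

theorem uses_card : ∀ (n : ℕ) (X : Finset (ℝ × ℝ)) (K : Set (ℝ × ℝ)) (U : Finset (ℝ × ℝ)), G n X →
    (∀ A, A ∈ U ↔ Us n X K A) → U.Nonempty →
    ∃ s : ℕ, 2 * cnt X K ≤ s + n + 1 ∧ s ≤ cnt X K ∧ U.card = s.choose 2 := by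
  intro n
  induction n using Nat.strong_induction_on with
  | _ n ih =>
    intro X K U hX hU hne
    obtain ⟨A, hA⟩ := hne
    have hA' := (hU A).1 hA
    rcases n with _ | n
    · exact (us_zero hA').elim
    rcases claim _ X K A hX hA' with h | ⟨M, hM, hd⟩ | ⟨M, M', P, hM, hM', hMM, hP, p1, p2, p3⟩
    · refine ⟨n + 2, by rw [h.2]; omega, by rw [h.2], ?_⟩
      have e : U = rm X K := by
        ext B
        rw [hU, mem_rm]
        exact ⟨fun h' => ⟨h'.1, h'.not_mem⟩, fun h' => us_mx hX.1 h h'.1 h'.2⟩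
      rw [e, (hX.rm h).1.1.1]
    · by_cases hK : Mx (n + 1) X K
      · obtain ⟨Q, q1, q2, q3⟩ := meet hX.1 hM hK
        exact absurd q3 (hd Q q1 q2)
      have e : ∀ B, B ∈ U ↔ Us n (rm X M) K B := by
        intro B
        rw [hU]
        constructor
        · intro h'
          have hBM : B ∉ M := fun hB => us_disj hM hd hB h'
          exact (us_down hM hBM h').resolve_left (by rintro rfl; exact hK hM)
        · exact fun h' => us_up hM.1 h'
      obtain ⟨s, s1, s2, s3⟩ := ih n (by omega) _ K U (hX.rm hM) e ⟨A, hA⟩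
      rw [cnt_rm_disj hd] at s1 s2
      exact ⟨s, by omega, s2, s3⟩
    · by_cases hK : Mx (n + 1) X K
      · refine ⟨n + 2, by rw [hK.2]; omega, by rw [hK.2], ?_⟩
        have e : U = rm X K := by
          ext B
          rw [hU, mem_rm]
          exact ⟨fun h' => ⟨h'.1, h'.not_mem⟩, fun h' => us_mx hX.1 hK h'.1 h'.2⟩
        rw [e, (hX.rm hK).1.1.1]
      have k1 : K ≠ M := by rintro rfl; exact hK hM
      have k2 : K ≠ M' := by rintro rfl; exact hK hM'
      rcases n with _ | n
      · exact absurd (us_one hX hA') hK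
      have hM2 : Mx (n + 1) (rm X M) M' := mx_rm hX.1 hM hM' hMM
      have e : ∀ B, B ∈ U ↔ Us n (rm (rm X M) M') K B := by
        intro B
        rw [hU]
        constructor
        · intro h'
          have hB : B ∉ M := fun hB => us_adj hX.1 hM hM' hMM p1 p2 p3 k1 k2 hB h'
          have hB' : B ∉ M' := fun hB => us_adj hX.1 hM' hM hMM.symm p2 p1 p3 k2 k1 hB h'
          exact (us_down hM2 hB' ((us_down hM hB h').resolve_left k1)).resolve_left k2
        · exact fun h' => us_up hM.1 (us_up hM'.1 h')
      have c1 := cnt_rm_inter hM.1 hA'.line k1.symm hP p1 p3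
      have c2 : cnt (rm (rm X M) M') K = cnt (rm X M) K := by
        apply cnt_rm_disj
        intro Q q1 q2 q3
        rw [mem_rm] at q1
        have := pt_eq hM'.1 hA'.line k2.symm q2 p2 q3 p3
        exact q1.2 (this ▸ p1)
      obtain ⟨s, s1, s2, s3⟩ := ih n (by omega) _ K U ((hX.rm hM).rm hM2) e ⟨A, hA⟩
      rw [c2] at s1 s2
      exact ⟨s, by omega, by omega, s3⟩

theorem mem_usesSet_iff {n : ℕ} {X : Finset (ℝ × ℝ)} {l : Poly2} (hl : l.totalDegree = 1) (A : ℝ × ℝ) :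
    A ∈ usesSet n X l ↔ Us n X (zeroSet l) A := by
  have : A ∈ usesSet n X l ↔ A ∈ X ∧ Uses n X l A := by simp [usesSet]
  rw [this]
  constructor
  · rintro ⟨h, p, hp, hd⟩
    exact ⟨h, l, p, hl, rfl, hp, hd⟩
  · rintro ⟨h, l', p, hl', e, hp, hd⟩
    exact ⟨h, p, hp, (dvd_of_zeroSet hl hl' e).trans hd⟩

/-- Assuming GM up to degree `n`, for a `GC_n` set `X` and a `k`-node line `ℓ`
with `2 ≤ k ≤ n+1`, either `X_ℓ = ∅` or `|X_ℓ| = (s choose 2)` for some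
`2k - n - 1 ≤ s ≤ k`. -/
theorem stmt_0 (n k : ℕ) (hGM : ∀ m ≤ n, GM m)
    (X : Finset (ℝ × ℝ)) (hX : IsGC n X)
    (ℓ : Poly2) (hk2 : 2 ≤ k) (hkn : k ≤ n + 1) (hℓ : IsKNodeLine X ℓ k) :
    usesSet n X ℓ = ∅ ∨
      ∃ s : ℕ, (2 * k : ℤ) - n - 1 ≤ (s : ℤ) ∧ s ≤ k ∧
        (usesSet n X ℓ).card = s.choose 2 := by
  rcases Finset.eq_empty_or_nonempty (usesSet n X ℓ) with h | h
  · exact Or.inl h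
  · right
    obtain ⟨s, s1, s2, s3⟩ := uses_card n X (zeroSet ℓ) (usesSet n X ℓ) ⟨hX, hGM⟩ (mem_usesSet_iff hℓ.1) h
    have e : cnt X (zeroSet ℓ) = k := by
      rw [cnt, ← nodesOn_eq]; exact hℓ.2
    rw [e] at s1 s2
    exact ⟨s, by omega, s2, s3⟩
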